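/- Let k ≥ 2 and G be a graph with |G| ≥ 3k, |H_k(G)| ≥ 2k, and minimum degree δ(G) ≥ 2k − 1 (equivalently L_k(G) = ∅). Then G contains k vertex-disjoint cycles. -/

import Mathlib

/-- `G` contains `k` pairwise vertex-disjoint cycles. -/
def HasDisjointCycles {V : Type*} (G : SimpleGraph V) (k : ℕ) : Prop :=
  ∃ c : Fin k → (v : V) × G.Walk v v,
    (∀ i, (c i).2.IsCycle) ∧
    ∀ i j, i ≠ j → List.Disjoint (c i).2.support (c j).2.support

/-- `H_k(G)`: the set of vertices of degree at least `2k`. -/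
def highSet {V : Type*} [Fintype V] (G : SimpleGraph V) [DecidableRel G.Adj] (k : ℕ) :
    Finset V :=
  Finset.univ.filter fun v => 2 * k ≤ G.degree v

/-- `L_k(G)`: the set of vertices of degree at most `2k - 2`. -/
def lowSet {V : Type*} [Fintype V] (G : SimpleGraph V) [DecidableRel G.Adj] (k : ℕ) :
    Finset V :=
  Finset.univ.filter fun v => G.degree v ≤ 2 * k - 2

namespace DisjointCycles

/-- The patterns of adjacency between a path `x y z` and a triangle that are excluded. -/
def triRule (x1 x2 x3 y1 y2 y3 z1 z2 z3 : Bool) : Bool :=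
  !(x1 && y1 && z2 && z3) && !(x2 && y2 && z1 && z3) && !(x3 && y3 && z1 && z2) &&
  !(z1 && y1 && x2 && x3) && !(z2 && y2 && x1 && x3) && !(z3 && y3 && x1 && x2)

theorem not_and_four {p q r s : Prop} [Decidable p] [Decidable q] [Decidable r] [Decidable s]
    (h : p → q → r → s → False) :
    (!(decide p && decide q && decide r && decide s)) = true := by
  by_cases p <;> by_cases q <;> by_cases r <;> by_cases s <;> simp_all

theorem triRule_mid_eq_zero : ∀ x1 x2 x3 y1 y2 y3 z1 z2 z3 : Bool,
    triRule x1 x2 x3 y1 y2 y3 z1 z2 z3 →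
    5 ≤ x1.toNat + x2.toNat + x3.toNat + (z1.toNat + z2.toNat + z3.toNat) →
    y1 = false ∧ y2 = false ∧ y3 = false := by decide

set_option maxRecDepth 4000 in
theorem triRule_five : ∀ x1 x2 x3 y1 y2 y3 z1 z2 z3 : Bool,
    triRule x1 x2 x3 y1 y2 y3 z1 z2 z3 → ∀ d1 d2 d3 : Bool,
    triRule y1 y2 y3 x1 x2 x3 d1 d2 d3 →
    !(y1 && z1 && d2 && d3) → !(y2 && z2 && d1 && d3) → !(y3 && z3 && d1 && d2) →
    9 ≤ x1.toNat + x2.toNat + x3.toNat + (y1.toNat + y2.toNat + y3.toNat) +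
      (z1.toNat + z2.toNat + z3.toNat) + (d1.toNat + d2.toNat + d3.toNat) →
    x1 ∧ x2 ∧ x3 ∧ z1 ∧ z2 ∧ z3 := by decide

set_option maxRecDepth 4000 in
theorem triRule_six : ∀ x1 x2 x3 y1 y2 y3 z1 z2 z3 : Bool,
    triRule x1 x2 x3 y1 y2 y3 z1 z2 z3 → ∀ d1 d2 d3 : Bool,
    triRule y1 y2 y3 x1 x2 x3 d1 d2 d3 → triRule y1 y2 y3 z1 z2 z3 d1 d2 d3 →
    x1.toNat + x2.toNat + x3.toNat + (z1.toNat + z2.toNat + z3.toNat) +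
      2 * (y1.toNat + y2.toNat + y3.toNat) + 2 * (d1.toNat + d2.toNat + d3.toNat) ≤ 12 := by
  decide

/-- Both ends of the path see the vertex `1` of the triangle, the middle sees the others. -/
def patMid (x1 y2 y3 z1 : Bool) : Bool := x1 && z1 && y2 && y3

/-- The ends see the vertices `2, 3`, the middle sees `1` only, the outer vertex sees all. -/
def patAll (x1 x2 x3 y1 y2 y3 z1 z2 z3 d1 d2 d3 : Bool) : Bool :=
  !x1 && x2 && x3 && y1 && !y2 && !y3 && !z1 && z2 && z3 && d1 && d2 && d3

/-- All four vertices see exactly `2` and `3`. -/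
def patSame (x1 x2 x3 y1 y2 y3 z1 z2 z3 d1 d2 d3 : Bool) : Bool :=
  !x1 && x2 && x3 && !y1 && y2 && y3 && !z1 && z2 && z3 && !d1 && d2 && d3

set_option maxRecDepth 4000 in
theorem triRule_pattern : ∀ x1 x2 x3 y1 y2 y3 z1 z2 z3 : Bool,
    triRule x1 x2 x3 y1 y2 y3 z1 z2 z3 →
    x1.toNat + x2.toNat + x3.toNat + (z1.toNat + z2.toNat + z3.toNat) = 4 → ∀ d1 d2 d3 : Bool,
    triRule y1 y2 y3 x1 x2 x3 d1 d2 d3 → triRule y1 y2 y3 z1 z2 z3 d1 d2 d3 →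
    (y1.toNat + y2.toNat + y3.toNat) + (d1.toNat + d2.toNat + d3.toNat) = 4 →
    (patMid x1 y2 y3 z1 || patMid x2 y1 y3 z2 || patMid x3 y1 y2 z3 ||
    patAll x1 x2 x3 y1 y2 y3 z1 z2 z3 d1 d2 d3 ||
    patAll x2 x1 x3 y2 y1 y3 z2 z1 z3 d2 d1 d3 ||
    patAll x3 x1 x2 y3 y1 y2 z3 z1 z2 d3 d1 d2 ||
    patSame x1 x2 x3 y1 y2 y3 z1 z2 z3 d1 d2 d3 ||
    patSame x2 x1 x3 y2 y1 y3 z2 z1 z3 d2 d1 d3 ||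
    patSame x3 x1 x2 y3 y1 y2 z3 z1 z2 d3 d1 d2) = true := by
  decide

/-- The excluded adjacencies between a triangle and the ends `x`, `y` of a longest path together
with another leaf `z`. -/
def leafRule (x1 x2 x3 y1 y2 y3 z1 z2 z3 : Bool) : Bool :=
  !(z2 && z3 && x1) && !(z1 && z3 && x2) && !(z1 && z2 && x3) &&
  !(z2 && z3 && y1) && !(z1 && z3 && y2) && !(z1 && z2 && y3) &&
  !(x2 && x3 && y1 && z1) && !(x1 && x3 && y2 && z2) && !(x1 && x2 && y3 && z3) &&
  !(y2 && y3 && x1 && z1) && !(y1 && y3 && x2 && z2) && !(y1 && y2 && x3 && z3)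

theorem not_and_three {p q r : Prop} [Decidable p] [Decidable q] [Decidable r]
    (h : p → q → r → False) : (!(decide p && decide q && decide r)) = true := by
  by_cases p <;> by_cases q <;> by_cases r <;> simp_all

theorem leafRule_sum : ∀ x1 x2 x3 y1 y2 y3 z1 z2 z3 : Bool,
    leafRule x1 x2 x3 y1 y2 y3 z1 z2 z3 →
    x1.toNat + x2.toNat + x3.toNat + (y1.toNat + y2.toNat + y3.toNat) +
      (z1.toNat + z2.toNat + z3.toNat) ≤ 6 ∧
    (x1.toNat + x2.toNat + x3.toNat + (y1.toNat + y2.toNat + y3.toNat) +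
      (z1.toNat + z2.toNat + z3.toNat) = 6 →
    z1.toNat + z2.toNat + z3.toNat ≤ 2 ∧ (z1.toNat + z2.toNat + z3.toNat = 2 →
      z1 = x1 ∧ z2 = x2 ∧ z3 = x3 ∧ z1 = y1 ∧ z2 = y2 ∧ z3 = y3)) := by decide

/-- Two of the four adjacencies from an edge to two adjacent vertices. -/
def twoOfFour (c2 c3 d2 d3 : Bool) : Bool :=
  (c2 && c3) || (d2 && d3) || (c2 && d2) || (c3 && d3) || (c2 && d3) || (c3 && d2)

/-- The excluded adjacencies between a triangle and the first two vertices `a`, `b` of a longest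
path with last two vertices `c`, `d`. -/
def halfRule (a1 a2 a3 b1 b2 b3 c1 c2 c3 d1 d2 d3 : Bool) : Bool :=
  !(a1 && b1 && twoOfFour c2 c3 d2 d3) && !(a2 && b2 && twoOfFour c1 c3 d1 d3) &&
  !(a3 && b3 && twoOfFour c1 c2 d1 d2) &&
  !(a2 && a3 && ((b1 && c1) || (b1 && d1) || (c1 && d1))) &&
  !(a1 && a3 && ((b2 && c2) || (b2 && d2) || (c2 && d2))) &&
  !(a1 && a2 && ((b3 && c3) || (b3 && d3) || (c3 && d3)))

/-- `b` sees the whole triangle, `a` two vertices, and each of them is seen by one of `c`, `d`. -/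
def tightRule (a1 a2 a3 b1 b2 b3 c1 c2 c3 d1 d2 d3 : Bool) : Bool :=
  b1 && b2 && b3 && decide (a1.toNat + a2.toNat + a3.toNat = 2) &&
  (a1 == xor c1 d1) && (a2 == xor c2 d2) && (a3 == xor c3 d3)

set_option maxRecDepth 10000 in
theorem halfRule_sum : ∀ a1 a2 a3 b1 b2 b3 c1 c2 c3 d1 d2 d3 : Bool,
    halfRule a1 a2 a3 b1 b2 b3 c1 c2 c3 d1 d2 d3 → halfRule d1 d2 d3 c1 c2 c3 b1 b2 b3 a1 a2 a3 →
    a1.toNat + a2.toNat + a3.toNat + (b1.toNat + b2.toNat + b3.toNat) +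
      (c1.toNat + c2.toNat + c3.toNat) + (d1.toNat + d2.toNat + d3.toNat) ≤ 7 ∧
    (a1.toNat + a2.toNat + a3.toNat + (b1.toNat + b2.toNat + b3.toNat) +
      (c1.toNat + c2.toNat + c3.toNat) + (d1.toNat + d2.toNat + d3.toNat) = 7 →
      tightRule a1 a2 a3 b1 b2 b3 c1 c2 c3 d1 d2 d3 ∨
      tightRule d1 d2 d3 c1 c2 c3 b1 b2 b3 a1 a2 a3) := by
  decide

open Finset Classical

section

variable {V : Type*} {G : SimpleGraph V}

/-- The number of neighbours of `v` in `S`. -/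
noncomputable def nb (G : SimpleGraph V) (v : V) (S : Finset V) : ℕ :=
  (S.filter (G.Adj v)).card

/-- A nonempty vertex set inducing a subgraph of minimum degree at least two. -/
def Core (G : SimpleGraph V) (S : Finset V) : Prop :=
  S.Nonempty ∧ ∀ v ∈ S, 2 ≤ nb G v S

theorem nb_mono (v : V) {S T : Finset V} (h : S ⊆ T) : nb G v S ≤ nb G v T :=
  card_le_card (filter_subset_filter _ h)

theorem nb_le_card (v : V) (S : Finset V) : nb G v S ≤ S.card := card_filter_le _ _

theorem nb_insert (v : V) {a : V} {S : Finset V} (h : a ∉ S) :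
    nb G v (insert a S) = (decide (G.Adj v a)).toNat + nb G v S := by
  unfold nb
  by_cases hv : G.Adj v a
  · rw [filter_insert, if_pos hv, card_insert_of_notMem (by simp [h])]
    simp [hv, add_comm]
  · rw [filter_insert, if_neg hv]
    simp [hv]

theorem nb_singleton (v a : V) : nb G v {a} = (decide (G.Adj v a)).toNat := by
  have := nb_insert (G := G) v (notMem_empty a)
  simpa [nb] using this

theorem nb_pair (v : V) {a b : V} (h : a ≠ b) :
    nb G v {a, b} = (decide (G.Adj v a)).toNat + (decide (G.Adj v b)).toNat := by
  rw [nb_insert v (by simpa using h), nb_singleton]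

theorem nb_triple (v : V) {a b c : V} (hab : a ≠ b) (hac : a ≠ c) (hbc : b ≠ c) :
    nb G v {a, b, c} = (decide (G.Adj v a)).toNat + (decide (G.Adj v b)).toNat +
      (decide (G.Adj v c)).toNat := by
  rw [nb_insert v (by simp [hab, hac]), nb_pair v hbc, add_assoc]

theorem nb_eq_sum (v : V) (S : Finset V) :
    nb G v S = ∑ u ∈ S, (decide (G.Adj v u)).toNat := by
  unfold nb
  rw [card_filter]
  refine sum_congr rfl fun u _ => ?_
  by_cases h : G.Adj v u <;> simp [h]

theorem sum_nb_comm (S T : Finset V) : ∑ v ∈ S, nb G v T = ∑ v ∈ T, nb G v S := by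
  simp only [nb_eq_sum]
  rw [sum_comm]
  simp [G.adj_comm]

theorem one_le_nb {v : V} {S : Finset V} : 1 ≤ nb G v S ↔ ∃ u ∈ S, G.Adj v u := by
  unfold nb
  rw [Nat.one_le_iff_ne_zero, Ne, card_eq_zero, ← Ne, ← nonempty_iff_ne_empty]
  simp [Finset.Nonempty]

theorem two_le_nb {v : V} {S : Finset V} :
    2 ≤ nb G v S ↔ ∃ u ∈ S, ∃ w ∈ S, u ≠ w ∧ G.Adj v u ∧ G.Adj v w := by
  unfold nb
  rw [← Nat.lt_iff_add_one_le, one_lt_card]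
  simp only [mem_filter]
  constructor
  · rintro ⟨a, ⟨ha, ha'⟩, b, ⟨hb, hb'⟩, h⟩
    exact ⟨a, ha, b, hb, h, ha', hb'⟩
  · rintro ⟨a, ha, b, hb, h, ha', hb'⟩
    exact ⟨a, ⟨ha, ha'⟩, b, ⟨hb, hb'⟩, h⟩

theorem eq_of_nb_le_one {v : V} {S : Finset V} (h : nb G v S ≤ 1) {a b : V} (ha : a ∈ S)
    (hb : b ∈ S) (hva : G.Adj v a) (hvb : G.Adj v b) : a = b := by
  by_contra hab
  have := two_le_nb.2 ⟨a, ha, b, hb, hab, hva, hvb⟩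
  omega

theorem core_of {S : Finset V} (hne : S.Nonempty)
    (h : ∀ v ∈ S, ∃ u ∈ S, ∃ w ∈ S, u ≠ w ∧ G.Adj v u ∧ G.Adj v w) : Core G S :=
  ⟨hne, fun v hv => two_le_nb.2 (h v hv)⟩

theorem core_triple {a b c : V} (hab : G.Adj a b) (hac : G.Adj a c) (hbc : G.Adj b c) :
    Core G {a, b, c} := by
  refine core_of (by simp) fun v hv => ?_
  simp only [mem_insert, mem_singleton] at hv
  rcases hv with rfl | rfl | rfl
  · exact ⟨b, by simp, c, by simp, hbc.ne, hab, hac⟩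
  · exact ⟨a, by simp, c, by simp, hac.ne, hab.symm, hbc⟩
  · exact ⟨a, by simp, b, by simp, hab.ne, hac.symm, hbc.symm⟩

theorem core_quad {a b c d : V} (hab : G.Adj a b) (hbc : G.Adj b c) (hcd : G.Adj c d)
    (hda : G.Adj d a) (hac : a ≠ c) (hbd : b ≠ d) : Core G {a, b, c, d} := by
  refine core_of (by simp) fun v hv => ?_
  simp only [mem_insert, mem_singleton] at hv
  rcases hv with rfl | rfl | rfl | rfl
  · exact ⟨b, by simp, d, by simp, hbd, hab, hda.symm⟩
  · exact ⟨a, by simp, c, by simp, hac, hab.symm, hbc⟩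
  · exact ⟨b, by simp, d, by simp, hbd, hbc.symm, hcd⟩
  · exact ⟨a, by simp, c, by simp, hac, hda, hcd.symm⟩

theorem Core.three_le_card {S : Finset V} (h : Core G S) : 3 ≤ S.card := by
  obtain ⟨v, hv⟩ := h.1
  obtain ⟨u, hu, w, hw, huw, h1, h2⟩ := two_le_nb.1 (h.2 v hv)
  have : ({v, u, w} : Finset V) ⊆ S := by
    intro z hz
    simp only [mem_insert, mem_singleton] at hz
    rcases hz with rfl | rfl | rfl <;> assumption
  refine le_trans ?_ (card_le_card this)
  rw [card_eq_three.2 ⟨v, u, w, h1.ne, h2.ne, huw, rfl⟩]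

/-- A vertex set containing no `Core` spans a forest. -/
theorem sum_nb_le_of_no_core (X : Finset V) (hX : X.Nonempty) (h : ∀ S ⊆ X, ¬ Core G S) :
    ∑ v ∈ X, nb G v X ≤ 2 * (X.card - 1) := by
  induction X using Finset.strongInduction with
  | H X ih =>
    have hX' := h X subset_rfl
    simp only [Core, not_and, not_forall, exists_prop] at hX'
    obtain ⟨v, hv, hv2⟩ := hX' hX
    rcases (X.erase v).eq_empty_or_nonempty with he | hne
    · have : X = {v} := by
        rw [erase_eq_empty_iff] at he
        rcases he with he | he
        · exact absurd he hX.ne_empty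
        · exact he
      subst this
      simp [nb_singleton]
    · have := ih (X.erase v) (erase_ssubset hv) hne
        fun S hS => h S (hS.trans (erase_subset _ _))
      have hXe : X = insert v (X.erase v) := (insert_erase hv).symm
      have hcard := card_erase_of_mem hv
      have hpos := hne.card_pos
      have e1 : ∑ u ∈ X, nb G u X = nb G v X + ∑ u ∈ X.erase v, nb G u X := by
        rw [← add_sum_erase _ _ hv]
      have e2 : ∑ u ∈ X.erase v, nb G u X
          = ∑ u ∈ X.erase v, ((decide (G.Adj u v)).toNat + nb G u (X.erase v)) := by
        refine sum_congr rfl fun u _ => ?_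
        conv_lhs => rw [hXe]
        exact nb_insert u (notMem_erase v X)
      have e3 : ∑ u ∈ X.erase v, (decide (G.Adj u v)).toNat = nb G v (X.erase v) := by
        rw [nb_eq_sum]; simp [G.adj_comm]
      have e4 := nb_mono (G := G) v (erase_subset v X)
      rw [e1, e2, sum_add_distrib, e3]
      omega

/-- `p 0, …, p (n - 1)` is a path inside `X`. -/
structure IsP (G : SimpleGraph V) (p : ℕ → V) (n : ℕ) (X : Finset V) : Prop where
  mem : ∀ i < n, p i ∈ X
  inj : ∀ i < n, ∀ j < n, p i = p j → i = j
  adj : ∀ i, i + 1 < n → G.Adj (p i) (p (i + 1))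

namespace IsP

variable {p : ℕ → V} {n : ℕ} {X : Finset V}

theorem take (h : IsP G p n X) {k : ℕ} (hk : k ≤ n) : IsP G p k X :=
  ⟨fun i hi => h.mem i (by omega), fun i hi j hj => h.inj i (by omega) j (by omega),
    fun i hi => h.adj i (by omega)⟩

theorem drop (h : IsP G p n X) (k : ℕ) : IsP G (fun i => p (i + k)) (n - k) X :=
  ⟨fun i hi => h.mem _ (by omega),
    fun i hi j hj hij => by have := h.inj _ (by omega) _ (by omega) hij; omega,
    fun i hi => by
      have := h.adj (i + k) (by omega)
      rwa [show i + k + 1 = i + 1 + k by omega] at this⟩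

theorem rev (h : IsP G p n X) : IsP G (fun i => p (n - 1 - i)) n X :=
  ⟨fun i hi => h.mem _ (by omega),
    fun i hi j hj hij => by have := h.inj _ (by omega) _ (by omega) hij; omega,
    fun i hi => by
      have := h.adj (n - 1 - (i + 1)) (by omega)
      rw [show n - 1 - (i + 1) + 1 = n - 1 - i by omega] at this
      exact this.symm⟩

theorem ne (h : IsP G p n X) {i j : ℕ} (hi : i < n) (hj : j < n) (hij : i ≠ j) : p i ≠ p j :=
  fun e => hij (h.inj i hi j hj e)

theorem cons (h : IsP G p n X) {c : V} (hc : c ∈ X) (hcp : ∀ i < n, p i ≠ c)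
    (hadj : 0 < n → G.Adj c (p 0)) :
    IsP G (fun i => if i = 0 then c else p (i - 1)) (n + 1) X := by
  refine ⟨fun i hi => ?_, fun i hi j hj hij => ?_, fun i hi => ?_⟩
  · rcases i with _ | i
    · simpa using hc
    · simpa using h.mem i (by omega)
  · rcases i with _ | i <;> rcases j with _ | j
    · rfl
    · simp at hij
      exact absurd hij.symm (hcp j (by omega))
    · simp at hij
      exact absurd hij (hcp i (by omega))
    · simp at hij
      rw [h.inj i (by omega) j (by omega) hij]
  · rcases i with _ | i
    · simpa using hadj (by omega)
    · simpa using h.adj i (by omega)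

theorem snoc (h : IsP G p n X) {c : V} (hc : c ∈ X) (hcp : ∀ i < n, p i ≠ c)
    (hadj : 0 < n → G.Adj (p (n - 1)) c) :
    IsP G (fun i => if i < n then p i else c) (n + 1) X := by
  refine ⟨fun i hi => ?_, fun i hi j hj hij => ?_, fun i hi => ?_⟩
  · split_ifs with h1
    · exact h.mem i h1
    · exact hc
  · split_ifs at hij with h1 h2 h2
    · exact h.inj i h1 j h2 hij
    · exact absurd hij (hcp i h1)
    · exact absurd hij.symm (hcp j h2)
    · omega
  · rw [if_pos (by omega)]
    split_ifs with h1
    · exact h.adj i h1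
    · have : i = n - 1 := by omega
      subst this
      exact hadj (by omega)

theorem single {c : V} (hc : c ∈ X) : IsP G (fun _ => c) 1 X :=
  ⟨fun _ _ => hc, fun i hi j hj _ => by omega, fun i hi => by omega⟩

theorem card_le (h : IsP G p n X) : n ≤ X.card := by
  have : ((range n).image p).card = n := by
    rw [card_image_of_injOn, card_range]
    intro i hi j hj hij
    exact h.inj i (by simpa using hi) j (by simpa using hj) hij
  rw [← this]
  refine card_le_card ?_
  intro v hv
  simp only [mem_image, mem_range] at hv
  obtain ⟨i, hi, rfl⟩ := hv
  exact h.mem i hi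

theorem card_arc (h : IsP G p n X) {i j : ℕ} (hj : j < n) :
    ((Icc i j).image p).card = j + 1 - i := by
  rw [card_image_of_injOn, Nat.card_Icc]
  intro a ha b hb hab
  simp only [coe_Icc, Set.mem_Icc] at ha hb
  exact h.inj a (by omega) b (by omega) hab

theorem arc_subset (h : IsP G p n X) {i j : ℕ} (hj : j < n) : (Icc i j).image p ⊆ X := by
  intro v hv
  simp only [mem_image, mem_Icc] at hv
  obtain ⟨a, ha, rfl⟩ := hv
  exact h.mem a (by omega)

theorem mem_arc {i j a : ℕ} (h1 : i ≤ a) (h2 : a ≤ j) : p a ∈ (Icc i j).image p :=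
  mem_image_of_mem _ (by simp [h1, h2])

theorem disjoint_arc (h : IsP G p n X) {i j i' j' : ℕ} (hj : j < n) (hj' : j' < n)
    (hd : j < i' ∨ j' < i) : Disjoint ((Icc i j).image p) ((Icc i' j').image p) := by
  rw [disjoint_left]
  intro v hv hv'
  simp only [mem_image, mem_Icc] at hv hv'
  obtain ⟨a, ha, rfl⟩ := hv
  obtain ⟨b, hb, hab⟩ := hv'
  have := h.inj b (by omega) a (by omega) hab
  omega

/-- An arc, enlarged by a set `T` which supplies every vertex of `T` with two neighbours and
each end of the arc with a further one, is a core. -/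
theorem core_arc (h : IsP G p n X) {i j : ℕ} (hij : i < j) (hj : j < n) (T : Finset V)
    (hT : ∀ v ∈ T, 2 ≤ nb G v (T ∪ (Icc i j).image p))
    (hi : ∃ u ∈ T ∪ (Icc i j).image p, u ≠ p (i + 1) ∧ G.Adj (p i) u)
    (hj' : ∃ u ∈ T ∪ (Icc i j).image p, u ≠ p (j - 1) ∧ G.Adj (p j) u) :
    Core G (T ∪ (Icc i j).image p) := by
  have marc : ∀ a, i ≤ a → a ≤ j → p a ∈ T ∪ (Icc i j).image p := fun a h1 h2 =>
    mem_union_right _ (mem_arc h1 h2)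
  refine ⟨⟨p i, marc i le_rfl hij.le⟩, fun v hv => ?_⟩
  rcases mem_union.1 hv with hv | hv
  · exact hT v hv
  simp only [mem_image, mem_Icc] at hv
  obtain ⟨a, ⟨h1, h2⟩, rfl⟩ := hv
  rw [two_le_nb]
  rcases h1.eq_or_lt with rfl | h1
  · obtain ⟨u, hu, hne, hadj⟩ := hi
    exact ⟨u, hu, p (i + 1), marc _ (by omega) (by omega), hne, hadj, h.adj i (by omega)⟩
  have hprev : G.Adj (p a) (p (a - 1)) := by
    have := h.adj (a - 1) (by omega)
    rw [show a - 1 + 1 = a by omega] at this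
    exact this.symm
  rcases h2.eq_or_lt with rfl | h2
  · obtain ⟨u, hu, hne, hadj⟩ := hj'
    exact ⟨u, hu, p (a - 1), marc _ (by omega) (by omega), hne, hadj, hprev⟩
  · exact ⟨p (a - 1), marc _ (by omega) (by omega), p (a + 1), marc _ (by omega) (by omega),
      h.ne (by omega) (by omega) (by omega), hprev, h.adj a (by omega)⟩

theorem core_chord (h : IsP G p n X) {i j : ℕ} (hij : i + 2 ≤ j) (hj : j < n)
    (hadj : G.Adj (p i) (p j)) : Core G ((Icc i j).image p) := by
  have := h.core_arc (i := i) (j := j) (by omega) hj ∅ (by simp)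
    ⟨p j, by simpa using ⟨j, by omega, rfl⟩, h.ne (by omega) (by omega) (by omega), hadj⟩
    ⟨p i, by simpa using ⟨i, by omega, rfl⟩, h.ne (by omega) (by omega) (by omega), hadj.symm⟩
  simpa using this

theorem core_vertex (h : IsP G p n X) {i j : ℕ} (hij : i < j) (hj : j < n) {c : V}
    (hc : c ∉ X) (hi : G.Adj c (p i)) (hj' : G.Adj c (p j)) :
    Core G (insert c ((Icc i j).image p)) := by
  have hne : ∀ a < n, c ≠ p a := fun a ha e => hc (e ▸ h.mem a ha)
  have := h.core_arc (i := i) (j := j) hij hj {c} (by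
      intro v hv
      rw [mem_singleton] at hv
      subst hv
      rw [two_le_nb]
      exact ⟨p i, mem_union_right _ (mem_arc le_rfl hij.le), p j,
        mem_union_right _ (mem_arc hij.le le_rfl), h.ne (by omega) hj (by omega), hi, hj'⟩)
    ⟨c, by simp, hne _ (by omega), hi.symm⟩ ⟨c, by simp, hne _ (by omega), hj'.symm⟩
  exact this

theorem core_edge (h : IsP G p n X) {i j : ℕ} (hij : i ≤ j) (hj : j < n) {c c' : V}
    (hc : c ∉ X) (hc' : c' ∉ X) (hcc : G.Adj c c') (hi : G.Adj c (p i)) (hj' : G.Adj c' (p j)) :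
    Core G (insert c (insert c' ((Icc i j).image p))) := by
  rcases hij.eq_or_lt with rfl | hij
  · have := core_triple hcc hi hj'
    simpa using this
  have hne : ∀ a < n, c ≠ p a := fun a ha e => hc (e ▸ h.mem a ha)
  have hne' : ∀ a < n, c' ≠ p a := fun a ha e => hc' (e ▸ h.mem a ha)
  have := h.core_arc (i := i) (j := j) hij hj {c, c'} (by
      intro v hv
      rw [mem_insert, mem_singleton] at hv
      rw [two_le_nb]
      rcases hv with rfl | rfl
      · exact ⟨p i, mem_union_right _ (mem_arc le_rfl hij.le), c', by simp,
          (hne' _ (by omega)).symm, hi, hcc⟩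
      · exact ⟨p j, mem_union_right _ (mem_arc hij.le le_rfl), c, by simp,
          (hne _ (by omega)).symm, hj', hcc.symm⟩)
    ⟨c, by simp, hne _ (by omega), hi.symm⟩ ⟨c', by simp, hne' _ (by omega), hj'.symm⟩
  simpa using this

end IsP

end

section

variable {V : Type*} {G : SimpleGraph V}

/-- A family of pairwise disjoint cores. -/
structure Fam (G : SimpleGraph V) (𝒞 : Finset (Finset V)) : Prop where
  core : ∀ C ∈ 𝒞, Core G C
  disj : ∀ C ∈ 𝒞, ∀ D ∈ 𝒞, C ≠ D → Disjoint C D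

theorem fam_single {A : Finset V} (hA : Core G A) : Fam G {A} :=
  ⟨fun C hC => by rw [mem_singleton] at hC; exact hC ▸ hA,
    fun C hC D hD h => by rw [mem_singleton] at hC hD; exact absurd (hC.trans hD.symm) h⟩

theorem Fam.mono {𝒞 𝒟 : Finset (Finset V)} (h : Fam G 𝒞) (hs : 𝒟 ⊆ 𝒞) : Fam G 𝒟 :=
  ⟨fun C hC => h.core C (hs hC), fun C hC D hD => h.disj C (hs hC) D (hs hD)⟩

theorem Fam.insertCore {𝒞 : Finset (Finset V)} {A : Finset V} (h : Fam G 𝒞) (hA : Core G A)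
    (hd : ∀ C ∈ 𝒞, Disjoint A C) : Fam G (insert A 𝒞) ∧ A ∉ 𝒞 := by
  refine ⟨⟨fun C hC => ?_, fun C hC D hD hne => ?_⟩, fun hAC => ?_⟩
  · rcases mem_insert.1 hC with rfl | hC
    exacts [hA, h.core C hC]
  · rcases mem_insert.1 hC with hC' | hC' <;> rcases mem_insert.1 hD with hD' | hD'
    exacts [absurd (hC'.trans hD'.symm) hne, hC' ▸ hd D hD', (hD' ▸ hd C hC').symm,
      h.disj C hC' D hD' hne]
  · have := hd A hAC
    rw [disjoint_self] at this
    exact hA.1.ne_empty this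

/-- The family obtained by replacing `C` with `A`. -/
noncomputable def swap (𝒞 : Finset (Finset V)) (C A : Finset V) :
    Finset (Finset V) := insert A (𝒞.erase C)

theorem mem_swap_of_ne {𝒞 : Finset (Finset V)} {C D A : Finset V} (hD : D ∈ 𝒞)
    (h : D ≠ C) : D ∈ swap 𝒞 C A :=
  mem_insert_of_mem (mem_erase.2 ⟨h, hD⟩)

variable [Fintype V]

/-- The vertices outside all members of `𝒞`. -/
noncomputable def rest (𝒞 : Finset (Finset V)) : Finset V := univ \ 𝒞.biUnion id

theorem mem_rest {𝒞 : Finset (Finset V)} {v : V} : v ∈ rest 𝒞 ↔ ∀ C ∈ 𝒞, v ∉ C := by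
  simp [rest]

theorem disjoint_rest {𝒞 : Finset (Finset V)} {C : Finset V} (hC : C ∈ 𝒞) :
    Disjoint C (rest 𝒞) :=
  disjoint_right.2 fun _ hv => mem_rest.1 hv C hC

theorem Fam.sum_card {𝒞 : Finset (Finset V)} (h : Fam G 𝒞) :
    ∑ C ∈ 𝒞, C.card + (rest 𝒞).card = Fintype.card V := by
  have h1 : (𝒞.biUnion id).card = ∑ C ∈ 𝒞, C.card := by
    rw [card_biUnion]
    · rfl
    · exact fun C hC D hD => h.disj C hC D hD
  have h2 := card_sdiff_add_card_eq_card (subset_univ (𝒞.biUnion id))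
  rw [card_univ] at h2
  unfold rest
  omega

theorem Fam.sum_eq {𝒞 : Finset (Finset V)} (h : Fam G 𝒞) (f : V → ℕ) :
    ∑ C ∈ 𝒞, ∑ v ∈ C, f v + ∑ v ∈ rest 𝒞, f v = ∑ v, f v := by
  have h1 : ∑ v ∈ 𝒞.biUnion id, f v = ∑ C ∈ 𝒞, ∑ v ∈ C, f v := by
    rw [sum_biUnion]
    · rfl
    · exact fun C hC D hD => h.disj C hC D hD
  rw [← h1, rest, add_comm]
  exact sum_sdiff (subset_univ _)

theorem Fam.nb_univ {𝒞 : Finset (Finset V)} (h : Fam G 𝒞) (v : V) :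
    nb G v univ = nb G v (rest 𝒞) + ∑ C ∈ 𝒞, nb G v C := by
  have := h.sum_eq fun u => (decide (G.Adj v u)).toNat
  simp only [nb_eq_sum]
  omega

theorem Fam.exchange {𝒞 𝒟 ℰ : Finset (Finset V)} (h : Fam G 𝒞) (h𝒟 : 𝒟 ⊆ 𝒞) (hℰ : Fam G ℰ)
    (hsub : ∀ E ∈ ℰ, E ⊆ 𝒟.biUnion id ∪ rest 𝒞) :
    Fam G (𝒞 \ 𝒟 ∪ ℰ) ∧ (𝒞 \ 𝒟 ∪ ℰ).card + 𝒟.card = 𝒞.card + ℰ.card ∧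
      ∑ C ∈ 𝒞 \ 𝒟 ∪ ℰ, C.card + ∑ C ∈ 𝒟, C.card = ∑ C ∈ 𝒞, C.card + ∑ C ∈ ℰ, C.card := by
  have key : ∀ E ∈ ℰ, ∀ C ∈ 𝒞 \ 𝒟, Disjoint E C := by
    intro E hE C hC
    rw [mem_sdiff] at hC
    rw [disjoint_left]
    intro v hv hvC
    rcases mem_union.1 (hsub E hE hv) with hv | hv
    · simp only [mem_biUnion, id] at hv
      obtain ⟨D, hD, hvD⟩ := hv
      have hne : D ≠ C := fun e => hC.2 (e ▸ hD)
      exact disjoint_left.1 (h.disj D (h𝒟 hD) C hC.1 hne) hvD hvC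
    · exact mem_rest.1 hv C hC.1 hvC
  have hdis : Disjoint (𝒞 \ 𝒟) ℰ := by
    rw [disjoint_left]
    intro E hE hE'
    have := key E hE' E hE
    rw [disjoint_self] at this
    exact (hℰ.core E hE').1.ne_empty this
  refine ⟨⟨fun C hC => ?_, fun C hC D hD hne => ?_⟩, ?_, ?_⟩
  · rcases mem_union.1 hC with hC | hC
    exacts [h.core C (mem_sdiff.1 hC).1, hℰ.core C hC]
  · rcases mem_union.1 hC with hC | hC <;> rcases mem_union.1 hD with hD | hD
    exacts [h.disj C (mem_sdiff.1 hC).1 D (mem_sdiff.1 hD).1 hne, (key D hD C hC).symm,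
      key C hC D hD, hℰ.disj C hC D hD hne]
  · rw [card_union_of_disjoint hdis]
    have := card_sdiff_add_card_eq_card h𝒟
    omega
  · rw [sum_union hdis]
    have := sum_sdiff (f := fun C : Finset V => C.card) h𝒟
    omega

/-- A family of `m` disjoint cores of least total size, in a graph without `m + 1` of them. -/
structure Opt (G : SimpleGraph V) (m : ℕ) (𝒞 : Finset (Finset V)) : Prop where
  fam : Fam G 𝒞
  card : 𝒞.card = m
  min : ∀ 𝒟, Fam G 𝒟 → 𝒟.card = m → ∑ C ∈ 𝒞, C.card ≤ ∑ C ∈ 𝒟, C.card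
  noPack : ∀ 𝒟, Fam G 𝒟 → 𝒟.card ≠ m + 1

namespace Opt

variable {m : ℕ} {𝒞 : Finset (Finset V)} {C D : Finset V}

theorem not_core (h : Opt G m 𝒞) {A : Finset V} (hA : A ⊆ rest 𝒞) : ¬ Core G A := by
  intro hc
  obtain ⟨h1, h2⟩ := h.fam.insertCore hc fun C hC =>
    ((disjoint_rest hC).mono_right hA).symm
  exact h.noPack _ h1 (by rw [card_insert_of_notMem h2, h.card])

theorem no_two (h : Opt G m 𝒞) (hC : C ∈ 𝒞) {A B : Finset V} (hA : Core G A) (hB : Core G B)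
    (hAB : Disjoint A B) (hA' : A ⊆ C ∪ rest 𝒞) (hB' : B ⊆ C ∪ rest 𝒞) : False := by
  obtain ⟨h1, h2⟩ := (fam_single hB).insertCore hA (by simpa using hAB)
  obtain ⟨h3, h4, -⟩ := h.fam.exchange (singleton_subset_iff.2 hC) h1 (by
    intro E hE
    simp only [mem_insert, mem_singleton] at hE
    rcases hE with rfl | rfl <;> simpa)
  refine h.noPack _ h3 ?_
  rw [card_insert_of_notMem h2] at h4
  simp only [card_singleton, h.card] at h4
  omega

theorem no_three (h : Opt G m 𝒞) (hC : C ∈ 𝒞) (hD : D ∈ 𝒞) (hCD : C ≠ D)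
    {A B E : Finset V} (hA : Core G A) (hB : Core G B) (hE : Core G E)
    (hAB : Disjoint A B) (hAE : Disjoint A E) (hBE : Disjoint B E)
    (hA' : A ⊆ C ∪ D ∪ rest 𝒞) (hB' : B ⊆ C ∪ D ∪ rest 𝒞) (hE' : E ⊆ C ∪ D ∪ rest 𝒞) :
    False := by
  obtain ⟨h1, h2⟩ := (fam_single hE).insertCore hB (by simpa using hBE)
  obtain ⟨h1', h2'⟩ := h1.insertCore hA (by simpa using ⟨hAB, hAE⟩)
  obtain ⟨h3, h4, -⟩ := h.fam.exchange (𝒟 := {C, D}) (by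
    intro X hX
    simp only [mem_insert, mem_singleton] at hX
    rcases hX with rfl | rfl <;> assumption) h1' (by
    intro X hX
    simp only [mem_insert, mem_singleton] at hX
    rcases hX with rfl | rfl | rfl <;> simpa [biUnion_insert, ← union_assoc] using ‹_›)
  refine h.noPack _ h3 ?_
  rw [card_insert_of_notMem h2', card_insert_of_notMem h2, card_pair hCD] at h4
  simp only [card_singleton, h.card] at h4
  omega

theorem le_card (h : Opt G m 𝒞) (hC : C ∈ 𝒞) {A : Finset V} (hA : Core G A)
    (hA' : A ⊆ C ∪ rest 𝒞) : C.card ≤ A.card := by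
  obtain ⟨h3, h4, h5⟩ := h.fam.exchange (singleton_subset_iff.2 hC) (fam_single hA) (by
    intro E hE
    rw [mem_singleton] at hE
    subst hE
    simpa)
  have := h.min _ h3 (by have := h.card; simp only [card_singleton] at h4; omega)
  simp only [sum_singleton] at h5
  omega

theorem swap_opt (h : Opt G m 𝒞) (hC : C ∈ 𝒞) {A : Finset V} (hA : Core G A)
    (hA' : A ⊆ C ∪ rest 𝒞) (hcard : A.card ≤ C.card) : Opt G m (swap 𝒞 C A) := by
  obtain ⟨h3, h4, h5⟩ := h.fam.exchange (singleton_subset_iff.2 hC) (fam_single hA) (by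
    intro E hE
    rw [mem_singleton] at hE
    subst hE
    simpa)
  have e : swap 𝒞 C A = 𝒞 \ {C} ∪ {A} := by
    ext X
    simp only [swap, mem_insert, mem_erase, mem_union, mem_sdiff, mem_singleton]
    tauto
  rw [← e] at h3 h4 h5
  simp only [card_singleton, sum_singleton] at h4 h5
  have := h.card
  exact ⟨h3, by omega, fun 𝒟 hD hD' => by have := h.min 𝒟 hD hD'; omega, h.noPack⟩

theorem rest_swap (h : Opt G m 𝒞) (hC : C ∈ 𝒞) {A : Finset V} (hA' : A ⊆ C ∪ rest 𝒞) :
    rest (swap 𝒞 C A) = (C ∪ rest 𝒞) \ A := by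
  ext v
  simp only [mem_rest, swap, mem_insert, mem_erase, mem_sdiff, mem_union]
  constructor
  · intro hv
    refine ⟨?_, hv A (Or.inl rfl)⟩
    by_cases hvC : v ∈ C
    · exact Or.inl hvC
    · refine Or.inr fun D hD => ?_
      by_cases hDC : D = C
      · exact hDC ▸ hvC
      · exact hv D (Or.inr ⟨hDC, hD⟩)
  · rintro ⟨hv, hvA⟩ D (rfl | ⟨hDC, hD⟩)
    · exact hvA
    · rcases hv with hv | hv
      · exact disjoint_left.1 (h.fam.disj C hC D hD (Ne.symm hDC)) hv
      · exact hv D hD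

theorem eq_of_subset (h : Opt G m 𝒞) (hC : C ∈ 𝒞) {A : Finset V} (hA : Core G A)
    (hA' : A ⊆ C) : A = C :=
  eq_of_subset_of_card_le hA' (h.le_card hC hA (hA'.trans subset_union_left))

end Opt

end

section

variable {V : Type*} {G : SimpleGraph V}

theorem exists_max_nat {P : ℕ → Prop} {N n : ℕ} (hn : P n) (hN : ∀ k, P k → k ≤ N) :
    ∃ k, P k ∧ ∀ j, P j → j ≤ k :=
  ⟨Nat.findGreatest P N, Nat.findGreatest_spec (hN n hn) hn,
    fun _ hj => Nat.le_findGreatest (hN _ hj) hj⟩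

theorem exists_longest {X : Finset V} (hX : X.Nonempty) :
    ∃ p n, IsP G p n X ∧ 1 ≤ n ∧ ∀ q k, IsP G q k X → k ≤ n := by
  obtain ⟨v, hv⟩ := hX
  obtain ⟨n, ⟨p, hp⟩, hmax⟩ := exists_max_nat (P := fun n => ∃ p, IsP G p n X) (N := X.card)
    ⟨_, IsP.single hv⟩ fun k ⟨p, hp⟩ => hp.card_le
  exact ⟨p, n, hp, hmax 1 ⟨_, IsP.single hv⟩, fun q k hq => hmax k ⟨q, hq⟩⟩

theorem IsP.exists_of_longest {X : Finset V} {p : ℕ → V} {n : ℕ} (h : IsP G p n X)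
    (hmax : ∀ q k, IsP G q k X → k ≤ n) {u : V} (hu : u ∈ X) (hadj : G.Adj (p 0) u) :
    ∃ j, 0 < j ∧ j < n ∧ p j = u := by
  by_contra hcon
  push Not at hcon
  have := hmax _ _ (h.cons hu (fun i hi e => by
    rcases Nat.eq_zero_or_pos i with rfl | h0
    · exact hadj.ne e
    · exact hcon i h0 hi e) fun _ => hadj.symm)
  omega

theorem Core.exists_chord {S : Finset V} (h : Core G S) :
    ∃ p j, IsP G p (j + 1) S ∧ 2 ≤ j ∧ G.Adj (p 0) (p j) := by
  obtain ⟨p, n, hp, hn, hmax⟩ := exists_longest (G := G) h.1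
  obtain ⟨u, hu, w, hw, huw, h1, h2⟩ := two_le_nb.1 (h.2 _ (hp.mem 0 (by omega)))
  obtain ⟨i, hi0, hi, rfl⟩ := hp.exists_of_longest hmax hu h1
  obtain ⟨j, hj0, hj, rfl⟩ := hp.exists_of_longest hmax hw h2
  have hij : i ≠ j := fun e => huw (by rw [e])
  rcases Nat.lt_or_ge i 2 with h | h
  · exact ⟨p, j, hp.take (by omega), by omega, h2⟩
  · exact ⟨p, i, hp.take (by omega), h, h1⟩

theorem Core.exists_triangle {C : Finset V} (h : Core G C) (h3 : C.card = 3) :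
    ∃ a b c, G.Adj a b ∧ G.Adj a c ∧ G.Adj b c ∧ C = {a, b, c} := by
  obtain ⟨a, b, c, hab, hac, hbc, rfl⟩ := card_eq_three.1 h3
  have ha := h.2 a (by simp)
  have hb := h.2 b (by simp)
  rw [nb_triple _ hab hac hbc] at ha hb
  refine ⟨a, b, c, ?_, ?_, ?_, rfl⟩ <;> by_contra hcon <;>
    simp [hcon, G.adj_comm b a] at ha hb
  all_goals
    have := Bool.toNat_le (decide (G.Adj a b))
    have := Bool.toNat_le (decide (G.Adj a c))
    have := Bool.toNat_le (decide (G.Adj b c))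
    omega

theorem nb_quad (v : V) {a b c d : V} (hab : G.Adj a b) (hbc : G.Adj b c)
    (hcd : G.Adj c d) (hda : G.Adj d a) (hac : a ≠ c) (hbd : b ≠ d) :
    nb G v {a, b, c, d} = (decide (G.Adj v a)).toNat + (decide (G.Adj v b)).toNat +
      (decide (G.Adj v c)).toNat + (decide (G.Adj v d)).toNat := by
  rw [nb_insert v (by simp [hab.ne, hac, hda.ne']), nb_triple v hbc.ne hbd hcd.ne]
  omega

variable [Fintype V]

namespace Opt

variable {m : ℕ} {𝒞 : Finset (Finset V)} {C D : Finset V}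

theorem exists_cycle (h : Opt G m 𝒞) (hC : C ∈ 𝒞) :
    ∃ p, IsP G p C.card C ∧ G.Adj (p 0) (p (C.card - 1)) ∧
      (Icc 0 (C.card - 1)).image p = C := by
  obtain ⟨p, j, hp, hj, hadj⟩ := (h.fam.core C hC).exists_chord
  have hc := hp.core_chord (i := 0) (j := j) (by omega) (by omega) hadj
  have e := h.eq_of_subset hC hc (hp.arc_subset (by omega))
  have e2 := hp.card_arc (i := 0) (j := j) (by omega)
  rw [e] at e2
  refine ⟨p, ?_, ?_, ?_⟩
  · rw [e2]; exact hp
  · rw [e2]; exact hadj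
  · rw [e2]; exact e

theorem exists_quad (h : Opt G m 𝒞) (hC : C ∈ 𝒞) (h4 : C.card = 4) :
    ∃ a b c d, G.Adj a b ∧ G.Adj b c ∧ G.Adj c d ∧ G.Adj d a ∧ a ≠ c ∧ b ≠ d ∧
      C = {a, b, c, d} := by
  obtain ⟨p, hp, hadj, e⟩ := h.exists_cycle hC
  rw [h4] at hp hadj e
  refine ⟨p 0, p 1, p 2, p 3, hp.adj 0 (by omega), hp.adj 1 (by omega), hp.adj 2 (by omega),
    hadj.symm, hp.ne (by omega) (by omega) (by omega), hp.ne (by omega) (by omega) (by omega),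
    ?_⟩
  rw [← e, show Icc 0 (4 - 1) = {0, 1, 2, 3} from rfl]
  simp [image_insert]

theorem not_two_adj (h : Opt G m 𝒞) (hC : C ∈ 𝒞) (h4 : 4 ≤ C.card) {v c c' : V}
    (hv : v ∈ rest 𝒞) (hc : c ∈ C) (hc' : c' ∈ C) (hadj : G.Adj c c') (h1 : G.Adj v c)
    (h2 : G.Adj v c') : False := by
  have h3 := h.le_card hC (core_triple h1 h2 hadj) (by
    simp only [insert_subset_iff, singleton_subset_iff, mem_union]
    exact ⟨Or.inr hv, Or.inl hc, Or.inl hc'⟩)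
  have := card_le_three (a := v) (b := c) (c := c')
  omega

theorem nb_le_one (h : Opt G m 𝒞) (hC : C ∈ 𝒞) (h5 : 5 ≤ C.card) {v : V}
    (hv : v ∈ rest 𝒞) : nb G v C ≤ 1 := by
  by_contra hcon
  obtain ⟨u, hu, w, hw, huw, h1, h2⟩ := two_le_nb.1 (not_le.1 hcon)
  obtain ⟨p, hp, hadj, e⟩ := h.exists_cycle hC
  have hvC : v ∉ C := mem_rest.1 hv C hC
  have small : ∀ A : Finset V, Core G A → A ⊆ C ∪ rest 𝒞 → 5 ≤ A.card := fun A hA hA' =>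
    h5.trans (h.le_card hC hA hA')
  have key : ∀ i j, i < j → j < C.card → G.Adj v (p i) → G.Adj v (p j) → False := by
    intro i j hij hj h1 h2
    have hlen := h.le_card hC (hp.core_vertex hij hj hvC h1 h2) (by
      rw [insert_subset_iff]
      exact ⟨mem_union_right _ hv, (hp.arc_subset hj).trans subset_union_left⟩)
    rw [card_insert_of_notMem (fun h => hvC (hp.arc_subset hj h)), hp.card_arc hj] at hlen
    have mem : ∀ a < C.card, p a ∈ C ∪ rest 𝒞 := fun a ha => mem_union_left _ (hp.mem a ha)
    have hv' : v ∈ C ∪ rest 𝒞 := mem_union_right _ hv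
    have hvp : ∀ a < C.card, v ≠ p a := fun a ha e => hvC (e ▸ hp.mem a ha)
    have hcyc : (i = 0 ∧ j = C.card - 1) ∨ (i = 0 ∧ j + 1 = C.card - 1) ∨
        (i = 1 ∧ j = C.card - 1) := by omega
    rcases hcyc with ⟨rfl, rfl⟩ | ⟨rfl, hj'⟩ | ⟨rfl, rfl⟩
    · exact h.not_two_adj hC (by omega) hv (hp.mem 0 (by omega)) (hp.mem _ hj) hadj h1 h2
    · have h3 := hp.adj j (by omega)
      have := small _ (core_quad h1 (hj' ▸ hadj) h3.symm h2.symm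
        (hvp _ (by omega)) (hp.ne (by omega) (by omega) (by omega))) (by
        simp only [insert_subset_iff, singleton_subset_iff]
        exact ⟨hv', mem _ (by omega), mem _ (by omega), mem _ (by omega)⟩)
      have := card_le_four (a := v) (b := p 0) (c := p (j + 1)) (d := p j)
      omega
    · have h3 := hp.adj 0 (by omega)
      have := small _ (core_quad h1 h3.symm hadj h2.symm
        (hvp _ (by omega)) (hp.ne (by omega) (by omega) (by omega))) (by
        simp only [insert_subset_iff, singleton_subset_iff]
        exact ⟨hv', mem _ (by omega), mem _ (by omega), mem _ (by omega)⟩)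
      have := card_le_four (a := v) (b := p 1) (c := p 0) (d := p (C.card - 1))
      omega
  rw [← e] at hu hw
  simp only [mem_image, mem_Icc] at hu hw
  obtain ⟨i, hi, rfl⟩ := hu
  obtain ⟨j, hj, rfl⟩ := hw
  rcases lt_trichotomy i j with hij | rfl | hij
  · exact key i j hij (by omega) h1 h2
  · exact huw rfl
  · exact key j i hij (by omega) h2 h1

theorem nb_le_two (h : Opt G m 𝒞) (hC : C ∈ 𝒞) (h4 : 4 ≤ C.card) {v : V}
    (hv : v ∈ rest 𝒞) : nb G v C ≤ 2 := by
  rcases h4.eq_or_lt with h4 | h4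
  · obtain ⟨a, b, c, d, hab, hbc, hcd, hda, hac, hbd, rfl⟩ := h.exists_quad hC h4.symm
    rw [nb_quad v hab hbc hcd hda hac hbd]
    have h1 := fun x y => h.not_two_adj hC h4.le hv (by simp) (by simp) hab x y
    have h2 := fun x y => h.not_two_adj hC h4.le hv (by simp) (by simp) hcd x y
    by_cases ha : G.Adj v a <;> by_cases hb : G.Adj v b <;> by_cases hc : G.Adj v c <;>
      by_cases hd : G.Adj v d <;> simp [ha, hb, hc, hd] <;> tauto
  · exact (h.nb_le_one hC h4 hv).trans (by omega)

theorem nb_le_three (h : Opt G m 𝒞) (hC : C ∈ 𝒞) {v : V} (hv : v ∈ rest 𝒞) :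
    nb G v C ≤ 3 := by
  rcases (h.fam.core C hC).three_le_card.eq_or_lt with h3 | h3
  · exact h3 ▸ nb_le_card v C
  · exact (h.nb_le_two hC h3 hv).trans (by omega)

end Opt

end

section

variable {V : Type*} {G : SimpleGraph V}

/-- `C` is a triangle on `a, b, c`. -/
structure Tri (G : SimpleGraph V) (C : Finset V) (a b c : V) : Prop where
  ab : G.Adj a b
  ac : G.Adj a c
  bc : G.Adj b c
  eq : C = {a, b, c}

namespace Tri

variable {C : Finset V} {a b c : V}

theorem swp (t : Tri G C a b c) : Tri G C b a c :=
  ⟨t.ab.symm, t.bc, t.ac, by rw [t.eq, insert_comm]⟩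

theorem swp' (t : Tri G C a b c) : Tri G C a c b :=
  ⟨t.ac, t.ab, t.bc.symm, by rw [t.eq, pair_comm]⟩

theorem rot (t : Tri G C a b c) : Tri G C c a b := t.swp'.swp

theorem ma (t : Tri G C a b c) : a ∈ C := by simp [t.eq]
theorem mb (t : Tri G C a b c) : b ∈ C := by simp [t.eq]
theorem mc (t : Tri G C a b c) : c ∈ C := by simp [t.eq]

theorem card (t : Tri G C a b c) : C.card = 3 :=
  card_eq_three.2 ⟨a, b, c, t.ab.ne, t.ac.ne, t.bc.ne, t.eq⟩

theorem nb (t : Tri G C a b c) (v : V) :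
    nb G v C = (decide (G.Adj v a)).toNat + (decide (G.Adj v b)).toNat +
      (decide (G.Adj v c)).toNat := by
  rw [t.eq, nb_triple v t.ab.ne t.ac.ne t.bc.ne]

theorem erase_eq (t : Tri G C a b c) : C.erase a = {b, c} := by
  rw [t.eq, erase_insert (by simp [t.ab.ne, t.ac.ne])]

end Tri

theorem Opt.tri {m : ℕ} {𝒞 : Finset (Finset V)} {C : Finset V} (h : Opt G m 𝒞) (hC : C ∈ 𝒞)
    (h3 : C.card ≤ 3) : ∃ a b c, Tri G C a b c := by
  have hc := h.fam.core C hC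
  obtain ⟨a, b, c, h1, h2, h3, h4⟩ := hc.exists_triangle (le_antisymm h3 hc.three_le_card)
  exact ⟨a, b, c, h1, h2, h3, h4⟩

theorem Opt.ne_of {m : ℕ} {𝒞 : Finset (Finset V)} {C D : Finset V} (h : Opt G m 𝒞) (hC : C ∈ 𝒞)
    (hD : D ∈ 𝒞) (hCD : C ≠ D) {c d : V} (hc : c ∈ C) (hd : d ∈ D) : c ≠ d := fun e =>
  disjoint_left.1 (h.fam.disj C hC D hD hCD) hc (e ▸ hd)

variable [Fintype V]

theorem Opt.ne_rest {m : ℕ} {𝒞 : Finset (Finset V)} {C : Finset V} (_ : Opt G m 𝒞) (hC : C ∈ 𝒞)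
    {c p : V} (hc : c ∈ C) (hp : p ∈ rest 𝒞) : c ≠ p := fun e => mem_rest.1 hp C hC (e ▸ hc)

/-- Release `a` from `C`, take in `p`. -/
theorem Opt.swap_one {m : ℕ} {𝒞 : Finset (Finset V)} {C : Finset V} (h : Opt G m 𝒞)
    (hC : C ∈ 𝒞) {a p : V} (ha : a ∈ C) (hp : p ∈ rest 𝒞)
    (hA : Core G (insert p (C.erase a))) :
    Opt G m (swap 𝒞 C (insert p (C.erase a))) ∧
      rest (swap 𝒞 C (insert p (C.erase a))) = insert a ((rest 𝒞).erase p) := by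
  have hsub : insert p (C.erase a) ⊆ C ∪ rest 𝒞 := by
    rw [insert_subset_iff]
    exact ⟨mem_union_right _ hp, (erase_subset _ _).trans subset_union_left⟩
  refine ⟨h.swap_opt hC hA hsub ?_, ?_⟩
  · refine (card_insert_le _ _).trans ?_
    rw [card_erase_of_mem ha]
    have := card_pos.2 ⟨a, ha⟩
    omega
  · rw [h.rest_swap hC hsub]
    ext v
    simp only [mem_sdiff, mem_union, mem_insert, mem_erase]
    have h1 : v ∈ C → v ≠ p := fun hv => h.ne_rest hC hv hp
    have h2 : v ∈ rest 𝒞 → v ≠ a := fun hv => (h.ne_rest hC ha hv).symm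
    have h3 : v = a → v ∈ C := fun e => e ▸ ha
    have h4 : v ∈ rest 𝒞 → v ∉ C := fun hv => mem_rest.1 hv C hC
    tauto

/-- The standing assumptions: degrees at least `2m + 1`, at least `2m + 2` vertices of larger
degree, and no `m + 1` disjoint cores. -/
structure Hyp (G : SimpleGraph V) (m : ℕ) : Prop where
  pos : 1 ≤ m
  card : 3 * m + 3 ≤ Fintype.card V
  deg : ∀ v, 2 * m + 1 ≤ nb G v univ
  high : 2 * m + 2 ≤ (univ.filter fun v => 2 * m + 2 ≤ nb G v univ).card
  noPack : ∀ 𝒟, Fam G 𝒟 → 𝒟.card ≠ m + 1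

/-- An optimal family whose complement is a path on three vertices. -/
structure Cfg (G : SimpleGraph V) (m : ℕ) (𝒞 : Finset (Finset V)) (x y z : V) : Prop where
  opt : Opt G m 𝒞
  rest_eq : rest 𝒞 = {x, y, z}
  xy : G.Adj x y
  yz : G.Adj y z
  ne : x ≠ z

namespace Cfg

variable {m : ℕ} {𝒞 : Finset (Finset V)} {x y z : V} {C D : Finset V} {a b c d e f : V}

theorem symm (h : Cfg G m 𝒞 x y z) : Cfg G m 𝒞 z y x :=
  ⟨h.opt, by rw [h.rest_eq]; ext v; simp; tauto, h.yz.symm, h.xy.symm, h.ne.symm⟩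

theorem mx (h : Cfg G m 𝒞 x y z) : x ∈ rest 𝒞 := by simp [h.rest_eq]
theorem my (h : Cfg G m 𝒞 x y z) : y ∈ rest 𝒞 := by simp [h.rest_eq]
theorem mz (h : Cfg G m 𝒞 x y z) : z ∈ rest 𝒞 := by simp [h.rest_eq]

theorem not_xz (h : Cfg G m 𝒞 x y z) : ¬ G.Adj x z := fun hxz =>
  h.opt.not_core (by rw [h.rest_eq]) (core_triple h.xy hxz h.yz)

theorem nb_rest (h : Cfg G m 𝒞 x y z) (v : V) :
    nb G v (rest 𝒞) = (decide (G.Adj v x)).toNat + (decide (G.Adj v y)).toNat +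
      (decide (G.Adj v z)).toNat := by
  rw [h.rest_eq, nb_triple v h.xy.ne h.ne h.yz.ne]

theorem not_rule (h : Cfg G m 𝒞 x y z) (hC : C ∈ 𝒞) (t : Tri G C a b c)
    (hxa : G.Adj x a) (hya : G.Adj y a) (hzb : G.Adj z b) (hzc : G.Adj z c) : False := by
  have n1 := fun v hv => h.opt.ne_rest hC (c := v) hv h.mx
  have n2 := fun v hv => h.opt.ne_rest hC (c := v) hv h.my
  have n3 := fun v hv => h.opt.ne_rest hC (c := v) hv h.mz
  have sub : ∀ A : Finset V, (∀ v ∈ A, v ∈ C ∨ v ∈ rest 𝒞) → A ⊆ C ∪ rest 𝒞 := fun A hA v hv =>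
    mem_union.2 (hA v hv)
  refine h.opt.no_two hC (core_triple h.xy hxa hya) (core_triple hzb hzc t.bc) ?_ ?_ ?_
  · simp [n1 b t.mb, n1 c t.mc, n2 b t.mb, n2 c t.mc, (n3 a t.ma).symm, h.ne.symm,
      h.yz.ne', t.ab.ne', t.ac.ne']
  · apply sub; simp [h.mx, h.my, t.ma]
  · apply sub; simp [h.mz, t.mb, t.mc]

theorem rule (h : Cfg G m 𝒞 x y z) (hC : C ∈ 𝒞) (t : Tri G C a b c) :
    triRule (decide (G.Adj x a)) (decide (G.Adj x b)) (decide (G.Adj x c))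
      (decide (G.Adj y a)) (decide (G.Adj y b)) (decide (G.Adj y c))
      (decide (G.Adj z a)) (decide (G.Adj z b)) (decide (G.Adj z c)) := by
  have h1 := h.not_rule hC t
  have h2 := h.not_rule hC t.swp
  have h3 := h.not_rule hC t.rot
  have h4 := h.symm.not_rule hC t
  have h5 := h.symm.not_rule hC t.swp
  have h6 := h.symm.not_rule hC t.rot
  unfold triRule
  refine Bool.and_eq_true_iff.2 ⟨Bool.and_eq_true_iff.2 ⟨Bool.and_eq_true_iff.2
    ⟨Bool.and_eq_true_iff.2 ⟨Bool.and_eq_true_iff.2 ⟨?_, ?_⟩, ?_⟩, ?_⟩, ?_⟩, ?_⟩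
  exacts [not_and_four h1, not_and_four h2, not_and_four h3, not_and_four h4,
    not_and_four h5, not_and_four h6]

/-- Replace the end `z` of the path by a vertex `a` of a triangle. -/
theorem swap_end (h : Cfg G m 𝒞 x y z) (hC : C ∈ 𝒞) (t : Tri G C a b c)
    (hxa : G.Adj x a) (hzb : G.Adj z b) (hzc : G.Adj z c) :
    Cfg G m (swap 𝒞 C (insert z (C.erase a))) y x a := by
  obtain ⟨h1, h2⟩ := h.opt.swap_one hC t.ma h.mz (by
    rw [t.erase_eq]; exact core_triple hzb hzc t.bc)
  refine ⟨h1, ?_, h.xy.symm, hxa, (h.opt.ne_rest hC t.ma h.my).symm⟩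
  rw [h2, h.rest_eq]
  ext v
  simp only [mem_insert, mem_erase, mem_singleton]
  have e1 : v = y → v ≠ z := fun e => e ▸ h.yz.ne
  have e2 : v = x → v ≠ z := fun e => e ▸ h.ne
  tauto

/-- Replace the middle `y` of the path by a vertex `a` of a member. -/
theorem swap_mid (h : Cfg G m 𝒞 x y z) (hC : C ∈ 𝒞) (ha : a ∈ C)
    (hxa : G.Adj x a) (hza : G.Adj z a) (hA : Core G (insert y (C.erase a))) :
    Cfg G m (swap 𝒞 C (insert y (C.erase a))) x a z := by
  obtain ⟨h1, h2⟩ := h.opt.swap_one hC ha h.my hA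
  refine ⟨h1, ?_, hxa, hza.symm, h.ne⟩
  rw [h2, h.rest_eq]
  ext v
  simp only [mem_insert, mem_erase, mem_singleton]
  have e1 : v = x → v ≠ y := fun e => e ▸ h.xy.ne
  have e2 : v = z → v ≠ y := fun e => e ▸ h.yz.ne'
  tauto

theorem mid_eq_zero (h : Cfg G m 𝒞 x y z) (hC : C ∈ 𝒞) (h5 : 5 ≤ nb G x C + nb G z C) :
    C.card = 3 ∧ nb G y C = 0 := by
  have h3 : C.card ≤ 3 := by
    by_contra hcon
    have h1 := h.opt.nb_le_two hC (by omega) h.mx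
    have h2 := h.opt.nb_le_two hC (by omega) h.mz
    omega
  refine ⟨le_antisymm h3 (h.opt.fam.core C hC).three_le_card, ?_⟩
  obtain ⟨a, b, c, t⟩ := h.opt.tri hC h3
  rw [t.nb, t.nb] at h5
  have := triRule_mid_eq_zero _ _ _ _ _ _ _ _ _ (h.rule hC t) h5
  simp [t.nb, this]

end Cfg

/-- A configuration together with a triangle completely joined to both ends of the path. -/
structure Cfg6 (G : SimpleGraph V) (m : ℕ) (𝒞 : Finset (Finset V)) (x y z : V) (D : Finset V)
    (d e f : V) : Prop extends Cfg G m 𝒞 x y z where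
  mem : D ∈ 𝒞
  tri : Tri G D d e f
  full_x : ∀ v ∈ D, G.Adj x v
  full_z : ∀ v ∈ D, G.Adj z v

namespace Cfg6

variable {m : ℕ} {𝒞 : Finset (Finset V)} {x y z : V} {C D : Finset V} {a b c d e f : V}

theorem symm (h : Cfg6 G m 𝒞 x y z D d e f) : Cfg6 G m 𝒞 z y x D d e f :=
  ⟨h.toCfg.symm, h.mem, h.tri, h.full_z, h.full_x⟩

theorem rot (h : Cfg6 G m 𝒞 x y z D d e f) : Cfg6 G m 𝒞 x y z D f d e :=
  ⟨h.toCfg, h.mem, h.tri.rot, h.full_x, h.full_z⟩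

theorem nb_x (h : Cfg6 G m 𝒞 x y z D d e f) : nb G x D = 3 := by
  simp [h.tri.nb, h.full_x _ h.tri.ma, h.full_x _ h.tri.mb, h.full_x _ h.tri.mc]

theorem nb_y (h : Cfg6 G m 𝒞 x y z D d e f) : nb G y D = 0 :=
  (h.toCfg.mid_eq_zero h.mem (by rw [h.nb_x, h.symm.nb_x]; omega)).2

theorem not_y (h : Cfg6 G m 𝒞 x y z D d e f) {v : V} (hv : v ∈ D) : ¬ G.Adj y v := fun hy => by
  have := one_le_nb.2 ⟨v, hv, hy⟩
  rw [h.nb_y] at this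
  omega

theorem swap_z (h : Cfg6 G m 𝒞 x y z D d e f) :
    Cfg G m (swap 𝒞 D (insert z (D.erase d))) y x d :=
  h.toCfg.swap_end h.mem h.tri (h.full_x d h.tri.ma) (h.full_z e h.tri.mb) (h.full_z f h.tri.mc)

/-- The weighted number of edges between `C` and the vertices `x, y, z, d`. -/
noncomputable def _root_.DisjointCycles.wt (G : SimpleGraph V) (x y z d : V) (C : Finset V) : ℕ :=
  nb G x C + nb G z C + 2 * nb G y C + 2 * nb G d C

theorem wt_le (h : Cfg6 G m 𝒞 x y z D d e f) (hC : C ∈ 𝒞) (hCD : C ≠ D) :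
    wt G x y z d C ≤ 12 := by
  have s1 := h.swap_z
  have s2 := h.symm.swap_z
  have hC1 := mem_swap_of_ne (A := insert z (D.erase d)) hC hCD
  have hC2 := mem_swap_of_ne (A := insert x (D.erase d)) hC hCD
  unfold wt
  by_cases h3 : C.card ≤ 3
  · obtain ⟨a, b, c, t⟩ := h.opt.tri hC h3
    simp only [t.nb]
    exact triRule_six _ _ _ _ _ _ _ _ _ (h.toCfg.rule hC t) _ _ _ (s1.rule hC1 t)
      (s2.rule hC2 t)
  · have := h.opt.nb_le_two hC (by omega) h.mx
    have := h.opt.nb_le_two hC (by omega) h.my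
    have := h.opt.nb_le_two hC (by omega) h.mz
    have := s1.opt.nb_le_two hC1 (by omega) s1.mz
    omega

theorem sum_wt (h : Cfg6 G m 𝒞 x y z D d e f) :
    nb G x univ + nb G z univ + 2 * nb G y univ + 2 * nb G d univ =
      20 + ∑ C ∈ 𝒞.erase D, wt G x y z d C := by
  simp only [h.opt.fam.nb_univ, h.toCfg.nb_rest, wt, sum_add_distrib, ← mul_sum,
    ← add_sum_erase 𝒞 _ h.mem, h.nb_x, h.symm.nb_x, h.nb_y]
  have hy := mt G.adj_symm (h.not_y h.tri.ma)
  have hx := (h.full_x _ h.tri.ma).symm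
  have hz := (h.full_z _ h.tri.ma).symm
  simp [h.tri.nb, h.xy, h.xy.symm, h.yz, h.yz.symm, h.not_xz, mt G.adj_symm h.not_xz,
    h.tri.ab, h.tri.ac, hx, hy, hz]
  omega

/-- The degree bound from which lowness of `y` and of the triangle `D` is read off. -/
theorem deg_le (h : Cfg6 G m 𝒞 x y z D d e f) :
    nb G x univ + nb G z univ + 2 * nb G y univ + 2 * nb G d univ ≤ 12 * m + 8 := by
  have h1 : ∑ C ∈ 𝒞.erase D, wt G x y z d C ≤ (𝒞.erase D).card • 12 :=
    sum_le_card_nsmul _ _ _ fun C hC => h.wt_le (mem_erase.1 hC).2 (mem_erase.1 hC).1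
  have h2 := card_erase_of_mem h.mem
  have h3 := card_pos.2 ⟨D, h.mem⟩
  rw [h.opt.card] at h2 h3
  have := h.sum_wt
  rw [h2, smul_eq_mul] at h1
  omega

end Cfg6

end

section

variable {V : Type*} {G : SimpleGraph V}

theorem Tri.sum {C : Finset V} {a b c : V} (t : Tri G C a b c) (f : V → ℕ) :
    ∑ v ∈ C, f v = f a + f b + f c := by
  rw [t.eq, sum_insert (by simp [t.ab.ne, t.ac.ne]), sum_pair t.bc.ne, add_assoc]

theorem disjoint_cross {C D R : Finset V} {x y z a b c d e f : V} (hx : x ∈ R) (hy : y ∈ R)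
    (hz : z ∈ R) (hxy : x ≠ y) (hxz : x ≠ z) (t : Tri G C a b c) (s : Tri G D d e f)
    (h1 : Disjoint C R) (h2 : Disjoint D R) (h3 : Disjoint C D) :
    Disjoint ({x, d, e} : Finset V) {y, z, c} ∧ Disjoint ({x, d, e} : Finset V) {f, a, b} ∧
      Disjoint ({y, z, c} : Finset V) {f, a, b} := by
  have := t.ma
  have := t.mb
  have := t.mc
  have := s.ma
  have := s.mb
  have := s.mc
  have := t.ac.ne
  have := t.bc.ne
  have := s.ac.ne
  have := s.bc.ne
  rw [disjoint_left] at h1 h2 h3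
  simp only [disjoint_insert_left, disjoint_singleton_left, mem_insert, mem_singleton, not_or]
  and_intros <;> grind

variable [Fintype V]

theorem Opt.not_cross {m : ℕ} {𝒞 : Finset (Finset V)} {C D : Finset V} {x y z a b c d e f : V}
    (h : Opt G m 𝒞) (hC : C ∈ 𝒞) (hD : D ∈ 𝒞) (hCD : C ≠ D) (t : Tri G C a b c)
    (s : Tri G D d e f) (hx : x ∈ rest 𝒞) (hy : y ∈ rest 𝒞) (hz : z ∈ rest 𝒞)
    (hxy : x ≠ y) (hxz : x ≠ z) (hyz : G.Adj y z) (hxd : G.Adj x d) (hxe : G.Adj x e)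
    (hyc : G.Adj y c) (hzc : G.Adj z c) (hfa : G.Adj f a) (hfb : G.Adj f b) : False := by
  obtain ⟨h1, h2, h3⟩ := disjoint_cross hx hy hz hxy hxz t s (disjoint_rest hC)
    (disjoint_rest hD) (h.fam.disj C hC D hD hCD)
  refine h.no_three hC hD hCD (core_triple hxd hxe s.ab) (core_triple hyz hyc hzc)
    (core_triple hfa hfb t.ab) h1 h2 h3 ?_ ?_ ?_ <;>
    simp [insert_subset_iff, hx, hy, hz, t.ma, t.mb, t.mc, s.ma, s.mb, s.mc]

namespace Cfg6

variable {m : ℕ} {𝒞 : Finset (Finset V)} {x y z : V} {C D Y : Finset V} {a b c d e f : V}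

/-- One of the ends has large degree. -/
def _root_.DisjointCycles.EndHigh (G : SimpleGraph V) (m : ℕ) (x z : V) : Prop :=
  2 * m + 2 ≤ nb G x univ ∨ 2 * m + 2 ≤ nb G z univ

theorem exists_of_mem (h : Cfg6 G m 𝒞 x y z D d e f) {v : V} (hv : v ∈ D) :
    ∃ e' f', Cfg6 G m 𝒞 x y z D v e' f' := by
  have := h.tri.eq ▸ hv
  simp only [mem_insert, mem_singleton] at this
  rcases this with rfl | rfl | rfl
  exacts [⟨_, _, h⟩, ⟨_, _, h.rot.rot⟩, ⟨_, _, h.rot⟩]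

theorem low (h : Cfg6 G m 𝒞 x y z D d e f) (hyp : Hyp G m) (hh : EndHigh G m x z) :
    nb G y univ ≤ 2 * m + 1 ∧ ∀ v ∈ D, nb G v univ ≤ 2 * m + 1 := by
  have hx := hyp.deg x
  have hy := hyp.deg y
  have hz := hyp.deg z
  refine ⟨?_, fun v hv => ?_⟩
  · have := h.deg_le
    have hd := hyp.deg d
    rcases hh with hh | hh <;> omega
  · obtain ⟨e', f', h'⟩ := h.exists_of_mem hv
    have := h'.deg_le
    have hv := hyp.deg v
    rcases hh with hh | hh <;> omega

theorem sum_wt_ge (h : Cfg6 G m 𝒞 x y z D d e f) (hyp : Hyp G m) (hh : EndHigh G m x z) :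
    12 * m ≤ ∑ C ∈ 𝒞.erase D, wt G x y z d C + 13 := by
  have hx := hyp.deg x
  have hy := hyp.deg y
  have hz := hyp.deg z
  have hd := hyp.deg d
  have := h.sum_wt
  rcases hh with hh | hh <;> omega

theorem wt_ge (h : Cfg6 G m 𝒞 x y z D d e f) (hyp : Hyp G m) (hh : EndHigh G m x z)
    (hC : C ∈ 𝒞) (hCD : C ≠ D) : 11 ≤ wt G x y z d C := by
  have hC' : C ∈ 𝒞.erase D := mem_erase.2 ⟨hCD, hC⟩
  have h1 : ∑ C ∈ (𝒞.erase D).erase C, wt G x y z d C ≤ ((𝒞.erase D).erase C).card • 12 :=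
    sum_le_card_nsmul _ _ _ fun Y hY =>
      h.wt_le (mem_erase.1 (mem_erase.1 hY).2).2 (mem_erase.1 (mem_erase.1 hY).2).1
  have h2 := card_erase_of_mem h.mem
  have h3 := card_erase_of_mem hC'
  have h4 := card_pos.2 ⟨C, hC'⟩
  rw [h.opt.card] at h2
  rw [h3, smul_eq_mul] at h1
  have h5 := add_sum_erase (𝒞.erase D) (wt G x y z d) hC'
  have := h.sum_wt_ge hyp hh
  omega

theorem low_of_swap_mid (h : Cfg6 G m 𝒞 x y z D d e f) (hyp : Hyp G m) (hh : EndHigh G m x z)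
    (hC : C ∈ 𝒞) (hCD : C ≠ D) (ha : a ∈ C) (hxa : G.Adj x a) (hza : G.Adj z a)
    (hA : Core G (insert y (C.erase a))) : nb G a univ ≤ 2 * m + 1 := by
  have h' : Cfg6 G m _ x a z D d e f := ⟨h.toCfg.swap_mid hC ha hxa hza hA,
    mem_swap_of_ne h.mem (Ne.symm hCD), h.tri, h.full_x, h.full_z⟩
  exact (h'.low hyp hh).1

/-- The triangle `{a, b, c}` is attached to the rest only through `b` and `c`. -/
structure _root_.DisjointCycles.Same (G : SimpleGraph V) (x y z a b c v : V) : Prop where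
  xa : ¬ G.Adj x a
  xb : G.Adj x b
  xc : G.Adj x c
  ya : ¬ G.Adj y a
  yb : G.Adj y b
  yc : G.Adj y c
  za : ¬ G.Adj z a
  zb : G.Adj z b
  zc : G.Adj z c
  va : ¬ G.Adj v a
  vb : G.Adj v b
  vc : G.Adj v c

theorem same_nb_le_two (h : Cfg6 G m 𝒞 x y z D d e f) (hyp : Hyp G m) (hh : EndHigh G m x z)
    (hC : C ∈ 𝒞) (hCD : C ≠ D) (t : Tri G C a b c) (hs : ∀ v ∈ D, Same G x y z a b c v)
    (hY : Y ∈ 𝒞) (hYC : Y ≠ C) (hYD : Y ≠ D) : nb G a Y ≤ 2 := by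
  have hsd := hs d h.tri.ma
  have hcore : Core G {y, z, b} := core_triple h.yz hsd.yb hsd.zb
  have hsub : ({y, z, b} : Finset V) ⊆ C ∪ rest 𝒞 := by
    simp [insert_subset_iff, h.my, h.mz, t.mb]
  have ho := h.opt.swap_opt hC hcore hsub (by
    rw [t.card]; exact card_le_three)
  have hr := h.opt.rest_swap hC hsub
  have nr := fun v hv p hp => h.opt.ne_rest hC (c := v) (p := p) hv hp
  have ha : a ∈ rest (swap 𝒞 C {y, z, b}) := by
    rw [hr]
    simp [t.ma, nr a t.ma y h.my, nr a t.ma z h.mz, t.ab.ne]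
  have hc : c ∈ rest (swap 𝒞 C {y, z, b}) := by
    rw [hr]
    simp [t.mc, nr c t.mc y h.my, nr c t.mc z h.mz, t.bc.ne']
  have hx : x ∈ rest (swap 𝒞 C {y, z, b}) := by
    rw [hr]
    simp [h.mx, h.xy.ne, h.ne, (nr b t.mb x h.mx).symm]
  have hY' : Y ∈ swap 𝒞 C {y, z, b} := mem_swap_of_ne hY hYC
  have hD' : D ∈ swap 𝒞 C {y, z, b} := mem_swap_of_ne h.mem (Ne.symm hCD)
  by_contra hcon
  have h3 := ho.nb_le_three hY' ha
  have hY3 : Y.card ≤ 3 := by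
    by_contra h4
    have := ho.nb_le_two hY' (by omega) ha
    omega
  obtain ⟨u₁, u₂, u₃, s⟩ := ho.tri hY' hY3
  have hall : ∀ u ∈ Y, G.Adj a u := by
    have := (filter_eq_self (s := Y) (p := G.Adj a)).1 (eq_of_subset_of_card_le
      (filter_subset _ _) (by unfold nb at hcon; omega))
    exact this
  have hrot : ∀ u ∈ Y, ∃ u' u'', Tri G Y u' u'' u := by
    intro u hu
    rw [s.eq] at hu
    simp only [mem_insert, mem_singleton] at hu
    rcases hu with rfl | rfl | rfl
    exacts [⟨_, _, s.rot.rot⟩, ⟨_, _, s.rot⟩, ⟨_, _, s⟩]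
  have hD1 : ∀ u ∈ Y, nb G u D ≤ 1 := by
    intro u hu
    by_contra hcon
    obtain ⟨v, hv, w, hw, hvw, huv, huw⟩ := two_le_nb.1 (not_le.1 hcon)
    obtain ⟨u', u'', s'⟩ := hrot u hu
    obtain ⟨p, q, h'⟩ := h.exists_of_mem hv
    have hw' := hw
    rw [h'.tri.eq] at hw'
    simp only [mem_insert, mem_singleton] at hw'
    have : ∃ t, Tri G D v w t := by
      rcases hw' with rfl | rfl | rfl
      exacts [absurd rfl hvw, ⟨_, h'.tri⟩, ⟨_, h'.tri.swp'⟩]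
    obtain ⟨q, t'⟩ := this
    exact ho.not_cross hD' hY' (Ne.symm hYD) t' s' ha hc hx t.ac.ne (nr a t.ma x h.mx)
      hsd.xc.symm (hall _ s'.ma) (hall _ s'.mb) (hs q t'.mc).vc.symm
      (h.full_x q t'.mc) huv huw
  have hyz : ∀ u ∈ Y, ¬ (G.Adj y u ∧ G.Adj z u) := by
    rintro u hu ⟨h1, h2⟩
    obtain ⟨u', u'', s'⟩ := hrot u hu
    exact h.opt.not_cross hY hC hYC s' t.rot.rot h.mx h.my h.mz h.xy.ne h.ne h.yz
      hsd.xb hsd.xc h1 h2 (hall _ s'.ma) (hall _ s'.mb)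
  have hyx : ∀ u ∈ Y, ¬ (G.Adj y u ∧ G.Adj x u) := by
    rintro u hu ⟨h1, h2⟩
    obtain ⟨u', u'', s'⟩ := hrot u hu
    exact h.opt.not_cross hY hC hYC s' t.rot.rot h.mz h.my h.mx h.yz.ne' h.ne.symm h.xy.symm
      hsd.zb hsd.zc h1 h2 (hall _ s'.ma) (hall _ s'.mb)
  have bnd : ∀ p q : V, (∀ u ∈ Y, ¬ (G.Adj p u ∧ G.Adj q u)) → nb G p Y + nb G q Y ≤ 3 := by
    intro p q hpq
    rw [← s.card]
    unfold nb
    rw [← card_union_of_disjoint]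
    · exact card_le_card (union_subset (filter_subset _ _) (filter_subset _ _))
    · rw [disjoint_filter]
      exact fun u hu h1 h2 => hpq u hu ⟨h1, h2⟩
  have b1 := bnd _ _ hyz
  have b2 := bnd _ _ hyx
  have hsum := sum_nb_comm (G := G) D Y
  rw [h.tri.sum, s.sum] at hsum
  have := hD1 _ s.ma
  have := hD1 _ s.mb
  have := hD1 _ s.mc
  have w1 := h.wt_ge hyp hh hY hYD
  have w2 := h.rot.wt_ge hyp hh hY hYD
  have w3 := h.rot.rot.wt_ge hyp hh hY hYD
  unfold wt at w1 w2 w3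
  omega

theorem not_same (h : Cfg6 G m 𝒞 x y z D d e f) (hyp : Hyp G m) (hh : EndHigh G m x z)
    (hC : C ∈ 𝒞) (hCD : C ≠ D) (t : Tri G C a b c) (hs : ∀ v ∈ D, Same G x y z a b c v) :
    False := by
  have hC' : C ∈ 𝒞.erase D := mem_erase.2 ⟨hCD, hC⟩
  have h1 : ∑ Y ∈ (𝒞.erase D).erase C, nb G a Y ≤ ((𝒞.erase D).erase C).card • 2 :=
    sum_le_card_nsmul _ _ _ fun Y hY => by
      simp only [mem_erase] at hY
      exact h.same_nb_le_two hyp hh hC hCD t hs hY.2.2 hY.1 hY.2.1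
  have h2 := card_erase_of_mem h.mem
  have h3 := card_erase_of_mem hC'
  have h4 := card_pos.2 ⟨C, hC'⟩
  rw [h.opt.card] at h2
  rw [h3, smul_eq_mul] at h1
  have h5 := h.opt.fam.nb_univ a
  rw [← add_sum_erase _ _ h.mem, ← add_sum_erase _ _ hC', h.toCfg.nb_rest, t.nb, h.tri.nb] at h5
  have h6 := hyp.deg a
  have hsd := hs d h.tri.ma
  simp only [mt G.adj_symm hsd.xa, mt G.adj_symm hsd.ya, mt G.adj_symm hsd.za,
    mt G.adj_symm hsd.va, mt G.adj_symm (hs e h.tri.mb).va, mt G.adj_symm (hs f h.tri.mc).va,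
    t.ab, t.ac, G.irrefl] at h5
  simp at h5
  omega

end Cfg6

end

section

variable {V : Type*} {G : SimpleGraph V}

theorem disjoint_full {C D : Finset V} {a b c d e f : V} (t : Tri G C a b c) (s : Tri G D d e f)
    (h : Disjoint C D) : Disjoint ({a, e, f} : Finset V) {d, b, c} := by
  rw [disjoint_left] at h
  have := h t.ma
  have := h t.mb
  have := h t.mc
  have := s.ma
  have := s.mb
  have := s.mc
  have := s.ab.ne
  have := s.ac.ne
  have := t.ab.ne
  have := t.ac.ne
  simp only [disjoint_insert_left, disjoint_singleton_left, mem_insert, mem_singleton, not_or]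
  and_intros <;> grind

theorem core_insert_erase {C : Finset V} {a b c y : V} (t : Tri G C a b c) (hb : G.Adj y b)
    (hc : G.Adj y c) : Core G (insert y (C.erase a)) := by
  rw [t.erase_eq]
  exact core_triple hb hc t.bc

variable [Fintype V]

/-- Redistribute the vertices of two members. -/
theorem Opt.swap_pair {m : ℕ} {𝒞 : Finset (Finset V)} {C D A B : Finset V} (h : Opt G m 𝒞)
    (hC : C ∈ 𝒞) (hD : D ∈ 𝒞) (hCD : C ≠ D) (hA : Core G A) (hB : Core G B)
    (hAB : Disjoint A B) (hu : A ∪ B = C ∪ D) :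
    ∃ 𝒟, Opt G m 𝒟 ∧ rest 𝒟 = rest 𝒞 ∧ B ∈ 𝒟 := by
  obtain ⟨h1, h2⟩ := (fam_single hB).insertCore hA (by simpa using hAB)
  have hsub : ({C, D} : Finset (Finset V)) ⊆ 𝒞 := by
    simp [insert_subset_iff, hC, hD]
  obtain ⟨h3, h4, h5⟩ := h.fam.exchange hsub h1 (by
    intro X hX
    simp only [mem_insert, mem_singleton] at hX
    simp only [biUnion_insert, singleton_biUnion, id]
    rw [← hu]
    rcases hX with rfl | rfl
    · exact subset_union_left.trans subset_union_left
    · exact subset_union_right.trans subset_union_left)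
  have e := congrArg Finset.card hu
  rw [card_union_of_disjoint hAB, card_union_of_disjoint (h.fam.disj C hC D hD hCD)] at e
  rw [card_insert_of_notMem h2, card_pair hCD, card_singleton] at h4
  rw [sum_insert h2, sum_pair hCD, sum_singleton] at h5
  refine ⟨_, ⟨h3, by have := h.card; omega, fun 𝒟 hD hD' => ?_, h.noPack⟩, ?_,
    mem_union_right _ (by simp)⟩
  · have := h.min 𝒟 hD hD'
    omega
  · ext v
    have hv := congrArg (v ∈ ·) hu
    simp only [mem_union, eq_iff_iff] at hv
    simp only [mem_rest, mem_union, mem_sdiff, mem_insert, mem_singleton]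
    constructor
    · intro H X hX hvX
      by_cases hX' : X = C ∨ X = D
      · have : v ∈ A ∨ v ∈ B := hv.2 (by rcases hX' with rfl | rfl <;> simp [hvX])
        rcases this with h' | h'
        · exact H A (by simp) h'
        · exact H B (by simp) h'
      · exact H X (Or.inl ⟨hX, hX'⟩) hvX
    · rintro H X (⟨hX, -⟩ | rfl | rfl) hvX
      · exact H X hX hvX
      · rcases hv.1 (Or.inl hvX) with h' | h'
        exacts [H C hC h', H D hD h']
      · rcases hv.1 (Or.inr hvX) with h' | h'
        exacts [H C hC h', H D hD h']

namespace Cfg6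

variable {m : ℕ} {𝒞 : Finset (Finset V)} {x y z : V} {C D Y : Finset V} {a b c d e f : V}

theorem pattern (h : Cfg6 G m 𝒞 x y z D d e f) (hC : C ∈ 𝒞) (hCD : C ≠ D) (h3 : C.card ≤ 3)
    (h4 : nb G x C + nb G z C = 4) (h4' : nb G y C + nb G d C = 4) :
    ∃ a b c, Tri G C a b c ∧ ((G.Adj x a ∧ G.Adj z a ∧ G.Adj y b ∧ G.Adj y c) ∨
      (G.Adj x b ∧ G.Adj x c ∧ G.Adj z b ∧ G.Adj z c ∧ nb G y C = 1) ∨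
      Same G x y z a b c d) := by
  obtain ⟨a, b, c, t⟩ := h.opt.tri hC h3
  have s1 := h.swap_z.rule (mem_swap_of_ne hC hCD) t
  have s2 := h.symm.swap_z.rule (mem_swap_of_ne hC hCD) t
  have e1 := h4
  have e2 := h4'
  rw [t.nb, t.nb] at e1 e2
  have key := triRule_pattern _ _ _ _ _ _ _ _ _ (h.toCfg.rule hC t) e1 _ _ _ s1 s2 e2
  simp only [patMid, patAll, patSame, Bool.or_eq_true, Bool.and_eq_true, decide_eq_true_eq,
    Bool.not_eq_true', decide_eq_false_iff_not] at key
  have hy := t.nb y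
  rcases key with (((((((key | key) | key) | key) | key) | key) | key) | key) | key
  · exact ⟨_, _, _, t, Or.inl (by tauto)⟩
  · exact ⟨_, _, _, t.swp, Or.inl (by tauto)⟩
  · exact ⟨_, _, _, t.rot, Or.inl (by tauto)⟩
  · exact ⟨_, _, _, t, Or.inr (Or.inl ⟨by tauto, by tauto, by tauto, by tauto, by simp_all⟩)⟩
  · exact ⟨_, _, _, t.swp, Or.inr (Or.inl ⟨by tauto, by tauto, by tauto, by tauto, by simp_all⟩)⟩
  · exact ⟨_, _, _, t.rot, Or.inr (Or.inl ⟨by tauto, by tauto, by tauto, by tauto, by simp_all⟩)⟩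
  · exact ⟨_, _, _, t, Or.inr (Or.inr (by constructor <;> tauto))⟩
  · exact ⟨_, _, _, t.swp, Or.inr (Or.inr (by constructor <;> tauto))⟩
  · exact ⟨_, _, _, t.rot, Or.inr (Or.inr (by constructor <;> tauto))⟩

theorem swap_full (h : Cfg6 G m 𝒞 x y z D d e f) (hC : C ∈ 𝒞) (hCD : C ≠ D) (t : Tri G C a b c)
    (hxb : G.Adj x b) (hxc : G.Adj x c) (hzb : G.Adj z b) (hzc : G.Adj z c)
    (hall : ∀ v ∈ D, ∀ u ∈ C, G.Adj v u) :
    ∃ 𝒟, Cfg6 G m 𝒟 x y z {d, b, c} d b c := by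
  have s := h.tri
  obtain ⟨𝒟, h1, h2, h3⟩ := h.opt.swap_pair hC h.mem hCD (A := {a, e, f}) (B := {d, b, c})
    (core_triple (hall e s.mb a t.ma).symm (hall f s.mc a t.ma).symm s.bc)
    (core_triple (hall d s.ma b t.mb) (hall d s.ma c t.mc) t.bc) (by
      exact disjoint_full t h.tri (h.opt.fam.disj C hC D h.mem hCD)) (by
      rw [t.eq, s.eq]
      ext v
      simp only [mem_union, mem_insert, mem_singleton]
      tauto)
  refine ⟨𝒟, ⟨h1, by rw [h2, h.rest_eq], h.xy, h.yz, h.ne⟩, h3,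
    ⟨hall d s.ma b t.mb, hall d s.ma c t.mc, t.bc, rfl⟩, ?_, ?_⟩
  · simpa using ⟨h.full_x d s.ma, hxb, hxc⟩
  · simpa using ⟨h.full_z d s.ma, hzb, hzc⟩

theorem exists_low (h : Cfg6 G m 𝒞 x y z D d e f) (hyp : Hyp G m) (hh : EndHigh G m x z)
    (hC : C ∈ 𝒞) (hCD : C ≠ D) (h3 : C.card ≤ 3) (h4 : nb G x C + nb G z C = 4)
    (h12 : wt G x y z d C = 12) : ∃ a ∈ C, nb G a univ ≤ 2 * m + 1 := by
  by_contra! hcon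
  have h4' : ∀ v ∈ D, nb G y C + nb G v C = 4 := by
    intro v hv
    obtain ⟨p, q, h'⟩ := h.exists_of_mem hv
    have w1 := h'.wt_le hC hCD
    have w2 := h'.wt_ge hyp hh hC hCD
    unfold wt at w1 w2 h12
    omega
  have hpat : ∀ v ∈ D, ∃ a b c, Tri G C a b c ∧ Same G x y z a b c v := by
    intro v hv
    obtain ⟨p, q, h'⟩ := h.exists_of_mem hv
    obtain ⟨a, b, c, t, key | key | key⟩ := h'.pattern hC hCD h3 h4 (h4' v hv)
    · have := h.low_of_swap_mid hyp hh hC hCD t.ma key.1 key.2.1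
        (core_insert_erase t key.2.2.1 key.2.2.2)
      have := hcon a t.ma
      omega
    · obtain ⟨k1, k2, k3, k4, k5⟩ := key
      have hall : ∀ v ∈ D, ∀ u ∈ C, G.Adj v u := by
        intro v hv
        have := h4' v hv
        have h5 := t.card
        exact (filter_eq_self (s := C) (p := G.Adj v)).1 (eq_of_subset_of_card_le
          (filter_subset _ _) (by unfold nb at this k5; omega))
      obtain ⟨𝒟, h''⟩ := h'.swap_full hC hCD t k1 k2 k3 k4 hall
      have := (h''.low hyp hh).2 b (by simp)
      have := hcon b t.mb
      omega
    · exact ⟨a, b, c, t, key⟩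
  obtain ⟨a, b, c, t, hs⟩ := hpat d h.tri.ma
  refine h.not_same hyp hh hC hCD t fun v hv => ?_
  obtain ⟨a', b', c', t', hs'⟩ := hpat v hv
  have ha : a' = a := by
    have := t'.ma
    rw [t.eq] at this
    simp only [mem_insert, mem_singleton] at this
    rcases this with e | e | e
    exacts [e, absurd hs.yb (e ▸ hs'.ya), absurd hs.yc (e ▸ hs'.ya)]
  subst ha
  have e := t.erase_eq
  rw [t'.erase_eq] at e
  have hb : b = b' ∨ b = c' := by
    have : b ∈ ({b', c'} : Finset V) := by rw [e]; simp
    simpa using this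
  have hc : c = b' ∨ c = c' := by
    have : c ∈ ({b', c'} : Finset V) := by rw [e]; simp
    simpa using this
  refine ⟨hs.xa, hs.xb, hs.xc, hs.ya, hs.yb, hs.yc, hs.za, hs.zb, hs.zc, hs'.va, ?_, ?_⟩
  · rcases hb with rfl | rfl
    exacts [hs'.vb, hs'.vc]
  · rcases hc with rfl | rfl
    exacts [hs'.vb, hs'.vc]

end Cfg6

end

section

variable {V : Type*} {G : SimpleGraph V} [Fintype V]

/-- The number of vertices of large degree in `S`. -/
noncomputable def hi (G : SimpleGraph V) (m : ℕ) (S : Finset V) : ℕ :=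
  (S.filter fun v => 2 * m + 2 ≤ nb G v univ).card

theorem hi_le_card (m : ℕ) (S : Finset V) : hi G m S ≤ S.card := card_filter_le _ _

theorem hi_add_one_le {m : ℕ} {S : Finset V} {a : V} (ha : a ∈ S)
    (hlow : nb G a univ ≤ 2 * m + 1) : hi G m S + 1 ≤ S.card := by
  rw [← card_erase_add_one ha]
  refine Nat.add_le_add_right (card_le_card fun v hv => ?_) 1
  rw [mem_filter] at hv
  exact mem_erase.2 ⟨fun e => by subst e; omega, hv.1⟩

theorem hi_add_two_le {m : ℕ} {S : Finset V} {a c : V} (ha : a ∈ S) (hc : c ∈ S) (hac : a ≠ c)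
    (hlow : nb G a univ ≤ 2 * m + 1) (hlow' : nb G c univ ≤ 2 * m + 1) :
    hi G m S + 2 ≤ S.card := by
  have h1 := hi_add_one_le (mem_erase.2 ⟨hac, ha⟩) hlow
  have h2 := card_erase_add_one hc
  have h3 : hi G m S ≤ hi G m (S.erase c) := card_le_card fun v hv => by
    rw [mem_filter] at hv
    exact mem_filter.2 ⟨mem_erase.2 ⟨fun e => by subst e; omega, hv.1⟩, hv.2⟩
  omega

theorem hi_eq_zero {m : ℕ} {S : Finset V} (h : ∀ v ∈ S, nb G v univ ≤ 2 * m + 1) :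
    hi G m S = 0 := by
  unfold hi
  rw [card_eq_zero, filter_eq_empty_iff]
  intro v hv
  have := h v hv
  omega

theorem hi_eq_sum (m : ℕ) (S : Finset V) :
    hi G m S = ∑ v ∈ S, if 2 * m + 2 ≤ nb G v univ then 1 else 0 := by
  unfold hi
  rw [card_filter]

theorem Fam.hi_univ {𝒞 : Finset (Finset V)} (h : Fam G 𝒞) (m : ℕ) :
    hi G m univ = ∑ C ∈ 𝒞, hi G m C + hi G m (rest 𝒞) := by
  simp only [hi_eq_sum]
  exact (h.sum_eq _).symm

theorem and_of_toNat_add {p q : Prop} (h : (decide p).toNat + (decide q).toNat = 2) : p ∧ q := by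
  by_cases hp : p <;> by_cases hq : q <;> simp_all

namespace Cfg

variable {m : ℕ} {𝒞 : Finset (Finset V)} {x y z : V} {C D Y : Finset V} {a b c d e f : V}

theorem not_common (h : Cfg G m 𝒞 x y z) (hC : C ∈ 𝒞) (h4 : 4 ≤ C.card) (ha : a ∈ C)
    (hxa : G.Adj x a) (hya : G.Adj y a) : False := by
  have := h.opt.le_card hC (core_triple h.xy hxa hya) (by
    simp [insert_subset_iff, h.mx, h.my, ha])
  have := this.trans card_le_three
  omega

end Cfg

theorem Opt.quad_pair {m : ℕ} {𝒞 : Finset (Finset V)} {C : Finset V} (h : Opt G m 𝒞)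
    (hC : C ∈ 𝒞) (h4 : C.card = 4) {v : V} (hv : v ∈ rest 𝒞) (h2 : 2 ≤ nb G v C) :
    ∃ a b c d, G.Adj a b ∧ G.Adj b c ∧ G.Adj c d ∧ G.Adj d a ∧ a ≠ c ∧ b ≠ d ∧
      C = {a, b, c, d} ∧ G.Adj v a ∧ G.Adj v c ∧ ¬ G.Adj v b ∧ ¬ G.Adj v d := by
  obtain ⟨a, b, c, d, hab, hbc, hcd, hda, hac, hbd, e⟩ := h.exists_quad hC h4
  have ma : a ∈ C := by simp [e]
  have mb : b ∈ C := by simp [e]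
  have mc : c ∈ C := by simp [e]
  have md : d ∈ C := by simp [e]
  have n1 := h.not_two_adj hC h4.ge hv ma mb hab
  have n2 := h.not_two_adj hC h4.ge hv mb mc hbc
  have n3 := h.not_two_adj hC h4.ge hv mc md hcd
  have n4 := h.not_two_adj hC h4.ge hv md ma hda
  rw [e, nb_quad v hab hbc hcd hda hac hbd] at h2
  by_cases hva : G.Adj v a
  · have hb := n1 hva
    have hd := fun hd => n4 hd hva
    refine ⟨a, b, c, d, hab, hbc, hcd, hda, hac, hbd, e, hva, ?_, hb, hd⟩
    by_contra hc
    simp [hva, hc, show ¬ G.Adj v b from hb, show ¬ G.Adj v d from hd] at h2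
  · have hb : G.Adj v b := by
      by_contra hb
      by_cases hc : G.Adj v c
      · have hd := n3 hc
        simp [hva, hb, hc, show ¬ G.Adj v d from hd] at h2
      · by_cases hd : G.Adj v d <;> simp [hva, hb, hc, hd] at h2
    have hc := n2 hb
    refine ⟨b, c, d, a, hbc, hcd, hda, hab, hbd, hac.symm, ?_, hb, ?_, hc, hva⟩
    · rw [e]; ext v; simp; tauto
    · by_contra hd
      simp [hva, hb, hd, show ¬ G.Adj v c from hc] at h2

namespace Cfg6

variable {m : ℕ} {𝒞 : Finset (Finset V)} {x y z : V} {C D Y : Finset V} {a b c d e f : V}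

theorem quad_low (h : Cfg6 G m 𝒞 x y z D d e f) (hyp : Hyp G m) (hh : EndHigh G m x z)
    (hC : C ∈ 𝒞) (hCD : C ≠ D) (h4 : C.card = 4) (h12 : wt G x y z d C = 12) :
    ∃ a ∈ C, ∃ c ∈ C, a ≠ c ∧ nb G a univ ≤ 2 * m + 1 ∧ nb G c univ ≤ 2 * m + 1 := by
  have n1 := h.opt.nb_le_two hC h4.ge h.mx
  have n2 := h.opt.nb_le_two hC h4.ge h.my
  have n3 := h.opt.nb_le_two hC h4.ge h.mz
  have n4 := h.swap_z.opt.nb_le_two (mem_swap_of_ne hC hCD) h4.ge h.swap_z.mz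
  unfold wt at h12
  obtain ⟨a, b, c, w, hab, hbc, hcw, hwa, hac, hbw, e', hxa, hxc, hxb, hxw⟩ :=
    h.opt.quad_pair hC h4 h.mx (by omega)
  have ma : a ∈ C := by simp [e']
  have mb : b ∈ C := by simp [e']
  have mc : c ∈ C := by simp [e']
  have mw : w ∈ C := by simp [e']
  have hya : ¬ G.Adj y a := h.toCfg.not_common hC h4.ge ma hxa
  have hyc : ¬ G.Adj y c := h.toCfg.not_common hC h4.ge mc hxc
  have hy : nb G y C = 2 := by omega
  have hz : nb G z C = 2 := by omega
  rw [e', nb_quad _ hab hbc hcw hwa hac hbw] at hy hz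
  simp only [hya, hyc, decide_false, Bool.toNat_false, zero_add, add_zero] at hy
  obtain ⟨hyb, hyw⟩ := and_of_toNat_add hy
  have hzb : ¬ G.Adj z b := fun hz => h.symm.toCfg.not_common hC h4.ge mb hz hyb
  have hzw : ¬ G.Adj z w := fun hz => h.symm.toCfg.not_common hC h4.ge mw hz hyw
  simp only [hzb, hzw, decide_false, Bool.toNat_false, add_zero] at hz
  obtain ⟨hza, hzc⟩ := and_of_toNat_add hz
  have ny := fun v hv => (h.opt.ne_rest hC (c := v) hv h.my).symm
  refine ⟨a, ma, c, mc, hac, h.low_of_swap_mid hyp hh hC hCD ma hxa hza ?_,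
    h.low_of_swap_mid hyp hh hC hCD mc hxc hzc ?_⟩
  · rw [show C.erase a = {b, c, w} by
      rw [e', erase_insert (by simp [hab.ne, hac, hwa.ne'])]]
    exact core_quad hyb hbc hcw hyw.symm (ny c mc) hbw
  · rw [show C.erase c = {w, a, b} by
      rw [e']; ext v; simp only [mem_erase, mem_insert, mem_singleton]
      have := hac
      have := hbc.ne
      have := hcw.ne
      grind]
    exact core_quad hyw hwa hab hyb.symm (ny a ma) hbw.symm

theorem claim (h : Cfg6 G m 𝒞 x y z D d e f) (hyp : Hyp G m) (hh : EndHigh G m x z)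
    (hC : C ∈ 𝒞) (hCD : C ≠ D) :
    2 * hi G m C + (nb G x C + nb G z C) + 4 * wt G x y z d C ≤ 56 := by
  have w1 := h.wt_ge hyp hh hC hCD
  have w2 := h.wt_le hC hCD
  have hcard := hi_le_card (G := G) m C
  by_cases h3 : C.card ≤ 3
  · have n1 := h.opt.nb_le_three hC h.mx
    have n2 := h.opt.nb_le_three hC h.mz
    by_cases h12 : wt G x y z d C = 12
    · have hpar : nb G x C + nb G z C = 6 ∨ nb G x C + nb G z C = 4 ∨
          nb G x C + nb G z C ≤ 2 := by
        unfold wt at h12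
        omega
      rcases hpar with h6 | h4 | h2
      · obtain ⟨a, b, c, t⟩ := h.opt.tri hC h3
        have hx := (filter_eq_self (s := C) (p := G.Adj x)).1 (eq_of_subset_of_card_le
          (filter_subset _ _) (by unfold nb at n1 n2 h6; omega))
        have hz := (filter_eq_self (s := C) (p := G.Adj z)).1 (eq_of_subset_of_card_le
          (filter_subset _ _) (by unfold nb at n1 n2 h6; omega))
        have h' : Cfg6 G m 𝒞 x y z C a b c := ⟨h.toCfg, hC, t, hx, hz⟩
        have := hi_eq_zero (h'.low hyp hh).2
        omega
      · obtain ⟨a, ha, hlow⟩ := h.exists_low hyp hh hC hCD h3 h4 h12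
        have := hi_add_one_le ha hlow
        omega
      · omega
    · omega
  · have n1 := h.opt.nb_le_two hC (by omega) h.mx
    have n2 := h.opt.nb_le_two hC (by omega) h.my
    have n3 := h.opt.nb_le_two hC (by omega) h.mz
    by_cases h4 : C.card = 4
    · by_cases h12 : wt G x y z d C = 12
      · obtain ⟨a, ha, c, hc, hac, l1, l2⟩ := h.quad_low hyp hh hC hCD h4 h12
        have := hi_add_two_le ha hc hac l1 l2
        omega
      · omega
    · have n1 := h.opt.nb_le_one hC (by omega) h.mx
      have n2 := h.opt.nb_le_one hC (by omega) h.my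
      have n3 := h.opt.nb_le_one hC (by omega) h.mz
      have n4 := h.swap_z.opt.nb_le_one (mem_swap_of_ne hC hCD) (by omega) h.swap_z.mz
      unfold wt at w1
      omega

theorem false (h : Cfg6 G m 𝒞 x y z D d e f) (hyp : Hyp G m) (hh : EndHigh G m x z) : False := by
  have h1 : ∑ C ∈ 𝒞.erase D, (2 * hi G m C + (nb G x C + nb G z C) + 4 * wt G x y z d C) ≤
      (𝒞.erase D).card • 56 :=
    sum_le_card_nsmul _ _ _ fun C hC =>
      h.claim hyp hh (mem_erase.1 hC).2 (mem_erase.1 hC).1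
  have h2 := card_erase_of_mem h.mem
  have h3 := card_pos.2 ⟨D, h.mem⟩
  rw [h.opt.card] at h2 h3
  rw [h2, smul_eq_mul] at h1
  simp only [sum_add_distrib, ← mul_sum] at h1
  obtain ⟨ly, lD⟩ := h.low hyp hh
  have e1 := h.opt.fam.hi_univ (G := G) m
  rw [← add_sum_erase _ _ h.mem, hi_eq_zero lD] at e1
  have e2 : hi G m (rest 𝒞) = (if 2 * m + 2 ≤ nb G x univ then 1 else 0) +
      (if 2 * m + 2 ≤ nb G z univ then 1 else 0) := by
    rw [hi_eq_sum, h.rest_eq, sum_insert (by simp [h.xy.ne, h.ne]), sum_pair h.yz.ne,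
      if_neg (show ¬ 2 * m + 2 ≤ nb G y univ by omega), zero_add]
  have e3 := h.opt.fam.nb_univ x
  have e4 := h.opt.fam.nb_univ z
  rw [← add_sum_erase _ _ h.mem, h.toCfg.nb_rest] at e3 e4
  rw [h.nb_x] at e3
  rw [h.symm.nb_x] at e4
  simp [h.xy, h.not_xz, h.yz.symm, mt G.adj_symm h.not_xz] at e3 e4
  have hx := hyp.deg x
  have hy := hyp.deg y
  have hz := hyp.deg z
  have hd := hyp.deg d
  have hs := h.sum_wt
  have hhi : 2 * m + 2 ≤ hi G m univ := hyp.high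
  unfold EndHigh at hh
  split_ifs at e2 <;> omega

end Cfg6

end

section

variable {V : Type*} {G : SimpleGraph V} [Fintype V]

namespace Cfg

variable {m : ℕ} {𝒞 : Finset (Finset V)} {x y z : V} {C D : Finset V} {d e f : V}

theorem false_of_five (h : Cfg G m 𝒞 x y z) (hyp : Hyp G m) (hh : EndHigh G m x z)
    (hD : D ∈ 𝒞) (s : Tri G D d e f) (hxd : G.Adj x d) (hxe : G.Adj x e) (hxf : G.Adj x f)
    (hzd : G.Adj z d) (hze : G.Adj z e) (hzf : ¬ G.Adj z f) (hy0 : nb G y D = 0) : False := by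
  have h' := h.swap_end hD s.rot hxf hzd hze
  have hyD : ∀ v ∈ D, ¬ G.Adj y v := fun v hv hyv => by
    have := one_le_nb.2 ⟨v, hv, hyv⟩
    omega
  have hsum : (𝒞.erase D).card • 8 <
      ∑ C ∈ 𝒞.erase D, (nb G x C + nb G y C + nb G z C + nb G f C) := by
    have h2 := card_erase_of_mem hD
    have h3 := card_pos.2 ⟨D, hD⟩
    rw [h.opt.card] at h2 h3
    rw [h2, smul_eq_mul]
    simp only [sum_add_distrib]
    have e1 := h.opt.fam.nb_univ x
    have e2 := h.opt.fam.nb_univ y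
    have e3 := h.opt.fam.nb_univ z
    have e4 := h.opt.fam.nb_univ f
    rw [← add_sum_erase _ _ hD, h.nb_rest, s.nb] at e1 e3 e4
    rw [← add_sum_erase _ _ hD, h.nb_rest, hy0] at e2
    simp [h.xy, h.xy.symm, h.yz, h.yz.symm, h.not_xz, mt G.adj_symm h.not_xz, hxd, hxe, hxf,
      hzd, hze, hzf, hxf.symm, mt G.adj_symm hzf, mt G.adj_symm (hyD f s.mc), s.ac.symm,
      s.bc.symm] at e1 e2 e3 e4
    have := hyp.deg x
    have := hyp.deg y
    have := hyp.deg z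
    have := hyp.deg f
    rcases hh with hh | hh <;> omega
  obtain ⟨C, hC', h9⟩ : ∃ C ∈ 𝒞.erase D, 8 < nb G x C + nb G y C + nb G z C + nb G f C := by
    by_contra! hcon
    exact absurd (sum_le_card_nsmul _ _ _ hcon) (not_le.2 hsum)
  obtain ⟨hCD, hC⟩ := mem_erase.1 hC'
  have hC2 := mem_swap_of_ne (A := insert z (D.erase f)) hC hCD
  have h3 : C.card ≤ 3 := by
    by_contra hcon
    have := h.opt.nb_le_two hC (by omega) h.mx
    have := h.opt.nb_le_two hC (by omega) h.my
    have := h.opt.nb_le_two hC (by omega) h.mz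
    have := h'.opt.nb_le_two hC2 (by omega) h'.mz
    omega
  obtain ⟨a, b, c, t⟩ := h.opt.tri hC h3
  have cross : ∀ {a b c}, Tri G C a b c → G.Adj y c → G.Adj z c → G.Adj f a → G.Adj f b →
      False := fun t => h.opt.not_cross hC hD hCD t s h.mx h.my h.mz h.xy.ne h.ne h.yz hxd hxe
  have h9' := h9
  simp only [t.nb] at h9'
  have key := triRule_five _ _ _ _ _ _ _ _ _ (h.rule hC t) _ _ _ (h'.rule hC2 t)
    (not_and_four (cross t.rot.rot)) (not_and_four (cross t.swp')) (not_and_four (cross t)) h9'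
  simp only [decide_eq_true_eq] at key
  obtain ⟨k1, k2, k3, k4, k5, k6⟩ := key
  have h6 : Cfg6 G m 𝒞 x y z C a b c := ⟨h, hC, t, by rw [t.eq]; simp [k1, k2, k3],
    by rw [t.eq]; simp [k4, k5, k6]⟩
  exact h6.false hyp hh

theorem false_of_full (h : Cfg G m 𝒞 x y z) (hyp : Hyp G m) (hh : EndHigh G m x z)
    (hD : D ∈ 𝒞) (h3 : D.card = 3) (h5 : 5 ≤ nb G x D + nb G z D)
    (hx : ∀ v ∈ D, G.Adj x v) : False := by
  have hy0 := (h.mid_eq_zero hD h5).2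
  obtain ⟨d, e, f, s⟩ := h.opt.tri hD h3.le
  by_cases hz : ∀ v ∈ D, G.Adj z v
  · exact (⟨h, hD, s, hx, hz⟩ : Cfg6 G m 𝒞 x y z D d e f).false hyp hh
  · push Not at hz
    obtain ⟨v, hv, hzv⟩ := hz
    obtain ⟨d, e, s⟩ : ∃ d e, Tri G D d e v := by
      rw [s.eq] at hv
      simp only [mem_insert, mem_singleton] at hv
      rcases hv with rfl | rfl | rfl
      exacts [⟨_, _, s.rot.rot⟩, ⟨_, _, s.swp'⟩, ⟨_, _, s⟩]
    have h1 : nb G x D ≤ 3 := h3 ▸ nb_le_card x D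
    have h2 : (decide (G.Adj z d)).toNat + (decide (G.Adj z e)).toNat = 2 := by
      have := Bool.toNat_le (decide (G.Adj z d))
      have := Bool.toNat_le (decide (G.Adj z e))
      have := s.nb z
      simp only [hzv, decide_false, Bool.toNat_false, add_zero] at this
      omega
    obtain ⟨hzd, hze⟩ := and_of_toNat_add h2
    exact h.false_of_five hyp hh hD s (hx d s.ma) (hx e s.mb) (hx v s.mc) hzd hze hzv hy0

theorem false (h : Cfg G m 𝒞 x y z) (hyp : Hyp G m) (hh : EndHigh G m x z) : False := by
  obtain ⟨D, hD, h5⟩ : ∃ D ∈ 𝒞, 4 < nb G x D + nb G z D := by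
    by_contra! hcon
    have h1 := sum_le_card_nsmul _ _ _ hcon
    rw [h.opt.card, smul_eq_mul, sum_add_distrib] at h1
    have e1 := h.opt.fam.nb_univ x
    have e3 := h.opt.fam.nb_univ z
    rw [h.nb_rest] at e1 e3
    simp [h.xy, h.yz.symm, h.not_xz, mt G.adj_symm h.not_xz] at e1 e3
    have := hyp.deg x
    have := hyp.deg z
    rcases hh with hh | hh <;> omega
  obtain ⟨h3, -⟩ := h.mid_eq_zero hD h5
  by_cases hx : 3 ≤ nb G x D
  · exact h.false_of_full hyp hh hD h3 h5 ((filter_eq_self (s := D) (p := G.Adj x)).1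
      (eq_of_subset_of_card_le (filter_subset _ _) (by unfold nb at hx; omega)))
  · exact h.symm.false_of_full hyp hh.symm hD h3 (by omega)
      ((filter_eq_self (s := D) (p := G.Adj z)).1
      (eq_of_subset_of_card_le (filter_subset _ _) (by unfold nb at hx h5; omega)))

end Cfg

end

section

variable {V : Type*} {G : SimpleGraph V}

theorem IsP.nb_first_le_one {p : ℕ → V} {n : ℕ} {X : Finset V} (h : IsP G p n X)
    (hX : ∀ A ⊆ X, ¬ Core G A) (hext : ∀ u ∈ X, G.Adj (p 0) u → ∃ j < n, p j = u) :
    nb G (p 0) X ≤ 1 := by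
  by_contra hcon
  obtain ⟨u, hu, w, hw, huw, h1, h2⟩ := two_le_nb.1 (not_le.1 hcon)
  have key : ∀ u ∈ X, G.Adj (p 0) u → u = p 1 := by
    intro u hu h1
    obtain ⟨j, hj, rfl⟩ := hext u hu h1
    have h0 : j ≠ 0 := fun e => h1.ne (e ▸ rfl)
    by_contra hne
    have : j ≠ 1 := fun e => hne (e ▸ rfl)
    exact hX _ (h.arc_subset hj) (h.core_chord (i := 0) (j := j) (by omega) hj h1)
  exact huw ((key u hu h1).trans (key w hw h2).symm)

variable [Fintype V]

/-- A path of length `L` outside an optimal family, with `L` as large as possible over all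
optimal families. -/
structure Max (G : SimpleGraph V) (m L : ℕ) (𝒞 : Finset (Finset V)) (p : ℕ → V) : Prop where
  opt : Opt G m 𝒞
  isP : IsP G p L (rest 𝒞)
  max : ∀ 𝒟 q k, Opt G m 𝒟 → IsP G q k (rest 𝒟) → k ≤ L

namespace Max

variable {m L : ℕ} {𝒞 𝒟 : Finset (Finset V)} {p q : ℕ → V} {C D : Finset V} {a b c z : V}

theorem of_isP (h : Max G m L 𝒞 p) (ho : Opt G m 𝒟) (hq : IsP G q L (rest 𝒟)) :
    Max G m L 𝒟 q := ⟨ho, hq, h.max⟩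

theorem rev (h : Max G m L 𝒞 p) : Max G m L 𝒞 fun i => p (L - 1 - i) :=
  h.of_isP h.opt h.isP.rev

theorem no_core (h : Max G m L 𝒞 p) : ∀ A ⊆ rest 𝒞, ¬ Core G A := fun _ => h.opt.not_core

theorem exists_of_adj (h : Max G m L 𝒞 p) {u : V} (hu : u ∈ rest 𝒞) (hadj : G.Adj (p 0) u) :
    ∃ j < L, p j = u := by
  obtain ⟨j, -, hj, e⟩ := h.isP.exists_of_longest (fun q k => h.max 𝒞 q k h.opt) hu hadj
  exact ⟨j, hj, e⟩

theorem nb_first (h : Max G m L 𝒞 p) : nb G (p 0) (rest 𝒞) ≤ 1 :=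
  h.isP.nb_first_le_one h.no_core fun _ hu => h.exists_of_adj hu

theorem nb_last (h : Max G m L 𝒞 p) : nb G (p (L - 1)) (rest 𝒞) ≤ 1 := h.rev.nb_first

theorem two_le (h : Max G m L 𝒞 p) (hyp : Hyp G m) (hL : 1 ≤ L) (hR : 2 ≤ (rest 𝒞).card) :
    2 ≤ L := by
  by_contra hcon
  obtain rfl : L = 1 := by omega
  have hind : ∀ u ∈ rest 𝒞, ∀ v ∈ rest 𝒞, ¬ G.Adj u v := fun u hu v hv huv => by
    have := h.max 𝒞 _ _ h.opt ((IsP.single hv).cons hu (fun _ _ => huv.ne') fun _ => huv)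
    omega
  have h0 : ∀ u ∈ rest 𝒞, nb G u (rest 𝒞) = 0 := fun u hu => by
    by_contra hne
    obtain ⟨v, hv, huv⟩ := one_le_nb.1 (Nat.one_le_iff_ne_zero.2 hne)
    exact hind u hu v hv huv
  obtain ⟨x, hx, z, hz, hxz⟩ := one_lt_card.1 hR
  obtain ⟨C, hC, h5⟩ : ∃ C ∈ 𝒞, 4 < nb G x C + nb G z C := by
    by_contra! hcon
    have h1 := sum_le_card_nsmul _ _ _ hcon
    rw [h.opt.card, smul_eq_mul, sum_add_distrib] at h1
    have e1 := h.opt.fam.nb_univ x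
    have e3 := h.opt.fam.nb_univ z
    rw [h0 x hx] at e1
    rw [h0 z hz] at e3
    have := hyp.deg x
    have := hyp.deg z
    omega
  have key : ∀ x ∈ rest 𝒞, ∀ z ∈ rest 𝒞, x ≠ z → 3 ≤ nb G x C → 2 ≤ nb G z C → False := by
    intro x hx z hz hxz h3 h2
    have hC3 : C.card ≤ 3 := by
      by_contra hcon
      have := h.opt.nb_le_two hC (by omega) hx
      omega
    obtain ⟨b, hb, c, hc, hbc, hzb, hzc⟩ := two_le_nb.1 h2
    have hall := (filter_eq_self (s := C) (p := G.Adj x)).1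
      (eq_of_subset_of_card_le (filter_subset _ _) (by unfold nb at h3; omega))
    obtain ⟨a, t⟩ : ∃ a, Tri G C a b c := by
      obtain ⟨u, v, w, t⟩ := h.opt.tri hC hC3
      rw [t.eq] at hb hc
      simp only [mem_insert, mem_singleton] at hb hc
      rcases hb with rfl | rfl | rfl <;> rcases hc with rfl | rfl | rfl <;>
        first
          | exact absurd rfl hbc
          | exact ⟨_, t⟩
          | exact ⟨_, t.swp'⟩
          | exact ⟨_, t.rot⟩
          | exact ⟨_, t.rot.rot⟩
          | exact ⟨_, t.rot.swp'⟩
          | exact ⟨_, t.rot.rot.swp'⟩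
    obtain ⟨h1, h2⟩ := h.opt.swap_one hC t.ma hz (core_insert_erase t hzb hzc)
    have hx' : x ∈ rest (swap 𝒞 C (insert z (C.erase a))) := by rw [h2]; simp [hx, hxz]
    have ha' : a ∈ rest (swap 𝒞 C (insert z (C.erase a))) := by rw [h2]; simp
    have := h.max _ _ _ h1 ((IsP.single ha').cons hx' (fun _ _ => (hall a t.ma).ne')
      fun _ => hall a t.ma)
    omega
  have n1 := h.opt.nb_le_three hC hx
  have n2 := h.opt.nb_le_three hC hz
  by_cases h3 : nb G x C = 3
  · exact key x hx z hz hxz h3.ge (by omega)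
  · exact key z hz x hx hxz.symm (by omega) (by omega)

theorem exists_leaf (h : Max G m L 𝒞 p) (hL : 2 ≤ L) (hne : ∃ v ∈ rest 𝒞, ∀ i < L, p i ≠ v) :
    ∃ z ∈ rest 𝒞, (∀ i < L, p i ≠ z) ∧ nb G z (rest 𝒞) ≤ 1 := by
  by_contra! hcon
  have hP := h.isP
  have hx := hP.mem 0 (by omega)
  have hy := hP.mem (L - 1) (by omega)
  have hxy : p 0 ≠ p (L - 1) := hP.ne (by omega) (by omega) (by omega)
  have hy' : p (L - 1) ∈ (rest 𝒞).erase (p 0) := mem_erase.2 ⟨hxy.symm, hy⟩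
  have hT : ∀ v ∈ ((rest 𝒞).erase (p 0)).erase (p (L - 1)), 2 ≤ nb G v (rest 𝒞) := by
    intro v hv
    simp only [mem_erase] at hv
    by_cases hvP : ∃ i < L, p i = v
    · obtain ⟨i, hi, rfl⟩ := hvP
      have h0 : i ≠ 0 := fun e => hv.2.1 (e ▸ rfl)
      have h1 : i ≠ L - 1 := fun e => hv.1 (e ▸ rfl)
      have a1 := hP.adj (i - 1) (by omega)
      rw [show i - 1 + 1 = i by omega] at a1
      exact two_le_nb.2 ⟨_, hP.mem (i - 1) (by omega), _, hP.mem (i + 1) (by omega),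
        hP.ne (by omega) (by omega) (by omega), a1.symm, hP.adj i (by omega)⟩
    · exact hcon v hv.2.2 (by simpa using hvP)
  have hsum := sum_nb_le_of_no_core (rest 𝒞) ⟨_, hx⟩ h.no_core
  rw [← add_sum_erase (rest 𝒞) _ hx, ← add_sum_erase _ _ hy'] at hsum
  have c1 := card_erase_add_one hx
  have c2 := card_erase_add_one hy'
  have x1 : 1 ≤ nb G (p 0) (rest 𝒞) := one_le_nb.2 ⟨_, hP.mem 1 (by omega), hP.adj 0 (by omega)⟩
  have y1 : 1 ≤ nb G (p (L - 1)) (rest 𝒞) := by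
    have := hP.adj (L - 2) (by omega)
    rw [show L - 2 + 1 = L - 1 by omega] at this
    exact one_le_nb.2 ⟨_, hP.mem (L - 2) (by omega), this.symm⟩
  have hno : ∀ v ∈ ((rest 𝒞).erase (p 0)).erase (p (L - 1)), nb G v (rest 𝒞) < 3 := by
    intro v hv
    by_contra h3
    rw [← add_sum_erase _ _ hv] at hsum
    have c3 := card_erase_add_one hv
    have := card_nsmul_le_sum ((((rest 𝒞).erase (p 0)).erase (p (L - 1))).erase v) (fun w => nb G w (rest 𝒞)) 2
      fun w hw => hT w (mem_of_mem_erase hw)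
    rw [smul_eq_mul] at this
    omega
  have hsep : ∀ u ∈ rest 𝒞, (∀ i < L, p i ≠ u) → ∀ i < L, ¬ G.Adj u (p i) := by
    intro u hu huP i hi hadj
    by_cases h0 : i = 0
    · subst h0
      obtain ⟨j, hj, e⟩ := h.exists_of_adj hu hadj.symm
      exact huP j hj e
    by_cases h1 : i = L - 1
    · subst h1
      obtain ⟨j, hj, e⟩ := h.rev.exists_of_adj hu hadj.symm
      exact huP _ (by omega) e
    have a1 := hP.adj (i - 1) (by omega)
    rw [show i - 1 + 1 = i by omega] at a1
    have hlt := hno (p i) (by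
      simp only [mem_erase]
      exact ⟨hP.ne (by omega) (by omega) h1, hP.ne (by omega) (by omega) h0, hP.mem i hi⟩)
    have h3 : nb G (p i) {p (i - 1), p (i + 1), u} = 3 := by
      rw [nb_triple _ (hP.ne (by omega) (by omega) (by omega)) (huP _ (by omega))
        (huP _ (by omega))]
      simp [a1.symm, hP.adj i (by omega), hadj.symm]
    have := nb_mono (G := G) (p i) (S := {p (i - 1), p (i + 1), u}) (T := (rest 𝒞)) (by
      simp only [insert_subset_iff, singleton_subset_iff]
      exact ⟨hP.mem _ (by omega), hP.mem _ (by omega), hu⟩)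
    omega
  obtain ⟨v, hv, hvP⟩ := hne
  refine h.no_core ((rest 𝒞).filter fun v => ∀ i < L, p i ≠ v) (filter_subset _ _)
    (core_of ⟨v, mem_filter.2 ⟨hv, hvP⟩⟩ fun u hu => ?_)
  rw [mem_filter] at hu
  obtain ⟨w, hw, w', hw', hww, a1, a2⟩ := two_le_nb.1 (hcon u hu.1 hu.2)
  have hs := hsep u hu.1 hu.2
  exact ⟨w, mem_filter.2 ⟨hw, fun i hi e => hs i hi (e ▸ a1)⟩, w',
    mem_filter.2 ⟨hw', fun i hi e => hs i hi (e ▸ a2)⟩, hww, a1, a2⟩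

end Max

end

section

variable {V : Type*} {G : SimpleGraph V} [Fintype V]

/-- `x` and `z` have the same two neighbours in every member of `𝒞`, one neighbour outside, and
small degree. -/
structure Twin (G : SimpleGraph V) (m : ℕ) (𝒞 : Finset (Finset V)) (x z : V) : Prop where
  card : ∀ C ∈ 𝒞, C.card ≤ 4
  two : ∀ C ∈ 𝒞, nb G x C = 2
  same : ∀ C ∈ 𝒞, ∀ c ∈ C, (G.Adj z c ↔ G.Adj x c)
  deg : nb G x univ = 2 * m + 1
  deg' : nb G z univ = 2 * m + 1
  nb_rest : nb G x (rest 𝒞) = 1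
  nb_rest' : nb G z (rest 𝒞) = 1

namespace Max

variable {m L : ℕ} {𝒞 𝒟 : Finset (Finset V)} {p q : ℕ → V} {C D : Finset V} {a b c z : V}

theorem swap_leaf (h : Max G m L 𝒞 p) (hz : z ∈ rest 𝒞)
    (hzp : ∀ i < L, p i ≠ z) (hC : C ∈ 𝒞) (ha : a ∈ C)
    (hcore : Core G (insert z (C.erase a))) : ¬ G.Adj (p 0) a := by
  intro hadj
  obtain ⟨h1, h2⟩ := h.opt.swap_one hC ha hz hcore
  have hp : IsP G p L (rest (swap 𝒞 C (insert z (C.erase a)))) :=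
    ⟨fun i hi => by rw [h2]; simp [h.isP.mem i hi, hzp i hi], h.isP.inj, h.isP.adj⟩
  have := h.max _ _ _ h1 (hp.cons (c := a) (by rw [h2]; simp)
    (fun i hi => (h.opt.ne_rest hC ha (h.isP.mem i hi)).symm) fun _ => hadj.symm)
  omega

theorem swap_first (h : Max G m L 𝒞 p) (hL : 2 ≤ L) (hz : z ∈ rest 𝒞)
    (hzp : ∀ i < L, p i ≠ z) (hC : C ∈ 𝒞) (t : Tri G C a b c) (hxb : G.Adj (p 0) b)
    (hxc : G.Adj (p 0) c) (hya : G.Adj (p (L - 1)) a) (hza : G.Adj z a) : False := by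
  obtain ⟨h1, h2⟩ := h.opt.swap_one hC t.ma (h.isP.mem 0 (by omega)) (core_insert_erase t hxb hxc)
  have hp : IsP G (fun i => p (i + 1)) (L - 1)
      (rest (swap 𝒞 C (insert (p 0) (C.erase a)))) := by
    have hd := h.isP.drop 1
    refine ⟨fun i hi => ?_, hd.inj, hd.adj⟩
    rw [h2]
    have := hd.mem i hi
    have := h.isP.ne (i := i + 1) (j := 0) (by omega) (by omega) (by omega)
    simp_all
  have hp2 := hp.snoc (c := a) (by rw [h2]; simp)
    (fun i hi => (h.opt.ne_rest hC t.ma (h.isP.mem _ (by omega))).symm) fun _ => by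
      rw [show L - 1 - 1 + 1 = L - 1 by omega]; exact hya
  have hp3 := hp2.snoc (c := z) (by rw [h2]; simp [hz, (hzp 0 (by omega)).symm])
    (fun i hi => by
      split_ifs
      · exact hzp _ (by omega)
      · exact h.opt.ne_rest hC t.ma hz) fun _ => by
      rw [if_neg (by omega)]; exact hza.symm
  have := h.max _ _ _ h1 hp3
  omega

theorem leaf_rule (h : Max G m L 𝒞 p) (hL : 2 ≤ L) (hz : z ∈ rest 𝒞)
    (hzp : ∀ i < L, p i ≠ z) (hC : C ∈ 𝒞) (t : Tri G C a b c) :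
    leafRule (decide (G.Adj (p 0) a)) (decide (G.Adj (p 0) b)) (decide (G.Adj (p 0) c))
      (decide (G.Adj (p (L - 1)) a)) (decide (G.Adj (p (L - 1)) b))
      (decide (G.Adj (p (L - 1)) c))
      (decide (G.Adj z a)) (decide (G.Adj z b)) (decide (G.Adj z c)) := by
  have hzp' : ∀ i < L, p (L - 1 - i) ≠ z := fun i hi => hzp _ (by omega)
  have e : L - 1 - (L - 1) = 0 := by omega
  have r1 : ∀ {a b c}, Tri G C a b c → G.Adj z b → G.Adj z c → G.Adj (p 0) a → False :=
    fun t hb hc => h.swap_leaf hz hzp hC t.ma (core_insert_erase t hb hc)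
  have r2 : ∀ {a b c}, Tri G C a b c → G.Adj z b → G.Adj z c → G.Adj (p (L - 1)) a → False :=
    fun t hb hc => h.rev.swap_leaf hz hzp' hC t.ma (core_insert_erase t hb hc)
  have r3 : ∀ {a b c}, Tri G C a b c → G.Adj (p 0) b → G.Adj (p 0) c →
      G.Adj (p (L - 1)) a → G.Adj z a → False := fun t => h.swap_first hL hz hzp hC t
  have r4 : ∀ {a b c}, Tri G C a b c → G.Adj (p (L - 1)) b → G.Adj (p (L - 1)) c →
      G.Adj (p 0) a → G.Adj z a → False := fun t h1 h2 h3 h4 =>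
    h.rev.swap_first hL hz hzp' hC t h1 h2 (by simpa only [e] using h3) h4
  simp only [leafRule, Bool.and_eq_true]
  refine ⟨⟨⟨⟨⟨⟨⟨⟨⟨⟨⟨?_, ?_⟩, ?_⟩, ?_⟩, ?_⟩, ?_⟩, ?_⟩, ?_⟩, ?_⟩, ?_⟩, ?_⟩, ?_⟩
  exacts [not_and_three (r1 t), not_and_three (r1 t.swp), not_and_three (r1 t.rot),
    not_and_three (r2 t), not_and_three (r2 t.swp), not_and_three (r2 t.rot),
    not_and_four (r3 t), not_and_four (r3 t.swp), not_and_four (r3 t.rot),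
    not_and_four (r4 t), not_and_four (r4 t.swp), not_and_four (r4 t.rot)]

theorem leaf_quad (h : Max G m L 𝒞 p) (hz : z ∈ rest 𝒞)
    (hzp : ∀ i < L, p i ≠ z) (hC : C ∈ 𝒞) (h4 : C.card = 4) (h1 : 2 ≤ nb G (p 0) C)
    (h2 : 2 ≤ nb G z C) : ∀ c ∈ C, (G.Adj z c ↔ G.Adj (p 0) c) := by
  obtain ⟨a, b, c, d, hab, hbc, hcd, hda, hac, hbd, e, hza, hzc, hzb, hzd⟩ :=
    h.opt.quad_pair hC h4 hz h2
  have ma : a ∈ C := by simp [e]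
  have mb : b ∈ C := by simp [e]
  have mc : c ∈ C := by simp [e]
  have md : d ∈ C := by simp [e]
  have nz := fun v hv => (h.opt.ne_rest hC (c := v) hv hz).symm
  have hxb := h.swap_leaf hz hzp hC mb (by
    rw [show C.erase b = {c, d, a} by
      rw [e]; ext v; simp only [mem_erase, mem_insert, mem_singleton]
      have := hab.ne
      have := hbc.ne
      grind]
    exact core_quad hzc hcd hda hza.symm (nz d md) hac.symm)
  have hxd := h.swap_leaf hz hzp hC md (by
    rw [show C.erase d = {a, b, c} by
      rw [e]; ext v; simp only [mem_erase, mem_insert, mem_singleton]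
      have := hda.ne
      have := hcd.ne
      grind]
    exact core_quad hza hab hbc hzc.symm (nz b mb) hac)
  rw [e, nb_quad _ hab hbc hcd hda hac hbd] at h1
  simp only [hxb, hxd, decide_false, Bool.toNat_false, add_zero] at h1
  have b1 := Bool.toNat_le (decide (G.Adj (p 0) a))
  have b2 := Bool.toNat_le (decide (G.Adj (p 0) c))
  obtain ⟨hxa, hxc⟩ := and_of_toNat_add (p := G.Adj (p 0) a) (q := G.Adj (p 0) c) (by omega)
  intro v hv
  rw [e] at hv
  simp only [mem_insert, mem_singleton] at hv
  rcases hv with rfl | rfl | rfl | rfl <;> simp [*]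

theorem leaf_le (h : Max G m L 𝒞 p) (hL : 2 ≤ L) (hz : z ∈ rest 𝒞)
    (hzp : ∀ i < L, p i ≠ z) (hC : C ∈ 𝒞) :
    nb G (p 0) C + nb G (p (L - 1)) C + nb G z C ≤ 6 ∧
    (nb G (p 0) C + nb G (p (L - 1)) C + nb G z C = 6 → nb G z C ≤ 2 ∧
      (nb G z C = 2 → C.card ≤ 4 ∧ nb G (p 0) C = 2 ∧
        ∀ c ∈ C, (G.Adj z c ↔ G.Adj (p 0) c))) := by
  have hx := h.isP.mem 0 (by omega)
  have hy := h.isP.mem (L - 1) (by omega)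
  by_cases h3 : C.card ≤ 3
  · obtain ⟨a, b, c, t⟩ := h.opt.tri hC h3
    have key := leafRule_sum _ _ _ _ _ _ _ _ _ (h.leaf_rule hL hz hzp hC t)
    simp only [← t.nb] at key
    refine ⟨key.1, fun h6 => ⟨(key.2 h6).1, fun h2 => ?_⟩⟩
    obtain ⟨k1, k2, k3, k4, k5, k6⟩ := (key.2 h6).2 h2
    refine ⟨by omega, ?_, ?_⟩
    · rw [t.nb, ← k1, ← k2, ← k3, ← t.nb, h2]
    · rw [decide_eq_decide] at k1 k2 k3
      rw [t.eq]
      simp [k1, k2, k3]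
  · have n1 := h.opt.nb_le_two hC (by omega) hx
    have n2 := h.opt.nb_le_two hC (by omega) hy
    have n3 := h.opt.nb_le_two hC (by omega) hz
    by_cases h4 : C.card = 4
    · exact ⟨by omega, fun h6 => ⟨n3, fun h2 => ⟨by omega, by omega,
        h.leaf_quad hz hzp hC h4 (by omega) h2.ge⟩⟩⟩
    · have n1 := h.opt.nb_le_one hC (by omega) hx
      have n2 := h.opt.nb_le_one hC (by omega) hy
      have n3 := h.opt.nb_le_one hC (by omega) hz
      exact ⟨by omega, fun h6 => by omega⟩

theorem twin (h : Max G m L 𝒞 p) (hyp : Hyp G m) (hL : 2 ≤ L) (hz : z ∈ rest 𝒞)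
    (hzp : ∀ i < L, p i ≠ z) (hleaf : nb G z (rest 𝒞) ≤ 1) : Twin G m 𝒞 (p 0) z := by
  have d1 := hyp.deg (p 0)
  have d2 := hyp.deg (p (L - 1))
  have d3 := hyp.deg z
  have e1 := h.opt.fam.nb_univ (p 0)
  have e2 := h.opt.fam.nb_univ (p (L - 1))
  have e3 := h.opt.fam.nb_univ z
  have n1 := h.nb_first
  have n2 := h.nb_last
  have hle := fun C hC => (h.leaf_le hL hz hzp (C := C) hC).1
  have hs := sum_le_card_nsmul _ _ _ hle
  rw [h.opt.card, smul_eq_mul, sum_add_distrib, sum_add_distrib] at hs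
  have heq : ∀ C ∈ 𝒞, nb G (p 0) C + nb G (p (L - 1)) C + nb G z C = 6 := by
    refine (sum_eq_sum_iff_of_le hle).1 ?_
    rw [sum_const, h.opt.card, smul_eq_mul, sum_add_distrib, sum_add_distrib]
    omega
  have hle2 := fun C hC => ((h.leaf_le hL hz hzp (C := C) hC).2 (heq C hC)).1
  have hs2 := sum_le_card_nsmul _ _ _ hle2
  rw [h.opt.card, smul_eq_mul] at hs2
  have heq2 : ∀ C ∈ 𝒞, nb G z C = 2 := by
    refine (sum_eq_sum_iff_of_le hle2).1 ?_
    rw [sum_const, h.opt.card, smul_eq_mul]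
    omega
  have key := fun C hC => ((h.leaf_le hL hz hzp (C := C) hC).2 (heq C hC)).2 (heq2 C hC)
  exact ⟨fun C hC => (key C hC).1, fun C hC => (key C hC).2.1, fun C hC => (key C hC).2.2,
    by omega, by omega, by omega, by omega⟩

end Max

end

section

variable {V : Type*} {G : SimpleGraph V}

theorem Opt.tri_of_mem {m : ℕ} {𝒞 : Finset (Finset V)} {C : Finset V} {a : V} (h : Opt G m 𝒞)
    (hC : C ∈ 𝒞) (h3 : C.card ≤ 3) (ha : a ∈ C) : ∃ b c, Tri G C a b c := by
  obtain ⟨u, v, w, t⟩ := h.tri hC h3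
  rw [t.eq] at ha
  simp only [mem_insert, mem_singleton] at ha
  rcases ha with rfl | rfl | rfl
  exacts [⟨_, _, t⟩, ⟨_, _, t.swp⟩, ⟨_, _, t.rot⟩]

variable [Fintype V]

/-- An edge `xy` outside a small cycle `C` closes up with part of `C`, sparing a neighbour
of `x`. -/
theorem Opt.exists_core_erase {m : ℕ} {𝒞 : Finset (Finset V)} {C : Finset V} {x y : V}
    (h : Opt G m 𝒞) (hC : C ∈ 𝒞) (h4 : C.card ≤ 4) (hx : x ∈ rest 𝒞) (hy : y ∈ rest 𝒞)
    (hxy : G.Adj x y) (h2 : 2 ≤ nb G x C) (h1 : 1 ≤ nb G y C) :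
    ∃ c ∈ C, G.Adj x c ∧ ∃ A, Core G A ∧ A ⊆ insert x (insert y (C.erase c)) := by
  obtain ⟨a, ha, b, hb, hab, hxa, hxb⟩ := two_le_nb.1 h2
  obtain ⟨c, hc, hyc⟩ := one_le_nb.1 h1
  have nx := fun v hv => h.ne_rest hC (c := v) hv hx
  have ny := fun v hv => h.ne_rest hC (c := v) hv hy
  by_cases hxc : G.Adj x c
  · obtain ⟨e, he, hxe, hec⟩ : ∃ e ∈ C, G.Adj x e ∧ e ≠ c := by
      by_cases hac : a = c
      · exact ⟨b, hb, hxb, fun e => hab (hac.trans e.symm)⟩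
      · exact ⟨a, ha, hxa, hac⟩
    refine ⟨e, he, hxe, _, core_triple hxy hxc hyc, ?_⟩
    simp only [insert_subset_iff, singleton_subset_iff, mem_insert, mem_erase]
    exact ⟨Or.inl trivial, Or.inr (Or.inl trivial), Or.inr (Or.inr ⟨hec.symm, hc⟩)⟩
  have hca : c ≠ a := fun e => hxc (e ▸ hxa)
  have hcb : c ≠ b := fun e => hxc (e ▸ hxb)
  have key : ∃ e ∈ C, ∃ f ∈ C, G.Adj x e ∧ G.Adj x f ∧ e ≠ f ∧ G.Adj c e := by
    by_contra hcon
    have na : ¬ G.Adj c a := fun hca => hcon ⟨a, ha, b, hb, hxa, hxb, hab, hca⟩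
    have nb' : ¬ G.Adj c b := fun hcb => hcon ⟨b, hb, a, ha, hxb, hxa, hab.symm, hcb⟩
    have hN := (h.fam.core C hC).2 c hc
    have hsub : C.filter (G.Adj c) ⊆ ((C.erase a).erase b).erase c := by
      intro v hv
      rw [mem_filter] at hv
      simp only [mem_erase]
      exact ⟨hv.2.ne', fun e => nb' (e ▸ hv.2), fun e => na (e ▸ hv.2), hv.1⟩
    have := card_le_card hsub
    have c1 := card_erase_add_one ha
    have c2 := card_erase_add_one (s := C.erase a) (a := b) (by simp [hab.symm, hb])
    have c3 := card_erase_add_one (s := (C.erase a).erase b) (a := c) (by simp [hca, hcb, hc])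
    unfold nb at hN
    omega
  obtain ⟨e, he, f, hf, hxe, hxf, hef, hce⟩ := key
  refine ⟨f, hf, hxf, _, core_quad hxy hyc hce hxe.symm (nx c hc).symm (ny e he).symm, ?_⟩
  simp only [insert_subset_iff, singleton_subset_iff, mem_insert, mem_erase]
  exact ⟨Or.inl trivial, Or.inr (Or.inl trivial), Or.inr (Or.inr ⟨fun e => hxc (e ▸ hxf), hc⟩),
    Or.inr (Or.inr ⟨hef, he⟩)⟩

namespace Max

variable {m L : ℕ} {𝒞 𝒟 : Finset (Finset V)} {p q : ℕ → V} {C D : Finset V} {a b c z : V}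

theorem not_two_cores (h : Max G m L 𝒞 p) (hL : 2 ≤ L) {k : ℕ} (hq : IsP G q k (rest 𝒞))
    (hk : 2 ≤ k) (hq0 : ∀ i < k, q i ≠ p 0) (hq1 : ∀ i < k, q i ≠ p 1) {w : V}
    (hw : w ∈ rest 𝒞) (hqw : ∀ i < k, q i ≠ w) (hC : C ∈ 𝒞) (hc : c ∈ C)
    (h0 : G.Adj (q 0) c) (h1 : G.Adj (q (k - 1)) c) {A : Finset V} (hA : Core G A)
    (hAs : A ⊆ insert w (insert (p 0) (insert (p 1) (C.erase c)))) : False := by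
  refine h.opt.no_two hC hA (hq.core_vertex (i := 0) (j := k - 1) (by omega) (by omega)
    (fun hcr => h.opt.ne_rest hC hc hcr rfl) h0.symm h1.symm) ?_ ?_ ?_
  · rw [disjoint_left]
    intro v hv hv'
    have hv2 := hAs hv
    simp only [mem_insert, mem_image, mem_Icc, mem_erase] at hv2 hv'
    rcases hv' with rfl | ⟨i, hi, rfl⟩
    · rcases hv2 with e | e | e | e
      · exact h.opt.ne_rest hC hc hw e
      · exact h.opt.ne_rest hC hc (h.isP.mem 0 (by omega)) e
      · exact h.opt.ne_rest hC hc (h.isP.mem 1 (by omega)) e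
      · exact e.1 rfl
    · rcases hv2 with e | e | e | e
      · exact hqw i (by omega) e
      · exact hq0 i (by omega) e
      · exact hq1 i (by omega) e
      · exact h.opt.ne_rest hC e.2 (hq.mem i (by omega)) rfl
  · intro v hv
    have hv2 := hAs hv
    simp only [mem_insert, mem_erase] at hv2
    rw [mem_union]
    rcases hv2 with e | e | e | e
    · exact Or.inr (e ▸ hw)
    · exact Or.inr (e ▸ h.isP.mem 0 (by omega))
    · exact Or.inr (e ▸ h.isP.mem 1 (by omega))
    · exact Or.inl e.2
  · intro v hv
    rw [mem_insert] at hv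
    rw [mem_union]
    rcases hv with rfl | hv
    · exact Or.inl hc
    · exact Or.inr (hq.arc_subset (by omega) hv)

/-- No path outside `𝒞` joins two vertices with the same neighbours in `𝒞` as an end of a longest
path, avoiding the two vertices at that end. -/
theorem meets_first (h : Max G m L 𝒞 p) (hyp : Hyp G m) (hL : 2 ≤ L) (hz : z ∈ rest 𝒞)
    (hzp : ∀ i < L, p i ≠ z) (hleaf : nb G z (rest 𝒞) ≤ 1) {k : ℕ} (hq : IsP G q k (rest 𝒞))
    (hk : 2 ≤ k) (h0 : ∀ C ∈ 𝒞, ∀ c ∈ C, G.Adj (p 0) c → G.Adj (q 0) c)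
    (h1 : ∀ C ∈ 𝒞, ∀ c ∈ C, G.Adj (p 0) c → G.Adj (q (k - 1)) c)
    (hq0 : ∀ i < k, q i ≠ p 0) (hq1 : ∀ i < k, q i ≠ p 1) : False := by
  have t := h.twin hyp hL hz hzp hleaf
  have hx := h.isP.mem 0 (by omega)
  have hx1 := h.isP.mem 1 (by omega)
  have h01 : G.Adj (p 0) (p 1) := h.isP.adj 0 (by omega)
  have hno : ∀ C ∈ 𝒞, nb G (p 1) C = 0 := by
    intro C hC
    by_contra hne
    obtain ⟨c, hc, hxc, A, hA, hAs⟩ := h.opt.exists_core_erase hC (t.card C hC) hx hx1 h01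
      (t.two C hC).ge (by omega)
    exact h.not_two_cores hL hq hk hq0 hq1 hx hq0 hC hc (h0 C hC c hc hxc) (h1 C hC c hc hxc) hA
      (hAs.trans (subset_insert _ _))
  have hdeg := hyp.deg (p 1)
  have hpos := hyp.pos
  rw [h.opt.fam.nb_univ, sum_eq_zero hno] at hdeg
  have hL2 : L ≠ 2 := by
    rintro rfl
    have := h.nb_last
    simp only [show 2 - 1 = 1 by omega] at this
    omega
  obtain ⟨w, hw, hw0, hw2, hww⟩ : ∃ w ∈ rest 𝒞, w ≠ p 0 ∧ w ≠ p 2 ∧ G.Adj (p 1) w := by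
    by_contra! hcon
    have hsub : (rest 𝒞).filter (G.Adj (p 1)) ⊆ {p 0, p 2} := by
      intro v hv
      rw [mem_filter] at hv
      rw [mem_insert, mem_singleton]
      by_contra! hv2
      exact hcon v hv.1 hv2.1 hv2.2 hv.2
    have := card_le_card hsub
    have := card_le_two (a := p 0) (b := p 2)
    unfold nb at hdeg
    omega
  have hwp : ∀ i < L, p i ≠ w := by
    rintro i hi rfl
    have : i ≠ 0 := fun e => hw0 (e ▸ rfl)
    have : i ≠ 1 := fun e => hww.ne (e ▸ rfl)
    have : i ≠ 2 := fun e => hw2 (e ▸ rfl)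
    exact h.no_core _ (h.isP.arc_subset hi) (h.isP.core_chord (i := 1) (by omega) hi hww)
  have hP : IsP G (fun i => if i = 0 then w else p (i - 1 + 1)) L (rest 𝒞) := by
    have := (h.isP.drop 1).cons hw (fun i hi => hwp _ (by omega)) fun _ => hww.symm
    rwa [show L - 1 + 1 = L by omega] at this
  have hw1 : nb G w (rest 𝒞) ≤ 1 := (h.of_isP h.opt hP).nb_first
  have tw := h.twin hyp hL hw hwp hw1
  have hwq : ∀ i < k, q i ≠ w := by
    rintro i hi rfl
    by_cases hi0 : i = 0
    · subst hi0
      have := eq_of_nb_le_one hw1 (hq.mem 1 (by omega)) hx1 (hq.adj 0 (by omega)) hww.symm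
      exact hq1 1 (by omega) this
    · have ha := hq.adj (i - 1) (by omega)
      rw [show i - 1 + 1 = i by omega] at ha
      have := eq_of_nb_le_one hw1 (hq.mem (i - 1) (by omega)) hx1 ha.symm hww.symm
      exact hq1 (i - 1) (by omega) this
  obtain ⟨C, hC⟩ : 𝒞.Nonempty := card_pos.1 (by rw [h.opt.card]; omega)
  obtain ⟨a, ha, b, hb, hab, hxa, hxb⟩ := two_le_nb.1 (t.two C hC).ge
  refine h.not_two_cores hL hq hk hq0 hq1 hw hwq hC hb (h0 C hC b hb hxb) (h1 C hC b hb hxb)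
    (core_quad h01 hww ((tw.same C hC a ha).2 hxa) hxa.symm (hwp 0 (by omega))
      (h.opt.ne_rest hC ha hx1).symm) ?_
  simp only [insert_subset_iff, singleton_subset_iff, mem_insert, mem_erase]
  tauto

end Max

end

section

variable {V : Type*} {G : SimpleGraph V}

theorem IsP.two_le_nb {q : ℕ → V} {k l : ℕ} {X : Finset V} (h : IsP G q k X) (h0 : 0 < l)
    (h1 : l + 1 < k) : 2 ≤ nb G (q l) X := by
  have a := h.adj (l - 1) (by omega)
  rw [show l - 1 + 1 = l by omega] at a
  exact DisjointCycles.two_le_nb.2 ⟨_, h.mem (l - 1) (by omega), _, h.mem (l + 1) h1,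
    h.ne (by omega) h1 (by omega), a.symm, h.adj l h1⟩

variable [Fintype V]

namespace Max

variable {m L : ℕ} {𝒞 𝒟 : Finset (Finset V)} {p q : ℕ → V} {C D : Finset V} {a b c z : V}

theorem exists_eq_first (h : Max G m L 𝒞 p) (hyp : Hyp G m) (hL : 2 ≤ L) (hz : z ∈ rest 𝒞)
    (hzp : ∀ i < L, p i ≠ z) (hleaf : nb G z (rest 𝒞) ≤ 1) {k : ℕ} (hq : IsP G q k (rest 𝒞))
    (hk : 2 ≤ k) (h0 : ∀ C ∈ 𝒞, ∀ c ∈ C, G.Adj (p 0) c → G.Adj (q 0) c)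
    (h1 : ∀ C ∈ 𝒞, ∀ c ∈ C, G.Adj (p 0) c → G.Adj (q (k - 1)) c)
    (hq0 : q 0 ≠ p 0) : ∃ i < k, q i = p 1 := by
  by_contra! hcon
  refine h.meets_first hyp hL hz hzp hleaf hq hk h0 h1 (fun i hi e => ?_) hcon
  have hi0 : i ≠ 0 := fun e' => hq0 (e' ▸ e)
  have ha := hq.adj (i - 1) (by omega)
  rw [show i - 1 + 1 = i by omega, e] at ha
  exact hcon (i - 1) (by omega) (eq_of_nb_le_one h.nb_first (hq.mem _ (by omega))
    (h.isP.mem 1 (by omega)) ha.symm (h.isP.adj 0 (by omega)))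

theorem snoc_first (h : Max G m L 𝒞 p) (hL : 2 ≤ L) {k i : ℕ} (hq : IsP G q k (rest 𝒞))
    (hq0 : q 0 ≠ p 0) (hi : i < k) (hqi : q i = p 1) :
    IsP G (fun l => if l < i + 1 then q l else p 0) (i + 1 + 1) (rest 𝒞) := by
  have h01 : G.Adj (p 0) (p 1) := h.isP.adj 0 (by omega)
  refine (hq.take (k := i + 1) (by omega)).snoc (h.isP.mem 0 (by omega)) (fun l hl e => ?_)
    fun _ => ?_
  · have : l ≠ 0 := fun e' => hq0 (e' ▸ e)
    have : l ≠ i := fun e' => h01.ne (by rw [← e, ← hqi, e'])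
    have h2 := hq.two_le_nb (l := l) (by omega) (by omega)
    rw [e] at h2
    have := h.nb_first
    omega
  · rw [Nat.add_sub_cancel, hqi]
    exact h01.symm

theorem not_first_lt (h : Max G m L 𝒞 p) (hyp : Hyp G m) (hL : 3 ≤ L) (hz : z ∈ rest 𝒞)
    (hzp : ∀ i < L, p i ≠ z) (hleaf : nb G z (rest 𝒞) ≤ 1) {k : ℕ} (hq : IsP G q k (rest 𝒞))
    (hqz : q 0 = z) {i j : ℕ} (hij : i < j) (hj : j < k) (hqi : q i = p 1)
    (hqj : q j = p (L - 2)) : False := by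
  have tx := h.twin hyp (by omega) hz hzp hleaf
  have hzp' : ∀ i < L, p (L - 1 - i) ≠ z := fun i hi => hzp _ (by omega)
  have ty := h.rev.twin hyp (by omega) hz hzp' hleaf
  have hP := h.snoc_first (by omega) hq (hqz ▸ (hzp 0 (by omega)).symm) (by omega) hqi
  refine h.rev.meets_first hyp (by omega) hz hzp' hleaf hP (by omega) (fun C hC c hc hyc => ?_)
    (fun C hC c hc hyc => ?_) (fun l hl => ?_) fun l hl => ?_
  · rw [if_pos (by omega), hqz]
    exact (ty.same C hC c hc).2 hyc
  · rw [if_neg (by omega)]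
    exact (tx.same C hC c hc).1 ((ty.same C hC c hc).2 hyc)
  · split_ifs with hl'
    · intro e
      have : l ≠ 0 := fun e' => hzp (L - 1) (by omega) (by rw [← hqz, ← e']; exact e.symm)
      have h2 := hq.two_le_nb (l := l) (by omega) (by omega)
      have := h.nb_last
      simp only [Nat.sub_zero] at e
      rw [e] at h2
      omega
    · exact h.isP.ne (by omega) (by omega) (by omega)
  · rw [show L - 1 - 1 = L - 2 by omega]
    split_ifs with hl'
    · rw [← hqj]
      exact hq.ne (by omega) (by omega) (by omega)
    · exact h.isP.ne (by omega) (by omega) (by omega)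

theorem leaf_adj (h : Max G m L 𝒞 p) (hyp : Hyp G m) (hL : 2 ≤ L) (hz : z ∈ rest 𝒞)
    (hzp : ∀ i < L, p i ≠ z) (hleaf : nb G z (rest 𝒞) ≤ 1) : L = 3 ∧ G.Adj z (p 1) := by
  have tx := h.twin hyp hL hz hzp hleaf
  have hzp' : ∀ i < L, p (L - 1 - i) ≠ z := fun i hi => hzp _ (by omega)
  have ty := h.rev.twin hyp hL hz hzp' hleaf
  obtain ⟨u, hu, hzu⟩ := one_le_nb.1 tx.nb_rest'.ge
  obtain ⟨k, ⟨q, hq, hqz⟩, hmax⟩ := exists_max_nat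
    (P := fun k => ∃ q, IsP G q k (rest 𝒞) ∧ q 0 = z)
    ⟨_, (IsP.single hu).cons hz (fun _ _ => hzu.ne') fun _ => hzu, by simp⟩
    (fun k hk => hk.choose_spec.1.card_le)
  have hk : 2 ≤ k := hmax 2 ⟨_, (IsP.single hu).cons hz (fun _ _ => hzu.ne') fun _ => hzu, by simp⟩
  have hw : nb G (q (k - 1)) (rest 𝒞) ≤ 1 := by
    refine hq.rev.nb_first_le_one h.no_core fun v hv hadj => ?_
    by_contra! hcon
    have := hmax (k + 1) ⟨_, hq.snoc hv (fun i hi => by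
      have := hcon (k - 1 - i) (by omega)
      rwa [show k - 1 - (k - 1 - i) = i by omega] at this) fun _ => hadj, by
        rw [if_pos (by omega)]; exact hqz⟩
    omega
  have hsame : ∀ C ∈ 𝒞, ∀ c ∈ C, (G.Adj (p 0) c → G.Adj (q (k - 1)) c) := by
    intro C hC c hc hxc
    by_cases hp : ∃ i < L, p i = q (k - 1)
    · obtain ⟨i, hi, e⟩ := hp
      by_cases hi0 : i = 0
      · rw [← e, hi0]; exact hxc
      by_cases hi1 : i = L - 1
      · rw [← e, hi1]
        exact (ty.same C hC c hc).1 ((tx.same C hC c hc).2 hxc)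
      · have := h.isP.two_le_nb (l := i) (by omega) (by omega)
        rw [e] at this
        omega
    · push Not at hp
      exact ((h.twin hyp hL (hq.mem _ (by omega)) hp hw).same C hC c hc).2 hxc
  have hz0 : ∀ i < L, q 0 ≠ p i := fun i hi => by rw [hqz]; exact (hzp i hi).symm
  obtain ⟨i, hi, hqi⟩ := h.exists_eq_first hyp hL hz hzp hleaf hq hk
    (fun C hC c hc hxc => by rw [hqz]; exact (tx.same C hC c hc).2 hxc) hsame (hz0 0 (by omega))
  obtain ⟨j, hj, hqj⟩ := h.rev.exists_eq_first hyp hL hz hzp' hleaf hq hk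
    (fun C hC c hc hyc => by rw [hqz]; exact (ty.same C hC c hc).2 hyc)
    (fun C hC c hc hyc => hsame C hC c hc ((tx.same C hC c hc).1 ((ty.same C hC c hc).2 hyc)))
    (hz0 _ (by omega))
  have hi0 : i ≠ 0 := fun e => hz0 1 (by omega) (e ▸ hqi)
  have hL3 : 3 ≤ L := by
    by_contra hcon
    obtain rfl : L = 2 := by omega
    have ha := hq.adj (i - 1) (by omega)
    rw [show i - 1 + 1 = i by omega, hqi] at ha
    have e := eq_of_nb_le_one h.nb_last (hq.mem (i - 1) (by omega)) (h.isP.mem 0 (by omega))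
      ha.symm (h.isP.adj 0 (by omega)).symm
    have : i - 1 ≠ 0 := fun e' => hz0 0 (by omega) (e' ▸ e)
    have h2 := hq.two_le_nb (l := i - 1) (by omega) (by omega)
    rw [e] at h2
    have := h.nb_first
    omega
  have hqj' : q j = p (L - 2) := by rw [hqj, show L - 1 - 1 = L - 2 by omega]
  rcases lt_trichotomy i j with hij | rfl | hij
  · exact (h.not_first_lt hyp hL3 hz hzp hleaf hq hqz hij hj hqi hqj').elim
  · have hL' : L = 3 := by
      have := h.isP.inj 1 (by omega) (L - 2) (by omega) (hqi.symm.trans hqj')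
      omega
    refine ⟨hL', ?_⟩
    have := h.max _ _ _ h.opt (h.snoc_first hL hq (hz0 0 (by omega)) hi hqi)
    obtain rfl : i = 1 := by omega
    have := hq.adj 0 (by omega)
    rwa [hqi, hqz] at this
  · exact (h.rev.not_first_lt hyp hL3 hz hzp' hleaf hq hqz hij hi hqj (by
      rw [hqi, show L - 1 - (L - 2) = 1 by omega])).elim

end Max

end

section

variable {V : Type*} {G : SimpleGraph V} [Fintype V]

theorem Opt.core_erase {m : ℕ} {𝒞 : Finset (Finset V)} {C : Finset V} {x v : V}
    (h : Opt G m 𝒞) (hC : C ∈ 𝒞) (h4 : C.card ≤ 4) (hx : x ∈ rest 𝒞) (hv : v ∈ C)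
    (h2 : nb G x C = 2) (hxv : ¬ G.Adj x v) : Core G (insert x (C.erase v)) := by
  by_cases h3 : C.card ≤ 3
  · obtain ⟨b, c, t⟩ := h.tri_of_mem hC h3 hv
    rw [t.nb] at h2
    simp only [hxv, decide_false, Bool.toNat_false, zero_add] at h2
    obtain ⟨h5, h6⟩ := and_of_toNat_add h2
    exact core_insert_erase t h5 h6
  · obtain ⟨a, b, c, d, hab, hbc, hcd, hda, hac, hbd, e, hxa, hxc, hxb, hxd⟩ :=
      h.quad_pair hC (by omega) hx h2.ge
    have nx := fun v hv => (h.ne_rest hC (c := v) hv hx).symm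
    have mb : b ∈ C := by simp [e]
    have md : d ∈ C := by simp [e]
    have hv' := hv
    rw [e] at hv'
    simp only [mem_insert, mem_singleton] at hv'
    have := hab.ne
    have := hbc.ne
    have := hcd.ne
    have := hda.ne
    rcases hv' with rfl | rfl | rfl | rfl
    · exact absurd hxa hxv
    · rw [show C.erase v = {c, d, a} by
        rw [e]; ext w; simp only [mem_erase, mem_insert, mem_singleton]; grind]
      exact core_quad hxc hcd hda hxa.symm (nx d md) hac.symm
    · exact absurd hxc hxv
    · rw [show C.erase v = {a, b, c} by
        rw [e]; ext w; simp only [mem_erase, mem_insert, mem_singleton]; grind]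
      exact core_quad hxa hab hbc hxc.symm (nx b mb) hac

namespace Max

variable {m L : ℕ} {𝒞 𝒟 : Finset (Finset V)} {p q : ℕ → V} {C D : Finset V} {a b c v z : V}

theorem star (h : Max G m 3 𝒞 p) (hyp : Hyp G m) (hv : v ∈ rest 𝒞) (hvb : v ≠ p 1) :
    G.Adj v (p 1) ∧ nb G v (rest 𝒞) ≤ 1 := by
  by_cases hp : ∃ i < 3, p i = v
  · obtain ⟨i, hi, rfl⟩ := hp
    have : i ≠ 1 := fun e => hvb (by rw [e])
    obtain rfl | rfl : i = 0 ∨ i = 2 := by omega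
    · exact ⟨h.isP.adj 0 (by omega), h.nb_first⟩
    · exact ⟨(h.isP.adj 1 (by omega)).symm, h.nb_last⟩
  · push Not at hp
    have h1 : nb G v (rest 𝒞) ≤ 1 := by
      by_contra hcon
      obtain ⟨u, hu, w, hw, huw, h1, h2⟩ := two_le_nb.1 (not_le.1 hcon)
      have hnot : ¬ G.Adj (p 0) v := fun hadj => by
        obtain ⟨j, hj, e⟩ := h.exists_of_adj hv hadj
        exact hp j hj e
      have hP := ((IsP.single hw).cons hv (fun _ _ => h2.ne') fun _ => h2).cons hu
        (fun i hi => by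
          split_ifs
          · exact h1.ne
          · exact huw.symm) fun _ => by simpa using h1.symm
      have := (h.of_isP h.opt hP).leaf_adj hyp (by omega) (h.isP.mem 0 (by omega)) (fun i hi => by
        split_ifs
        · exact fun e => hnot (e ▸ h1.symm)
        · exact hp 0 (by omega) ∘ Eq.symm
        · exact fun e => hnot (e ▸ h2.symm)) h.nb_first
      exact hnot (by simpa using this.2)
    exact ⟨(h.leaf_adj hyp (by omega) hv hp h1).2, h1⟩

theorem adj_of_high (h : Max G m 3 𝒞 p) (hyp : Hyp G m)
    (hz : z ∈ rest 𝒞) (hzp : ∀ i < 3, p i ≠ z) (hC : C ∈ 𝒞) (hv : v ∈ C)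
    (hhigh : 2 * m + 2 ≤ nb G v univ) : G.Adj (p 0) v := by
  by_contra hxv
  have hx := h.isP.mem 0 (by omega)
  have hb := h.isP.mem 1 (by omega)
  have hy := h.isP.mem 2 (by omega)
  have hyx : p 2 ≠ p 0 := h.isP.ne (by omega) (by omega) (by omega)
  have hbx : p 1 ≠ p 0 := h.isP.ne (by omega) (by omega) (by omega)
  have hyb : p 2 ≠ p 1 := h.isP.ne (by omega) (by omega) (by omega)
  have hby : G.Adj (p 1) (p 2) := h.isP.adj 1 (by omega)
  have hzx := hzp 0 (by omega)
  have hzb := hzp 1 (by omega)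
  have hzy := hzp 2 (by omega)
  obtain ⟨hzadj, hz1⟩ := h.star hyp hz hzb.symm
  have t := h.twin hyp (by omega) hz hzp hz1
  have ty := h.rev.twin hyp (by omega) hz (fun i hi => hzp _ (by omega)) hz1
  obtain ⟨ho, hr⟩ := h.opt.swap_one hC hv hx
    (h.opt.core_erase hC (t.card C hC) hx hv (t.two C hC) hxv)
  set 𝒞' := swap 𝒞 C (insert (p 0) (C.erase v)) with h𝒞'
  have hv' : v ∈ rest 𝒞' := by rw [hr]; simp
  have hin : ∀ w ∈ rest 𝒞, w ≠ p 0 → w ∈ rest 𝒞' := fun w hw hwx => by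
    rw [hr]; simp [hw, hwx]
  have nv := fun w hw => h.opt.ne_rest hC (p := w) hv hw
  by_cases hvb : G.Adj v (p 1)
  · have hP := ((IsP.single (hin _ hy hyx)).cons (hin _ hb hbx) (fun _ _ => hyb) fun _ => hby).cons
      hv' (fun i hi => by
        split_ifs
        · exact (nv _ hb).symm
        · exact (nv _ hy).symm) fun _ => by simpa using hvb
    have hM := h.of_isP ho hP
    obtain ⟨u, hu, hup, hu1⟩ := hM.exists_leaf (by omega) ⟨z, hin z hz hzx.symm, fun i hi => by
      split_ifs
      · exact nv z hz
      · exact hzb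
      · exact hzy⟩
    have := (hM.twin hyp (by omega) hu hup hu1).deg
    simp only [if_true] at this
    omega
  · have hv0 : nb G v (rest 𝒞) = 0 := by
      by_contra hne
      obtain ⟨w, hw, hvw⟩ := one_le_nb.1 (Nat.one_le_iff_ne_zero.2 hne)
      have hwx : w ≠ p 0 := fun e => hxv (e ▸ hvw.symm)
      have hwb : w ≠ p 1 := fun e => hvb (e ▸ hvw)
      obtain ⟨u, hu, hub, huw, hux⟩ : ∃ u ∈ rest 𝒞, u ≠ p 1 ∧ u ≠ w ∧ u ≠ p 0 := by
        by_cases e : w = z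
        · exact ⟨_, hy, hyb, fun e' => hzy (e'.trans e), hyx⟩
        · exact ⟨z, hz, hzb.symm, fun e' => e e'.symm, hzx.symm⟩
      have hwadj := (h.star hyp hw hwb).1
      have huadj := (h.star hyp hu hub).1
      have hP := (((IsP.single (hin _ hu hux)).cons (hin _ hb hbx) (fun _ _ => hub)
        fun _ => huadj.symm).cons (hin _ hw hwx) (fun i hi => by
          split_ifs
          · exact hwb.symm
          · exact huw) fun _ => by simpa using hwadj).cons hv' (fun i hi => by
          split_ifs
          · exact hvw.ne'
          · exact (nv _ hb).symm
          · exact (nv _ hu).symm) fun _ => by simpa using hvw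
      have := h.max _ _ _ ho hP
      omega
    rw [h.opt.fam.nb_univ, hv0, ← add_sum_erase _ _ hC] at hhigh
    have hvC : nb G v C ≤ 3 := by
      have h1 : nb G v C ≤ (C.erase v).card := card_le_card fun w hw => by
        rw [mem_filter] at hw
        exact mem_erase.2 ⟨hw.2.ne', hw.1⟩
      have := card_erase_add_one hv
      have := t.card C hC
      omega
    obtain ⟨D, hD, hD3⟩ : ∃ D ∈ 𝒞.erase C, 2 < nb G v D := by
      by_contra! hcon
      have h1 := sum_le_card_nsmul _ (fun D => nb G v D) _ hcon
      have := card_erase_add_one hC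
      rw [smul_eq_mul] at h1
      rw [h.opt.card] at this
      omega
    rw [mem_erase] at hD
    have hD' : D ∈ 𝒞' := mem_swap_of_ne hD.2 hD.1
    have hcard : D.card ≤ 3 := by
      by_contra hcon
      have := ho.nb_le_two hD' (by omega) hv'
      omega
    obtain ⟨d, hd, hxd⟩ := one_le_nb.1 (show 1 ≤ nb G (p 0) D by rw [t.two D hD.2]; omega)
    obtain ⟨e, f, tD⟩ := h.opt.tri_of_mem hD.2 hcard hd
    have hzd := (t.same D hD.2 d hd).2 hxd
    have hyd := (ty.same D hD.2 d hd).1 hzd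
    have hall := (filter_eq_self (s := D) (p := G.Adj v)).1
      (eq_of_subset_of_card_le (filter_subset _ _) (by unfold nb at hD3; omega))
    have nd : ∀ c ∈ D, ∀ w ∈ rest 𝒞', c ≠ w := fun c hc w hw => ho.ne_rest hD' hc hw
    refine ho.no_two hD' (core_insert_erase tD (hall e tD.mb) (hall f tD.mc))
      (core_quad hby.symm hzadj.symm hzd hyd.symm hzy (nd d hd _ (hin _ hb hbx)).symm) ?_ ?_ ?_
    · rw [disjoint_left]
      intro w hw hw'
      simp only [mem_insert, mem_singleton, mem_erase] at hw hw'
      rcases hw with rfl | hw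
      · rcases hw' with e' | e' | e' | e'
        · exact nv _ hy e'
        · exact nv _ hb e'
        · exact nv _ hz e'
        · exact nd d hd _ hv' e'.symm
      · rcases hw' with e' | e' | e' | e'
        · exact nd w hw.2 _ (hin _ hy hyx) e'
        · exact nd w hw.2 _ (hin _ hb hbx) e'
        · exact nd w hw.2 _ (hin _ hz hzx.symm) e'
        · exact hw.1 e'
    · intro w hw
      rw [mem_insert, mem_erase] at hw
      rw [mem_union]
      rcases hw with rfl | hw
      · exact Or.inr hv'
      · exact Or.inl hw.2
    · simp only [insert_subset_iff, singleton_subset_iff, mem_union]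
      exact ⟨Or.inr (hin _ hy hyx), Or.inr (hin _ hb hbx), Or.inr (hin _ hz hzx.symm), Or.inl hd⟩

theorem false_of_leaf (h : Max G m L 𝒞 p) (hyp : Hyp G m) (hL : 2 ≤ L)
    (hz : z ∈ rest 𝒞) (hzp : ∀ i < L, p i ≠ z)
    (hleaf : nb G z (rest 𝒞) ≤ 1) : False := by
  have t := h.twin hyp hL hz hzp hleaf
  obtain rfl := (h.leaf_adj hyp hL hz hzp hleaf).1
  have hhigh := hyp.high
  change 2 * m + 2 ≤ hi G m univ at hhigh
  rw [h.opt.fam.hi_univ] at hhigh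
  have hC : ∀ C ∈ 𝒞, hi G m C ≤ 2 := fun C hC => by
    rw [← t.two C hC]
    refine card_le_card fun v hv => ?_
    rw [mem_filter] at hv
    exact mem_filter.2 ⟨hv.1, h.adj_of_high hyp hz hzp hC hv.1 hv.2⟩
  have hs := sum_le_card_nsmul _ (fun C => hi G m C) _ hC
  rw [h.opt.card, smul_eq_mul] at hs
  have hrest : hi G m (rest 𝒞) ≤ 1 := by
    rw [← card_singleton (p 1)]
    refine card_le_card fun v hv => ?_
    rw [mem_filter] at hv
    rw [mem_singleton]
    by_contra hvb
    have h1 := (h.star hyp hv.1 hvb).2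
    by_cases hp : ∃ i < 3, p i = v
    · obtain ⟨i, hi, rfl⟩ := hp
      have : i ≠ 1 := fun e => hvb (by rw [e])
      have hv2 := hv.2
      obtain rfl | rfl : i = 0 ∨ i = 2 := by omega
      · have := t.deg
        omega
      · have := (h.rev.twin hyp (by omega) hz (fun i hi => hzp _ (by omega)) hleaf).deg
        simp only [show 3 - 1 - 0 = 2 by omega] at this
        omega
    · push Not at hp
      have := (h.twin hyp hL hv.1 hp h1).deg'
      have := hv.2
      omega
  omega

end Max

end

section

variable {V : Type*} {G : SimpleGraph V}

theorem core_of_twoOfFour {u v s t : V} (huv : G.Adj u v) (hst : G.Adj s t) (hus : u ≠ s)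
    (hut : u ≠ t) (hvs : v ≠ s) (hvt : v ≠ t)
    (h : twoOfFour (decide (G.Adj s u)) (decide (G.Adj s v)) (decide (G.Adj t u))
      (decide (G.Adj t v))) : ∃ B, Core G B ∧ B ⊆ {u, v} ∪ {s, t} := by
  simp only [twoOfFour, Bool.or_eq_true, Bool.and_eq_true, decide_eq_true_eq] at h
  rcases h with ((((h | h) | h) | h) | h) | h
  · exact ⟨_, core_triple h.1 h.2 huv, by simp [insert_subset_iff]⟩
  · exact ⟨_, core_triple h.1 h.2 huv, by simp [insert_subset_iff]⟩
  · exact ⟨_, core_triple hst h.1 h.2, by simp [insert_subset_iff]⟩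
  · exact ⟨_, core_triple hst h.1 h.2, by simp [insert_subset_iff]⟩
  · exact ⟨_, core_quad h.1.symm hst h.2 huv.symm hut hvs.symm, by simp [insert_subset_iff]⟩
  · exact ⟨_, core_quad h.1.symm hst h.2 huv hvt hus.symm, by simp [insert_subset_iff]⟩

/-- The adjacencies between a triangle and a long path when there are seven of them. -/
structure Tight (G : SimpleGraph V) (C : Finset V) (a b c d : V) : Prop where
  mid : nb G b C = 3
  first : nb G a C = 2
  xor : ∀ v ∈ C, (G.Adj a v ↔ Xor (G.Adj c v) (G.Adj d v))

theorem tight_of_rule {C : Finset V} {a b c : V} (t : Tri G C a b c) {x y z w : V}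
    (h : tightRule (decide (G.Adj x a)) (decide (G.Adj x b)) (decide (G.Adj x c))
      (decide (G.Adj y a)) (decide (G.Adj y b)) (decide (G.Adj y c))
      (decide (G.Adj z a)) (decide (G.Adj z b)) (decide (G.Adj z c))
      (decide (G.Adj w a)) (decide (G.Adj w b)) (decide (G.Adj w c))) : Tight G C x y z w := by
  simp only [tightRule, Bool.and_eq_true, decide_eq_true_eq, beq_iff_eq] at h
  obtain ⟨⟨⟨⟨⟨⟨h1, h2⟩, h3⟩, h4⟩, h5⟩, h6⟩, h7⟩ := h
  refine ⟨by simp [t.nb, h1, h2, h3], by rw [t.nb, h4], fun v hv => ?_⟩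
  have key : ∀ {p q r : Prop}, decide p = (decide q ^^ decide r) → (p ↔ Xor q r) := by
    intro p q r
    by_cases p <;> by_cases q <;> by_cases r <;> simp_all [Xor]
  rw [t.eq] at hv
  simp only [mem_insert, mem_singleton] at hv
  rcases hv with rfl | rfl | rfl
  exacts [key h5, key h6, key h7]

variable [Fintype V] {m L : ℕ} {𝒞 : Finset (Finset V)} {p : ℕ → V} {C D : Finset V} {a b c d : V}

namespace Opt

/-- Two cores cannot be split off along a path outside `𝒞` with the help of one member of `𝒞`. -/
theorem no_split (h : Opt G m 𝒞) (hp : IsP G p L (rest 𝒞)) (hC : C ∈ 𝒞) {i j i' j' : ℕ}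
    (hj : j < i') (hi' : i' ≤ j') (hj' : j' < L) {S T A B : Finset V} (hS : S ⊆ C) (hT : T ⊆ C)
    (hST : Disjoint S T) (hA : Core G A) (hB : Core G B) (hAs : A ⊆ S ∪ (Icc i j).image p)
    (hBs : B ⊆ T ∪ (Icc i' j').image p) : False := by
  have hd := disjoint_rest hC
  have a1 := hp.arc_subset (i := i) (j := j) (by omega)
  have a2 := hp.arc_subset (i := i') (j := j') (by omega)
  refine h.no_two hC hA hB (disjoint_of_subset_left hAs (disjoint_of_subset_right hBs ?_))
    (hAs.trans (union_subset_union hS a1)) (hBs.trans (union_subset_union hT a2))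
  rw [disjoint_union_left, disjoint_union_right, disjoint_union_right]
  exact ⟨⟨hST, hd.mono hS a2⟩, (hd.mono hT a1).symm, hp.disjoint_arc (by omega) hj' (Or.inl hj)⟩

theorem edge_rule (h : Opt G m 𝒞) (hp : IsP G p L (rest 𝒞)) (hL : 4 ≤ L) (hC : C ∈ 𝒞)
    (t : Tri G C a b c) (h0 : G.Adj (p 0) a) (h1 : G.Adj (p 1) a)
    (h2 : twoOfFour (decide (G.Adj (p (L - 2)) b)) (decide (G.Adj (p (L - 2)) c))
      (decide (G.Adj (p (L - 1)) b)) (decide (G.Adj (p (L - 1)) c))) : False := by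
  have hadj := hp.adj (L - 2) (by omega)
  rw [show L - 2 + 1 = L - 1 by omega] at hadj
  have hne := fun v hv i hi => h.ne_rest hC (c := v) hv (hp.mem i hi)
  obtain ⟨B, hB, hBs⟩ := core_of_twoOfFour t.bc hadj (hne _ t.mb _ (by omega))
    (hne _ t.mb _ (by omega)) (hne _ t.mc _ (by omega)) (hne _ t.mc _ (by omega)) h2
  refine h.no_split hp hC (i := 0) (j := 1) (i' := L - 2) (j' := L - 1) (S := {a}) (T := {b, c})
    (by omega) (by omega) (by omega) (by simp [t.ma]) (by simp [insert_subset_iff, t.mb, t.mc])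
    (by simp [t.ab.ne, t.ac.ne]) (core_triple (hp.adj 0 (by omega)) h0 h1) hB ?_
    (hBs.trans (union_subset_union subset_rfl ?_))
  · simp only [insert_subset_iff, singleton_subset_iff, mem_union, mem_singleton]
    exact ⟨Or.inr (IsP.mem_arc (by omega) (by omega)), Or.inr (IsP.mem_arc (by omega) (by omega)),
      Or.inl trivial⟩
  · simp only [insert_subset_iff, singleton_subset_iff]
    exact ⟨IsP.mem_arc (by omega) (by omega), IsP.mem_arc (by omega) (by omega)⟩

theorem vert_rule (h : Opt G m 𝒞) (hp : IsP G p L (rest 𝒞)) (hC : C ∈ 𝒞)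
    (t : Tri G C a b c) (h0 : G.Adj (p 0) b) (h1 : G.Adj (p 0) c) {i j : ℕ} (hi : 1 ≤ i)
    (hij : i < j) (hj : j < L) (h2 : G.Adj (p i) a) (h3 : G.Adj (p j) a) : False := by
  have ha : a ∉ rest 𝒞 := fun har => h.ne_rest hC t.ma har rfl
  refine h.no_split hp hC (i := 0) (j := 0) (i' := i) (j' := j) (S := {b, c}) (T := {a})
    (by omega) (by omega) (by omega) (by simp [insert_subset_iff, t.mb, t.mc]) (by simp [t.ma])
    (by simp [t.ab.ne, t.ac.ne]) (core_triple h0 h1 t.bc)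
    (hp.core_vertex hij hj ha h2.symm h3.symm) ?_ ?_
  · simp [insert_subset_iff]
  · rw [insert_eq]

theorem half_rule (h : Opt G m 𝒞) (hp : IsP G p L (rest 𝒞)) (hL : 4 ≤ L) (hC : C ∈ 𝒞)
    (t : Tri G C a b c) :
    halfRule (decide (G.Adj (p 0) a)) (decide (G.Adj (p 0) b)) (decide (G.Adj (p 0) c))
      (decide (G.Adj (p 1) a)) (decide (G.Adj (p 1) b)) (decide (G.Adj (p 1) c))
      (decide (G.Adj (p (L - 2)) a)) (decide (G.Adj (p (L - 2)) b)) (decide (G.Adj (p (L - 2)) c))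
      (decide (G.Adj (p (L - 1)) a)) (decide (G.Adj (p (L - 1)) b))
      (decide (G.Adj (p (L - 1)) c)) := by
  have r1 : ∀ {a b c}, Tri G C a b c → (!(decide (G.Adj (p 0) a) && decide (G.Adj (p 1) a) &&
      twoOfFour (decide (G.Adj (p (L - 2)) b)) (decide (G.Adj (p (L - 2)) c))
        (decide (G.Adj (p (L - 1)) b)) (decide (G.Adj (p (L - 1)) c)))) = true := by
    intro a b c t
    rw [Bool.not_eq_true', ← Bool.not_eq_true]
    intro h1
    simp only [Bool.and_eq_true, decide_eq_true_eq] at h1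
    exact h.edge_rule hp hL hC t h1.1.1 h1.1.2 h1.2
  have r2 : ∀ {a b c}, Tri G C a b c → (!(decide (G.Adj (p 0) b) && decide (G.Adj (p 0) c) &&
      ((decide (G.Adj (p 1) a) && decide (G.Adj (p (L - 2)) a)) ||
        (decide (G.Adj (p 1) a) && decide (G.Adj (p (L - 1)) a)) ||
        (decide (G.Adj (p (L - 2)) a) && decide (G.Adj (p (L - 1)) a))))) = true := by
    intro a b c t
    rw [Bool.not_eq_true', ← Bool.not_eq_true]
    intro h1
    simp only [Bool.and_eq_true, Bool.or_eq_true, decide_eq_true_eq] at h1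
    obtain ⟨⟨h1, h2⟩, (h3 | h3) | h3⟩ := h1
    · exact h.vert_rule hp hC t h1 h2 le_rfl (by omega) (by omega) h3.1 h3.2
    · exact h.vert_rule hp hC t h1 h2 le_rfl (by omega) (by omega) h3.1 h3.2
    · exact h.vert_rule hp hC t h1 h2 (by omega) (by omega) (by omega) h3.1 h3.2
  simp only [halfRule, Bool.and_eq_true]
  exact ⟨⟨⟨⟨⟨by simpa using r1 t, by simpa using r1 t.swp⟩, by simpa using r1 t.rot⟩,
    by simpa using r2 t⟩, by simpa using r2 t.swp⟩, by simpa using r2 t.rot⟩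

theorem tri_sum (h : Opt G m 𝒞) (hp : IsP G p L (rest 𝒞)) (hL : 4 ≤ L) (hC : C ∈ 𝒞)
    (h3 : C.card ≤ 3) :
    nb G (p 0) C + nb G (p 1) C + nb G (p (L - 2)) C + nb G (p (L - 1)) C ≤ 7 ∧
    (nb G (p 0) C + nb G (p 1) C + nb G (p (L - 2)) C + nb G (p (L - 1)) C = 7 →
      Tight G C (p 0) (p 1) (p (L - 2)) (p (L - 1)) ∨
      Tight G C (p (L - 1)) (p (L - 2)) (p 1) (p 0)) := by
  obtain ⟨a, b, c, t⟩ := h.tri hC h3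
  have h2 := h.half_rule hp.rev hL hC t
  simp only [show L - 1 - 1 = L - 2 by omega, show L - 1 - (L - 2) = 1 by omega,
    show L - 1 - (L - 1) = 0 by omega, Nat.sub_zero] at h2
  have key := halfRule_sum _ _ _ _ _ _ _ _ _ _ _ _ (h.half_rule hp hL hC t) h2
  simp only [← t.nb] at key
  exact ⟨key.1, fun h7 => (key.2 h7).imp (tight_of_rule t) (tight_of_rule t)⟩

end Opt

end

section

variable {V : Type*} {G : SimpleGraph V}

/-- `C` is the vertex set of the 4-cycle `a b c d`. -/
structure Sq (G : SimpleGraph V) (C : Finset V) (a b c d : V) : Prop where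
  ab : G.Adj a b
  bc : G.Adj b c
  cd : G.Adj c d
  da : G.Adj d a
  ac : a ≠ c
  bd : b ≠ d
  eq : C = {a, b, c, d}

namespace Sq

variable {C : Finset V} {a b c d : V}

theorem rot (s : Sq G C a b c d) : Sq G C b c d a :=
  ⟨s.bc, s.cd, s.da, s.ab, s.bd, s.ac.symm, by rw [s.eq]; ext v; simp; tauto⟩

theorem flip (s : Sq G C a b c d) : Sq G C a d c b :=
  ⟨s.da.symm, s.cd.symm, s.bc.symm, s.ab.symm, s.ac, s.bd.symm, by rw [s.eq]; ext v; simp; tauto⟩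

theorem ma (s : Sq G C a b c d) : a ∈ C := by simp [s.eq]
theorem mb (s : Sq G C a b c d) : b ∈ C := by simp [s.eq]
theorem mc (s : Sq G C a b c d) : c ∈ C := by simp [s.eq]
theorem md (s : Sq G C a b c d) : d ∈ C := by simp [s.eq]

theorem exists_adj_of_not (s : Sq G C a b c d) {v : V} (h : 1 ≤ nb G v C) (ha : ¬ G.Adj v a)
    (hc : ¬ G.Adj v c) : G.Adj v b ∨ G.Adj v d := by
  obtain ⟨u, hu, hvu⟩ := one_le_nb.1 h
  rw [s.eq] at hu
  simp only [mem_insert, mem_singleton] at hu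
  rcases hu with rfl | rfl | rfl | rfl
  exacts [(ha hvu).elim, Or.inl hvu, (hc hvu).elim, Or.inr hvu]

theorem adj_of_not (s : Sq G C a b c d) {v : V} (h : 2 ≤ nb G v C) (ha : ¬ G.Adj v a)
    (hc : ¬ G.Adj v c) : G.Adj v b ∧ G.Adj v d := by
  rw [s.eq, nb_quad v s.ab s.bc s.cd s.da s.ac s.bd] at h
  simp only [ha, hc, decide_false, Bool.toNat_false, zero_add, add_zero] at h
  have := (decide (G.Adj v b)).toNat_le
  have := (decide (G.Adj v d)).toNat_le
  exact and_of_toNat_add (by omega)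

end Sq

variable [Fintype V] {m L : ℕ} {𝒞 : Finset (Finset V)} {p : ℕ → V} {C D : Finset V}
  {a b c d u v s t : V}

namespace Opt

theorem sq_pair (h : Opt G m 𝒞) (hC : C ∈ 𝒞) (h4 : C.card = 4) (hv : v ∈ rest 𝒞)
    (h2 : 2 ≤ nb G v C) : ∃ a b c d, Sq G C a b c d ∧ G.Adj v a ∧ G.Adj v c ∧
      ¬ G.Adj v b ∧ ¬ G.Adj v d := by
  obtain ⟨a, b, c, d, ab, bc, cd, da, ac, bd, e, h⟩ := h.quad_pair hC h4 hv h2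
  exact ⟨a, b, c, d, ⟨ab, bc, cd, da, ac, bd, e⟩, h⟩

theorem not_common (h : Opt G m 𝒞) (hC : C ∈ 𝒞) (h4 : 4 ≤ C.card) (hu : u ∈ rest 𝒞)
    (hv : v ∈ rest 𝒞) (huv : G.Adj u v) (hc : c ∈ C) (h1 : G.Adj u c) (h2 : G.Adj v c) :
    False := by
  have h3 := h.le_card hC (core_triple huv h1 h2) (by
    simp only [insert_subset_iff, singleton_subset_iff, mem_union]
    exact ⟨Or.inr hu, Or.inr hv, Or.inl hc⟩)
  have := card_le_three (a := u) (b := v) (c := c)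
  omega

theorem sq_split (h : Opt G m 𝒞) (hC : C ∈ 𝒞) (q : Sq G C a b c d) (hu : u ∈ rest 𝒞)
    (hv : v ∈ rest 𝒞) (hs : s ∈ rest 𝒞) (ht : t ∈ rest 𝒞) (hd : Disjoint ({u, v} : Finset V) {s, t})
    (huv : G.Adj u v) (hst : G.Adj s t) (hua : G.Adj u a) (hvb : G.Adj v b) (hsc : G.Adj s c)
    (htd : G.Adj t d) : False := by
  have n := fun x hx y hy => h.ne_rest hC (c := x) (p := y) hx hy
  have n' := fun x hx y hy => (h.ne_rest hC (c := x) (p := y) hx hy).symm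
  refine h.no_two hC (core_quad hua q.ab hvb.symm huv.symm (n' _ q.mb _ hu) (n _ q.ma _ hv))
    (core_quad hsc q.cd htd.symm hst.symm (n' _ q.md _ hs) (n _ q.mc _ ht)) ?_ ?_ ?_
  · simp only [disjoint_insert_left, disjoint_singleton_left, mem_insert, mem_singleton,
      not_or] at hd ⊢
    exact ⟨⟨hd.1.1, n' _ q.mc _ hu, n' _ q.md _ hu, hd.1.2⟩,
      ⟨n _ q.ma _ hs, q.ac, q.da.ne', n _ q.ma _ ht⟩,
      ⟨n _ q.mb _ hs, q.bc.ne, q.bd, n _ q.mb _ ht⟩, ⟨hd.2.1, n' _ q.mc _ hv, n' _ q.md _ hv, hd.2.2⟩⟩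
  · simp [insert_subset_iff, q.ma, q.mb, hu, hv]
  · simp [insert_subset_iff, q.mc, q.md, hs, ht]

theorem sq_side (h : Opt G m 𝒞) (hC : C ∈ 𝒞) (h4 : C.card = 4) (hu : u ∈ rest 𝒞)
    (hv : v ∈ rest 𝒞) (hs : s ∈ rest 𝒞) (ht : t ∈ rest 𝒞) (hd : Disjoint ({u, v} : Finset V) {s, t})
    (huv : G.Adj u v) (hst : G.Adj s t) (h1 : 2 ≤ nb G u C) (h2 : 2 ≤ nb G v C)
    (h3 : 2 ≤ nb G s C) (h5 : 1 ≤ nb G t C) : False := by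
  obtain ⟨a, b, c, d, q, hua, huc, hub, hud⟩ := h.sq_pair hC h4 hu h1
  have hv' := q.adj_of_not h2
    (fun hva => h.not_common hC h4.ge hu hv huv q.ma hua hva)
    (fun hvc => h.not_common hC h4.ge hu hv huv q.mc huc hvc)
  have nst := fun x (hx : x ∈ C) (hsx : G.Adj s x) (htx : G.Adj t x) =>
    h.not_common hC h4.ge hs ht hst hx hsx htx
  by_cases hsa : G.Adj s a
  · have hsb := fun hb => h.not_two_adj hC h4.ge hs q.ma q.mb q.ab hsa hb
    have hsd := fun hd => h.not_two_adj hC h4.ge hs q.md q.ma q.da hd hsa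
    have hsc := (q.rot.adj_of_not h3 hsb hsd).1
    rcases q.exists_adj_of_not h5 (nst _ q.ma hsa) (nst _ q.mc hsc) with htb | htd
    · exact h.sq_split hC q.flip hu hv hs ht hd huv hst hua hv'.2 hsc htb
    · exact h.sq_split hC q hu hv hs ht hd huv hst hua hv'.1 hsc htd
  · have hsc : ¬ G.Adj s c := fun hsc => by
      have hsb := fun hb => h.not_two_adj hC h4.ge hs q.mb q.mc q.bc hb hsc
      have hsd := fun hd => h.not_two_adj hC h4.ge hs q.mc q.md q.cd hsc hd
      exact hsa (q.rot.adj_of_not h3 hsb hsd).2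
    obtain ⟨hsb, hsd⟩ := q.adj_of_not h3 hsa hsc
    have hd' : Disjoint ({u, v} : Finset V) {t, s} := by rwa [pair_comm t s]
    rcases q.rot.exists_adj_of_not h5 (nst _ q.mb hsb) (nst _ q.md hsd) with htc | hta
    · exact h.sq_split hC q hu hv ht hs hd' huv hst.symm hua hv'.1 htc hsd
    · exact h.sq_split hC q.rot.rot hu hv ht hs hd' huv hst.symm huc hv'.2 hta hsb

theorem sq_sum (h : Opt G m 𝒞) (hC : C ∈ 𝒞) (h4 : C.card = 4) (hu : u ∈ rest 𝒞)
    (hv : v ∈ rest 𝒞) (hs : s ∈ rest 𝒞) (ht : t ∈ rest 𝒞) (hd : Disjoint ({u, v} : Finset V) {s, t})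
    (huv : G.Adj u v) (hst : G.Adj s t) :
    nb G u C + nb G v C + nb G s C + nb G t C ≤ 6 := by
  by_contra hcon
  have k : ∀ {v}, v ∈ rest 𝒞 → nb G v C ≤ 2 := fun hv => h.nb_le_two hC h4.ge hv
  have := k hu
  have := k hv
  have := k hs
  have := k ht
  have e1 := pair_comm u v
  have e2 := pair_comm s t
  by_cases h1 : nb G u C = 2 ∧ nb G v C = 2
  · by_cases h3 : nb G s C = 2
    · exact h.sq_side hC h4 hu hv hs ht hd huv hst (by omega) (by omega) (by omega) (by omega)
    · exact h.sq_side hC h4 hu hv ht hs (e2 ▸ hd) huv hst.symm (by omega) (by omega) (by omega)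
        (by omega)
  · by_cases h3 : nb G u C = 2
    · exact h.sq_side hC h4 hs ht hu hv hd.symm hst huv (by omega) (by omega) (by omega) (by omega)
    · exact h.sq_side hC h4 hs ht hv hu (e1 ▸ hd.symm) hst huv.symm (by omega) (by omega) (by omega)
        (by omega)

/-- The four vertices at the ends of a path outside `𝒞`, against one member of `𝒞`. -/
theorem path_sum (h : Opt G m 𝒞) (hp : IsP G p L (rest 𝒞)) (hL : 4 ≤ L) (hC : C ∈ 𝒞) :
    nb G (p 0) C + nb G (p 1) C + nb G (p (L - 2)) C + nb G (p (L - 1)) C ≤ 7 ∧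
    (nb G (p 0) C + nb G (p 1) C + nb G (p (L - 2)) C + nb G (p (L - 1)) C = 7 →
      Tight G C (p 0) (p 1) (p (L - 2)) (p (L - 1)) ∨
      Tight G C (p (L - 1)) (p (L - 2)) (p 1) (p 0)) := by
  rcases lt_trichotomy C.card 4 with h4 | h4 | h4
  · exact h.tri_sum hp hL hC (by omega)
  · have hadj := hp.adj (L - 2) (by omega)
    rw [show L - 2 + 1 = L - 1 by omega] at hadj
    have := h.sq_sum hC h4 (hp.mem 0 (by omega)) (hp.mem 1 (by omega))
      (hp.mem (L - 2) (by omega)) (hp.mem (L - 1) (by omega)) (by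
        simp only [disjoint_insert_left, disjoint_singleton_left, mem_insert, mem_singleton, not_or]
        exact ⟨⟨hp.ne (by omega) (by omega) (by omega), hp.ne (by omega) (by omega) (by omega)⟩,
          hp.ne (by omega) (by omega) (by omega), hp.ne (by omega) (by omega) (by omega)⟩)
      (hp.adj 0 (by omega)) hadj
    exact ⟨by omega, fun h7 => by omega⟩
  · have k : ∀ i < L, nb G (p i) C ≤ 1 := fun i hi => h.nb_le_one hC h4 (hp.mem i hi)
    have := k 0 (by omega)
    have := k 1 (by omega)
    have := k (L - 2) (by omega)
    have := k (L - 1) (by omega)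
    exact ⟨by omega, fun h7 => by omega⟩

end Opt

end

section

variable {V : Type*} {G : SimpleGraph V}

theorem IsP.nb_le_two {p : ℕ → V} {n i : ℕ} {X : Finset V} (h : IsP G p n X)
    (hX : ∀ A ⊆ X, ¬ Core G A) (hspan : ∀ u ∈ X, ∃ j < n, p j = u) (hi : i < n) :
    nb G (p i) X ≤ 2 := by
  refine (card_le_card fun v hv => ?_).trans (card_le_two (a := p (i - 1)) (b := p (i + 1)))
  obtain ⟨hv, hadj⟩ := mem_filter.1 hv
  obtain ⟨j, hj, rfl⟩ := hspan v hv
  have hne : j ≠ i := fun e => hadj.ne (e ▸ rfl)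
  have h1 : ¬ i + 2 ≤ j := fun hij => hX _ (h.arc_subset hj) (h.core_chord hij hj hadj)
  have h2 : ¬ j + 2 ≤ i := fun hij => hX _ (h.arc_subset hi) (h.core_chord hij hi hadj.symm)
  rw [mem_insert, mem_singleton]
  rcases hne.lt_or_gt with h3 | h3
  · exact Or.inl (congrArg p (by omega))
  · exact Or.inr (congrArg p (by omega))

variable [Fintype V] {m L : ℕ} {𝒞 : Finset (Finset V)} {p : ℕ → V} {C D : Finset V}
  {a b c d u w : V}

theorem Opt.no_tight_pair (h : Opt G m 𝒞) (hC : C ∈ 𝒞) (hD : D ∈ 𝒞) (hCD : C ≠ D)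
    (hC3 : C.card ≤ 3) (hD3 : D.card ≤ 3) (ha : a ∈ rest 𝒞) (hb : b ∈ rest 𝒞) (hc : c ∈ rest 𝒞)
    (hd : d ∈ rest 𝒞) (hab : a ≠ b) (hac : a ≠ c) (had : a ≠ d) (hbc : b ≠ c) (hbd : b ≠ d)
    (hcd : c ≠ d) (hbC : ∀ v ∈ C, G.Adj b v) (hcD : ∀ v ∈ D, G.Adj c v) (hu : u ∈ C)
    (hw : w ∈ D) (hau : G.Adj a u) (hdu : G.Adj d u) (haw : G.Adj a w) (hdw : G.Adj d w) :
    False := by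
  obtain ⟨u', u'', t⟩ := h.tri_of_mem hC hC3 hu
  obtain ⟨w', w'', s⟩ := h.tri_of_mem hD hD3 hw
  have nC := fun v hv x hx => (h.ne_rest hC (c := v) (p := x) hv hx)
  have nD := fun v hv x hx => (h.ne_rest hD (c := v) (p := x) hv hx)
  have nCD := fun v hv x hx => (h.ne_of hC hD hCD (c := v) (d := x) hv hx)
  refine h.no_three hC hD hCD (core_insert_erase t (hbC _ t.mb) (hbC _ t.mc))
    (core_insert_erase s (hcD _ s.mb) (hcD _ s.mc))
    (core_quad hau hdu.symm hdw haw.symm had (nCD _ hu _ hw)) ?_ ?_ ?_ ?_ ?_ ?_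
  · rw [disjoint_left]
    intro v hv hv'
    simp only [mem_insert, mem_erase] at hv hv'
    rcases hv with rfl | ⟨-, hv⟩ <;> rcases hv' with rfl | ⟨-, hv'⟩
    exacts [hbc rfl, nD _ hv' _ hb rfl, nC _ hv _ hc rfl, nCD _ hv _ hv' rfl]
  · rw [disjoint_left]
    intro v hv hv'
    simp only [mem_insert, mem_erase, mem_singleton] at hv hv'
    rcases hv with rfl | ⟨hvu, hv⟩ <;> rcases hv' with rfl | rfl | rfl | rfl
    exacts [hab rfl, nC _ hu _ hb rfl, hbd rfl, nD _ hw _ hb rfl, nC _ hv _ ha rfl, hvu rfl,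
      nC _ hv _ hd rfl, nCD _ hv _ hw rfl]
  · rw [disjoint_left]
    intro v hv hv'
    simp only [mem_insert, mem_erase, mem_singleton] at hv hv'
    rcases hv with rfl | ⟨hvu, hv⟩ <;> rcases hv' with rfl | rfl | rfl | rfl
    exacts [hac rfl, nC _ hu _ hc rfl, hcd rfl, nD _ hw _ hc rfl, nD _ hv _ ha rfl,
      nCD _ hu _ hv rfl, nD _ hv _ hd rfl, hvu rfl]
  · rw [insert_subset_iff]
    exact ⟨by simp [hb], (erase_subset _ _).trans (subset_union_left.trans subset_union_left)⟩
  · rw [insert_subset_iff]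
    exact ⟨by simp [hc], (erase_subset _ _).trans (subset_union_right.trans subset_union_left)⟩
  · simp [insert_subset_iff, ha, hd, hu, hw]

/-- A path of at least four vertices, covering all vertices outside an optimal family. -/
structure Span (G : SimpleGraph V) (m L : ℕ) (𝒞 : Finset (Finset V)) (p : ℕ → V) : Prop where
  opt : Opt G m 𝒞
  isP : IsP G p L (rest 𝒞)
  four_le : 4 ≤ L
  span : ∀ u ∈ rest 𝒞, ∃ j < L, p j = u

namespace Span

theorem rev (h : Span G m L 𝒞 p) : Span G m L 𝒞 fun i => p (L - 1 - i) :=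
  ⟨h.opt, h.isP.rev, h.four_le, fun u hu => by
    obtain ⟨j, hj, rfl⟩ := h.span u hu
    exact ⟨L - 1 - j, by omega, congrArg p (by omega)⟩⟩

theorem mem (h : Span G m L 𝒞 p) {i : ℕ} (hi : i < L) : p i ∈ rest 𝒞 := h.isP.mem i hi

theorem first (h : Span G m L 𝒞 p) (hyp : Hyp G m) : 2 * m ≤ ∑ C ∈ 𝒞, nb G (p 0) C := by
  have h1 := h.isP.nb_first_le_one (fun _ => h.opt.not_core) fun u hu _ => h.span u hu
  have h2 := h.opt.fam.nb_univ (p 0)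
  have := hyp.deg (p 0)
  omega

theorem last (h : Span G m L 𝒞 p) (hyp : Hyp G m) : 2 * m ≤ ∑ C ∈ 𝒞, nb G (p (L - 1)) C :=
  h.rev.first hyp

theorem inner (h : Span G m L 𝒞 p) (hyp : Hyp G m) {i : ℕ} (hi : i < L) :
    nb G (p i) univ ≤ 2 + ∑ C ∈ 𝒞, nb G (p i) C ∧ 2 * m ≤ 1 + ∑ C ∈ 𝒞, nb G (p i) C := by
  have h1 := h.isP.nb_le_two (fun _ => h.opt.not_core) h.span hi
  have h2 := h.opt.fam.nb_univ (p i)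
  have := hyp.deg (p i)
  omega

theorem adj_of_three (h : Span G m L 𝒞 p) (hC : C ∈ 𝒞) {i : ℕ} (hi : i < L)
    (h3 : nb G (p i) C = 3) : C.card ≤ 3 ∧ ∀ v ∈ C, G.Adj (p i) v := by
  have hC3 : C.card ≤ 3 := by
    by_contra hcon
    have := h.opt.nb_le_two hC (by omega) (h.mem hi)
    omega
  exact ⟨hC3, (filter_eq_self (s := C) (p := G.Adj (p i))).1
      (eq_of_subset_of_card_le (filter_subset _ _) (by unfold nb at h3; omega))⟩

theorem false_of_tight (h : Span G m L 𝒞 p) (hC : C ∈ 𝒞) (hD : D ∈ 𝒞) (hCD : C ≠ D)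
    (hCt : Tight G C (p 0) (p 1) (p (L - 2)) (p (L - 1)))
    (hDt : Tight G D (p (L - 1)) (p (L - 2)) (p 1) (p 0))
    (h1 : nb G (p (L - 2)) C = 0) (h2 : nb G (p 1) D = 0) : False := by
  have hL := h.four_le
  have zero : ∀ {v S x}, nb G v S = 0 → x ∈ S → ¬ G.Adj v x := fun h0 hx hvx => by
    have := one_le_nb.2 ⟨_, hx, hvx⟩
    omega
  obtain ⟨hC3, hCa⟩ := h.adj_of_three hC (by omega) hCt.mid
  obtain ⟨hD3, hDa⟩ := h.adj_of_three hD (by omega) hDt.mid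
  obtain ⟨u, hu, hau⟩ := one_le_nb.1 (show 1 ≤ nb G (p 0) C by rw [hCt.first]; omega)
  obtain ⟨w, hw, hdw⟩ := one_le_nb.1 (show 1 ≤ nb G (p (L - 1)) D by rw [hDt.first]; omega)
  have hdu := ((hCt.xor u hu).1 hau).resolve_left fun e => zero h1 hu e.1
  have haw := ((hDt.xor w hw).1 hdw).resolve_left fun e => zero h2 hw e.1
  have ne := fun i j (hi : i < L) (hj : j < L) (hij : i ≠ j) => h.isP.ne hi hj hij
  exact h.opt.no_tight_pair hC hD hCD hC3 hD3 (h.mem (i := 0) (by omega))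
    (h.mem (i := 1) (by omega)) (h.mem (i := L - 2) (by omega)) (h.mem (i := L - 1) (by omega))
    (ne _ _ (by omega) (by omega) (by omega)) (ne _ _ (by omega) (by omega) (by omega))
    (ne _ _ (by omega) (by omega) (by omega)) (ne _ _ (by omega) (by omega) (by omega))
    (ne _ _ (by omega) (by omega) (by omega)) (ne _ _ (by omega) (by omega) (by omega))
    hCa hDa hu hw hau hdu.1 haw.1 hdw

theorem eq_one (h : Span G m L 𝒞 p) (hyp : Hyp G m) : m = 1 := by
  have hL := h.four_le
  have s0 := h.first hyp
  have s3 := h.last hyp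
  have s1 := (h.inner hyp (i := 1) (by omega)).2
  have s2 := (h.inner hyp (i := L - 2) (by omega)).2
  have hS := fun C hC => h.opt.path_sum h.isP hL (C := C) hC
  have hsum := sum_le_card_nsmul 𝒞 (fun C => nb G (p 0) C + nb G (p 1) C + nb G (p (L - 2)) C +
    nb G (p (L - 1)) C) 7 fun C hC => (hS C hC).1
  rw [h.opt.card, smul_eq_mul] at hsum
  simp only [sum_add_distrib] at hsum
  have := hyp.pos
  by_contra hne
  obtain rfl : m = 2 := by omega
  obtain ⟨C, D, hCD, rfl⟩ := card_eq_two.1 h.opt.card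
  simp only [sum_pair hCD] at s0 s1 s2 s3
  have hC : C ∈ ({C, D} : Finset (Finset V)) := by simp
  have hD : D ∈ ({C, D} : Finset (Finset V)) := by simp
  obtain ⟨c1, c2⟩ := hS C hC
  obtain ⟨d1, d2⟩ := hS D hD
  rcases c2 (by omega) with hCt | hCt <;> rcases d2 (by omega) with hDt | hDt
  · have := hCt.mid
    have := hCt.first
    have := hDt.mid
    have := hDt.first
    omega
  · have := hCt.mid
    have := hCt.first
    have := hDt.mid
    have := hDt.first
    exact h.false_of_tight hC hD hCD hCt hDt (by omega) (by omega)
  · have := hCt.mid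
    have := hCt.first
    have := hDt.mid
    have := hDt.first
    exact h.false_of_tight hD hC hCD.symm hDt hCt (by omega) (by omega)
  · have := hCt.mid
    have := hCt.first
    have := hDt.mid
    have := hDt.first
    omega

end Span

end

section

variable {V : Type*} {G : SimpleGraph V}

theorem IsP.core_pair {p : ℕ → V} {n i j : ℕ} {X : Finset V} {c d u v : V} (h : IsP G p n X)
    (hij : i < j) (hj : j < n) (hc : c ∉ X) (hd : d ∉ X) (hcd : G.Adj c d) (hu : u = c ∨ u = d)
    (hv : v = c ∨ v = d) (hiu : G.Adj (p i) u) (hjv : G.Adj (p j) v) :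
    ∃ B, Core G B ∧ B ⊆ {c, d} ∪ (Icc i j).image p := by
  have mem : ∀ v, v = c ∨ v = d → v ∈ ({c, d} : Finset V) ∪ (Icc i j).image p := by simp +contextual
  have hX : ∀ v, v = c ∨ v = d → v ∉ X := by rintro v (rfl | rfl) <;> assumption
  by_cases huv : u = v
  · subst huv
    exact ⟨_, h.core_vertex hij hj (hX _ hu) hiu.symm hjv.symm,
      insert_subset_iff.2 ⟨mem _ hu, subset_union_right⟩⟩
  · have huv' : G.Adj u v := by
      rcases hu with rfl | rfl <;> rcases hv with rfl | rfl
      exacts [(huv rfl).elim, hcd, hcd.symm, (huv rfl).elim]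
    exact ⟨_, h.core_edge hij.le hj (hX _ hu) (hX _ hv) huv' hiu.symm hjv.symm,
      insert_subset_iff.2 ⟨mem _ hu, insert_subset_iff.2 ⟨mem _ hv, subset_union_right⟩⟩⟩

theorem Tri.exists_third {C : Finset V} {a b c u v : V} (t : Tri G C a b c) (hu : u ∈ C) (hv : v ∈ C) (huv : u ≠ v) :
    ∃ w, Tri G C u v w := by
  rw [t.eq] at hu hv
  simp only [mem_insert, mem_singleton] at hu hv
  rcases hu with rfl | rfl | rfl <;> rcases hv with rfl | rfl | rfl
  exacts [(huv rfl).elim, ⟨_, t⟩, ⟨_, t.swp'⟩, ⟨_, t.swp⟩, (huv rfl).elim, ⟨_, t.rot.rot⟩,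
    ⟨_, t.rot⟩, ⟨_, t.rot.swp'⟩, (huv rfl).elim]

variable [Fintype V] {L i j : ℕ} {p : ℕ → V} {C : Finset V} {a b c d u v : V}

namespace Span

theorem two_le_first (h : Span G 1 L {C} p) (hyp : Hyp G 1) : 2 ≤ nb G (p 0) C := by
  simpa using h.first hyp

theorem two_le_last (h : Span G 1 L {C} p) (hyp : Hyp G 1) : 2 ≤ nb G (p (L - 1)) C :=
  h.rev.two_le_first hyp

theorem one_le (h : Span G 1 L {C} p) (hyp : Hyp G 1) (hi : i < L) : 1 ≤ nb G (p i) C := by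
  have := (h.inner hyp hi).2
  rw [sum_singleton] at this
  omega

theorem notMem_rest (hv : v ∈ C) : v ∉ rest {C} := fun h => mem_rest.1 h C (by simp) hv

theorem not_sq_split (h : Span G 1 L {C} p) (q : Sq G C a b c d) (h0 : G.Adj (p 0) a)
    (h1 : G.Adj (p 1) b) (hu : u = c ∨ u = d) (hv : v = c ∨ v = d) (h2 : G.Adj (p 2) u)
    (h3 : G.Adj (p (L - 1)) v) : False := by
  have hL := h.four_le
  obtain ⟨B, hB, hBs⟩ := h.isP.core_pair (by omega) (by omega) (notMem_rest q.mc)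
    (notMem_rest q.md) q.cd hu hv h2 h3
  have n := fun x (hx : x ∈ C) i (hi : i < L) => h.opt.ne_rest (mem_singleton_self C) hx (h.mem hi)
  refine h.opt.no_split h.isP (mem_singleton_self C) (i := 0) (j := 1) (S := {a, b}) (T := {c, d})
    (by omega) (by omega) (by omega) (by simp [insert_subset_iff, q.ma, q.mb])
    (by simp [insert_subset_iff, q.mc, q.md])
    (by simp [q.ac.symm, q.da.ne, q.bc.ne', q.bd.symm])
    (core_quad h0 q.ab h1.symm (h.isP.adj 0 (by omega)).symm
      (n _ q.mb 0 (by omega)).symm (n _ q.ma 1 (by omega))) hB ?_ hBs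
  simp only [insert_subset_iff, singleton_subset_iff, mem_union, mem_insert, mem_singleton]
  exact ⟨Or.inr (IsP.mem_arc (by omega) (by omega)), Or.inl (Or.inl trivial),
    Or.inl (Or.inr trivial), Or.inr (IsP.mem_arc (by omega) (by omega))⟩

theorem card_ne_four (h : Span G 1 L {C} p) (hyp : Hyp G 1) : C.card ≠ 4 := by
  intro h4
  have hL := h.four_le
  have hC := mem_singleton_self C
  obtain ⟨a, b, c, d, q, h0a, h0c, -, -⟩ :=
    h.opt.sq_pair hC h4 (h.mem (by omega)) (h.two_le_first hyp)
  have nc := fun i (hi : i + 1 < L) x (hx : x ∈ C) =>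
    h.opt.not_common hC h4.ge (h.mem (by omega)) (h.mem hi) (h.isP.adj i hi) hx
  have key : ∀ {b d}, Sq G C a b c d → G.Adj (p 1) b → False := by
    intro b d q h1
    have hl := fun x (hx : x ∈ C) y (hy : y ∈ C) hxy =>
      h.opt.not_two_adj hC h4.ge (h.mem (i := L - 1) (by omega)) hx hy hxy
    have hlast : (G.Adj (p (L - 1)) a ∧ G.Adj (p (L - 1)) c) ∨ G.Adj (p (L - 1)) d := by
      by_cases hd : G.Adj (p (L - 1)) d
      · exact Or.inr hd
      · by_cases hb : G.Adj (p (L - 1)) b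
        · exact Or.inr (q.adj_of_not (h.two_le_last hyp) (fun ha => hl _ q.ma _ q.mb q.ab ha hb)
            fun hc => hl _ q.mb _ q.mc q.bc hb hc).2
        · exact Or.inl (q.rot.adj_of_not (h.two_le_last hyp) hb hd).symm
    obtain ⟨u, hu, h2⟩ := one_le_nb.1 (h.one_le hyp (i := 2) (by omega))
    have hub : u ≠ b := fun e => nc 1 (by omega) b q.mb h1 (e ▸ h2)
    have s1 := fun v hu hv => h.not_sq_split q (u := u) (v := v) h0a h1 hu hv h2
    have s2 := fun v hu hv => h.not_sq_split q.rot.rot.flip (u := u) (v := v) h0c h1 hu hv h2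
    rw [q.eq] at hu
    simp only [mem_insert, mem_singleton] at hu
    rcases hlast with ⟨ha, hc⟩ | hd
    · rcases hu with e | e | e | e
      · exact s2 _ (Or.inl e) (Or.inl rfl) ha
      · exact hub e
      · exact s1 _ (Or.inl e) (Or.inl rfl) hc
      · exact s1 _ (Or.inr e) (Or.inl rfl) hc
    · rcases hu with e | e | e | e
      · exact s2 _ (Or.inl e) (Or.inr rfl) hd
      · exact hub e
      · exact s1 _ (Or.inl e) (Or.inr rfl) hd
      · exact s1 _ (Or.inr e) (Or.inr rfl) hd
  rcases q.exists_adj_of_not (h.one_le hyp (i := 1) (by omega)) (nc 0 (by omega) a q.ma h0a)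
    (nc 0 (by omega) c q.mc h0c) with h1 | h1
  exacts [key q h1, key q.flip h1]

theorem card_le_three (h : Span G 1 L {C} p) (hyp : Hyp G 1) : C.card ≤ 3 := by
  have hL := h.four_le
  have := h.card_ne_four hyp
  by_contra hcon
  have := h.opt.nb_le_one (mem_singleton_self C) (by omega) (h.mem (i := 0) (by omega))
  have := h.two_le_first hyp
  omega

theorem first_eq_two (h : Span G 1 L {C} p) (hyp : Hyp G 1) : nb G (p 0) C = 2 := by
  have hL := h.four_le
  have hC := mem_singleton_self C
  have := h.two_le_first hyp
  have := h.opt.nb_le_three hC (h.mem (i := 0) (by omega))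
  by_contra hne
  obtain ⟨hC3, hall⟩ := h.adj_of_three hC (i := 0) (by omega) (by omega)
  have rule : ∀ v ∈ C, ∀ i j, 1 ≤ i → i < j → j < L → G.Adj (p i) v → G.Adj (p j) v → False := by
    intro v hv i j hi hij hj
    obtain ⟨b, c, t⟩ := h.opt.tri_of_mem hC hC3 hv
    exact h.opt.vert_rule h.isP hC t (hall _ t.mb) (hall _ t.mc) hi hij hj
  have hsum : ∀ v ∈ C, (decide (G.Adj (p 1) v)).toNat + (decide (G.Adj (p 2) v)).toNat +
      (decide (G.Adj (p (L - 1)) v)).toNat ≤ 1 := by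
    intro v hv
    have r1 := rule v hv 1 2 (by omega) (by omega) (by omega)
    have r2 := rule v hv 1 (L - 1) (by omega) (by omega) (by omega)
    have r3 := rule v hv 2 (L - 1) (by omega) (by omega) (by omega)
    by_cases h1 : G.Adj (p 1) v <;> by_cases h2 : G.Adj (p 2) v <;>
      by_cases h3 : G.Adj (p (L - 1)) v <;> simp_all
  obtain ⟨a, b, c, t⟩ := h.opt.tri hC hC3
  have h1 := h.one_le hyp (i := 1) (by omega)
  have h2 := h.one_le hyp (i := 2) (by omega)
  have h3 := h.two_le_last hyp
  rw [t.nb] at h1 h2 h3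
  have := hsum a t.ma
  have := hsum b t.mb
  have := hsum c t.mc
  omega

theorem first_low (h : Span G 1 L {C} p) (hyp : Hyp G 1) : nb G (p 0) univ ≤ 3 := by
  have h1 := h.isP.nb_first_le_one (fun _ => h.opt.not_core) fun u hu _ => h.span u hu
  have h2 := h.opt.fam.nb_univ (p 0)
  rw [sum_singleton, h.first_eq_two hyp] at h2
  omega

theorem exists_inner (h : Span G 1 L {C} p) (hyp : Hyp G 1) :
    ∃ i, 1 ≤ i ∧ i < L - 1 ∧ 2 ≤ nb G (p i) C := by
  have hhigh := hyp.high
  obtain ⟨v, hv, hvC⟩ := exists_mem_notMem_of_card_lt_card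
    (lt_of_lt_of_le (Nat.lt_succ_of_le (h.card_le_three hyp)) hhigh)
  replace hv := (mem_filter.1 hv).2
  obtain ⟨i, hi, rfl⟩ := h.span v (mem_rest.2 (by simpa using hvC))
  have h1 := h.first_low hyp
  have h2 : nb G (p (L - 1)) univ ≤ 3 := h.rev.first_low hyp
  have h3 := (h.inner hyp hi).1
  rw [sum_singleton] at h3
  refine ⟨i, ?_, ?_, by omega⟩
  · by_contra hcon
    obtain rfl : i = 0 := by omega
    omega
  · by_contra hcon
    obtain rfl : i = L - 1 := by omega
    omega

theorem not_tri_split (h : Span G 1 L {C} p) (t : Tri G C a b c) (h0 : G.Adj (p 0) a)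
    (h1 : G.Adj (p (L - 1)) b) (hi : 1 ≤ i) (hij : i < j) (hj : j < L - 1)
    (hu : u = b ∨ u = c) (h2 : G.Adj (p i) a) (h3 : G.Adj (p j) u) : False := by
  obtain ⟨B, hB, hBs⟩ := h.isP.core_pair hj (by omega) (notMem_rest t.mb)
    (notMem_rest t.mc) t.bc hu (Or.inl rfl) h3 h1
  refine h.opt.no_split h.isP (mem_singleton_self C) (i := 0) (S := {a}) (T := {b, c})
    hij hj.le (by omega) (by simp [t.ma]) (by simp [insert_subset_iff, t.mb, t.mc])
    (by simp [t.ab.ne, t.ac.ne])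
    (h.isP.core_vertex (i := 0) hi (by omega) (notMem_rest t.ma) h0.symm h2.symm) hB ?_ hBs
  rw [insert_eq]

theorem not_adj_of_same (h : Span G 1 L {C} p) (t : Tri G C a b c) (h0a : G.Adj (p 0) a)
    (h0b : G.Adj (p 0) b) (h1a : G.Adj (p (L - 1)) a) (h1b : G.Adj (p (L - 1)) b) (hi : 1 ≤ i)
    (hi' : i < L - 1) (hj : 1 ≤ j) (hj' : j < L - 1) (hij : i ≠ j) (hu : u = b ∨ u = c)
    (h2 : G.Adj (p i) a) (h3 : G.Adj (p j) u) : False := by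
  rcases hij.lt_or_gt with hij | hij
  · exact h.not_tri_split t h0a h1b hi hij hj' hu h2 h3
  · refine h.rev.not_tri_split (i := L - 1 - i) (j := L - 1 - j) t h1a ?_ (by omega) (by omega)
      (by omega) hu ?_ ?_
    · rwa [Nat.sub_self]
    · rwa [Nat.sub_sub_self (by omega)]
    · rwa [Nat.sub_sub_self (by omega)]

theorem false_of_same (h : Span G 1 L {C} p) (hyp : Hyp G 1) (t : Tri G C a b c)
    (h0a : G.Adj (p 0) a) (h0b : G.Adj (p 0) b) (h1a : G.Adj (p (L - 1)) a)
    (h1b : G.Adj (p (L - 1)) b) : False := by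
  have hL := h.four_le
  obtain ⟨i, hi, hi', h2⟩ := h.exists_inner hyp
  obtain ⟨j, hj, hj', hij⟩ : ∃ j, 1 ≤ j ∧ j < L - 1 ∧ i ≠ j := by
    by_cases h : i = 1
    · exact ⟨2, by omega, by omega, by omega⟩
    · exact ⟨1, by omega, by omega, by omega⟩
  have key : ∀ {a b}, Tri G C a b c → G.Adj (p 0) a → G.Adj (p 0) b → G.Adj (p (L - 1)) a →
      G.Adj (p (L - 1)) b → G.Adj (p i) a → False := by
    intro a b t h0a h0b h1a h1b hia
    have r1 := fun u hu => h.not_adj_of_same (u := u) t h0a h0b h1a h1b hi hi' hj hj' hij hu hia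
    have hja : G.Adj (p j) a := by
      obtain ⟨u, hu, hju⟩ := one_le_nb.1 (h.one_le hyp (i := j) (by omega))
      rw [t.eq] at hu
      simp only [mem_insert, mem_singleton] at hu
      rcases hu with rfl | hu
      exacts [hju, (r1 u hu hju).elim]
    have r2 := fun u hu => h.not_adj_of_same (u := u) t h0a h0b h1a h1b hj hj' hi hi' hij.symm hu hja
    have nb : ¬ G.Adj (p i) b := r2 b (Or.inl rfl)
    have nc : ¬ G.Adj (p i) c := r2 c (Or.inr rfl)
    simp [t.nb, nb, nc, hia] at h2
  by_cases hia : G.Adj (p i) a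
  · exact key t h0a h0b h1a h1b hia
  · have hib : G.Adj (p i) b := by
      by_contra hib
      have := (decide (G.Adj (p i) c)).toNat_le
      rw [t.nb] at h2
      simp only [hia, hib, decide_false, Bool.toNat_false] at h2
      omega
    exact key t.swp h0b h0a h1b h1a hib

theorem false_of_shift (h : Span G 1 L {C} p) (hyp : Hyp G 1) (t : Tri G C a b c)
    (h0a : G.Adj (p 0) a) (h0b : G.Adj (p 0) b) (h1b : G.Adj (p (L - 1)) b)
    (h1c : G.Adj (p (L - 1)) c) : False := by
  obtain ⟨i, hi, hi', h2⟩ := h.exists_inner hyp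
  have hC := mem_singleton_self C
  have nc : ¬ G.Adj (p i) c := fun hic =>
    h.opt.vert_rule h.isP hC t.rot h0a h0b hi hi' (by omega) hic h1c
  have na : ¬ G.Adj (p i) a := fun hia => by
    refine h.opt.vert_rule h.rev.isP hC t (i := L - 1 - i) (j := L - 1) h1b h1c
      (by omega) (by omega) (by omega) ?_ ?_
    · rwa [Nat.sub_sub_self (by omega)]
    · rwa [Nat.sub_self]
  have := (decide (G.Adj (p i) b)).toNat_le
  rw [t.nb] at h2
  simp only [na, nc, decide_false, Bool.toNat_false] at h2
  omega

theorem false {m : ℕ} {𝒞 : Finset (Finset V)} (h : Span G m L 𝒞 p) (hyp : Hyp G m) : False := by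
  obtain rfl := h.eq_one hyp
  obtain ⟨C, rfl⟩ := card_eq_one.1 h.opt.card
  have hC := mem_singleton_self C
  obtain ⟨_, _, _, t⟩ := h.opt.tri hC (h.card_le_three hyp)
  obtain ⟨a, ha, b, hb, hab, h0a, h0b⟩ := two_le_nb.1 (h.two_le_first hyp)
  obtain ⟨c, t⟩ := t.exists_third ha hb hab
  have hl := h.two_le_last hyp
  have h2 := h.rev.first_eq_two hyp
  by_cases h1a : G.Adj (p (L - 1)) a <;> by_cases h1b : G.Adj (p (L - 1)) b
  · exact h.false_of_same hyp t h0a h0b h1a h1b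
  · rw [t.nb] at hl
    have h1c : G.Adj (p (L - 1)) c := by
      by_contra h1c
      simp [h1a, h1b, h1c] at hl
    exact h.false_of_shift hyp t.swp h0b h0a h1a h1c
  · rw [t.nb] at hl
    have h1c : G.Adj (p (L - 1)) c := by
      by_contra h1c
      simp [h1a, h1b, h1c] at hl
    exact h.false_of_shift hyp t h0a h0b h1b h1c
  · rw [t.nb] at hl
    have := (decide (G.Adj (p (L - 1)) c)).toNat_le
    simp only [h1a, h1b, decide_false, Bool.toNat_false] at hl
    omega

end Span

end

section

variable {V : Type*} {G H : SimpleGraph V}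

theorem nb_le_of_le (h : G ≤ H) (v : V) (S : Finset V) : nb G v S ≤ nb H v S :=
  card_le_card (monotone_filter_right S fun _ _ hu => h hu)

theorem Core.of_adj {C : Finset V} (h : Core H C)
    (hadj : ∀ v ∈ C, ∀ u ∈ C, H.Adj v u → G.Adj v u) : Core G C :=
  ⟨h.1, fun v hv => (h.2 v hv).trans (card_le_card fun _ hu =>
    mem_filter.2 ⟨(mem_filter.1 hu).1, hadj v hv _ (mem_filter.1 hu).1 (mem_filter.1 hu).2⟩)⟩

theorem Core.of_sup_edge {x y : V} {C : Finset V} (h : Core (G ⊔ SimpleGraph.edge x y) C)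
    (hxy : x ∈ C → y ∉ C) : Core G C := by
  refine h.of_adj fun v hv u hu hvu => ?_
  rw [SimpleGraph.sup_adj, SimpleGraph.edge_adj] at hvu
  rcases hvu with hvu | ⟨⟨rfl, rfl⟩ | ⟨rfl, rfl⟩, -⟩
  exacts [hvu, (hxy hv hu).elim, (hxy hu hv).elim]

theorem exists_fam_of_universal (n : ℕ) {S T : Finset V} (hS : 2 * n ≤ S.card)
    (hT : n ≤ T.card) (hST : Disjoint S T) (huniv : ∀ v ∈ S, ∀ u, u ≠ v → G.Adj v u) :
    ∃ 𝒟, Fam G 𝒟 ∧ 𝒟.card = n ∧ ∀ C ∈ 𝒟, C ⊆ S ∪ T := by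
  induction n generalizing S T with
  | zero => exact ⟨∅, ⟨by simp, by simp⟩, rfl, by simp⟩
  | succ n ih =>
    obtain ⟨a, ha, b, hb, hab⟩ := one_lt_card.1 (show 1 < S.card by omega)
    obtain ⟨t, ht⟩ := card_pos.1 (show 0 < T.card by omega)
    have hb' : b ∈ S.erase a := mem_erase.2 ⟨hab.symm, hb⟩
    obtain ⟨𝒟, h1, h2, h3⟩ := ih (S := (S.erase a).erase b) (T := T.erase t)
      (by rw [card_erase_of_mem hb', card_erase_of_mem ha]; omega)
      (by rw [card_erase_of_mem ht]; omega)
      (hST.mono ((erase_subset _ _).trans (erase_subset _ _)) (erase_subset _ _))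
      fun v hv => huniv v (mem_of_mem_erase (mem_of_mem_erase hv))
    have hn : ∀ s ∈ S, t ≠ s := fun s hs e => disjoint_left.1 hST hs (e ▸ ht)
    obtain ⟨h4, h5⟩ := h1.insertCore (core_triple (huniv a ha b hab.symm)
      (huniv a ha t (hn a ha)) (huniv b hb t (hn b hb))) fun C hC => by
        refine disjoint_of_subset_right (h3 C hC) ?_
        simp only [disjoint_insert_left, disjoint_singleton_left, mem_union, mem_erase]
        have := disjoint_left.1 hST ha
        have := disjoint_left.1 hST hb
        have := disjoint_right.1 hST ht
        tauto
    refine ⟨_, h4, by rw [card_insert_of_notMem h5, h2], fun C hC => ?_⟩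
    rcases mem_insert.1 hC with rfl | hC
    · simp [insert_subset_iff, ha, hb, ht]
    · exact (h3 C hC).trans (union_subset_union ((erase_subset _ _).trans (erase_subset _ _))
        (erase_subset _ _))

variable [Fintype V] {m : ℕ} {𝒞 𝒟 : Finset (Finset V)}

theorem Opt.card_rest_le (h : Opt G m 𝒞) (hF : Fam G 𝒟) (hc : 𝒟.card = m) :
    (rest 𝒟).card ≤ (rest 𝒞).card := by
  have := h.min 𝒟 hF hc
  have := hF.sum_card
  have := h.fam.sum_card
  omega

theorem Opt.of_card_rest_le (h : Opt G m 𝒞) (hF : Fam G 𝒟) (hc : 𝒟.card = m)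
    (hle : (rest 𝒞).card ≤ (rest 𝒟).card) : Opt G m 𝒟 := by
  refine ⟨hF, hc, fun ℰ hE hEc => ?_, h.noPack⟩
  have := h.min ℰ hE hEc
  have := hF.sum_card
  have := h.fam.sum_card
  omega

theorem exists_opt (hF : Fam G 𝒟) (hc : 𝒟.card = m)
    (hno : ∀ 𝒟, Fam G 𝒟 → 𝒟.card ≠ m + 1) : ∃ 𝒞, Opt G m 𝒞 := by
  obtain ⟨𝒞, h1, h2⟩ := exists_min_image (univ.filter fun 𝒟 => Fam G 𝒟 ∧ 𝒟.card = m)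
    (fun 𝒟 => ∑ C ∈ 𝒟, C.card) ⟨𝒟, by simp [hF, hc]⟩
  simp only [mem_filter, mem_univ, true_and] at h1 h2
  exact ⟨𝒞, h1.1, h1.2, fun ℰ hE hEc => h2 ℰ ⟨hE, hEc⟩, hno⟩

theorem Opt.card_rest_lt (h : Opt G m 𝒞) (hyp : Hyp G m) : (rest 𝒞).card < 4 := by
  by_contra hcon
  obtain ⟨v, hv⟩ := card_pos.1 (show 0 < (rest 𝒞).card by omega)
  obtain ⟨L, ⟨𝒟, p, hD, hp⟩, hmax⟩ := exists_max_nat (n := 1) (N := Fintype.card V)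
    (P := fun k => ∃ 𝒟 p, Opt G m 𝒟 ∧ IsP G p k (rest 𝒟)) ⟨𝒞, _, h, IsP.single hv⟩
    fun k ⟨𝒟, p, _, hp⟩ => hp.card_le.trans (card_le_univ _)
  have hM : Max G m L 𝒟 p := ⟨hD, hp, fun ℰ q k hE hq => hmax k ⟨ℰ, q, hE, hq⟩⟩
  have hR := hD.card_rest_le h.fam h.card
  have hL := hM.two_le hyp (hmax 1 ⟨𝒞, _, h, IsP.single hv⟩) (by omega)
  by_cases hspan : ∃ v ∈ rest 𝒟, ∀ i < L, p i ≠ v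
  · obtain ⟨z, hz, hzp, hleaf⟩ := hM.exists_leaf hL hspan
    exact hM.false_of_leaf hyp hL hz hzp hleaf
  · push Not at hspan
    refine Span.false ⟨hD, hp, ?_, hspan⟩ hyp
    have : (rest 𝒟).card ≤ ((range L).image p).card := card_le_card fun v hv => by
      obtain ⟨i, hi, e⟩ := hspan v hv
      exact mem_image.2 ⟨i, mem_range.2 hi, e⟩
    have := this.trans card_image_le
    rw [card_range] at this
    omega

theorem Hyp.exists_not_adj (h : Hyp G m) :
    ∃ x y, 2 * m + 2 ≤ nb G x univ ∧ x ≠ y ∧ ¬ G.Adj x y := by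
  by_contra! hcon
  obtain ⟨S, hS, hcard⟩ := exists_subset_card_eq h.high
  have := h.card
  obtain ⟨𝒟, h1, h2, -⟩ := exists_fam_of_universal (G := G) (m + 1) (S := S) (T := Sᶜ)
    (by omega) (by rw [card_compl]; omega) disjoint_compl_right
    fun v hv u hne => hcon v u (mem_filter.1 (hS hv)).2 hne.symm
  exact h.noPack 𝒟 h1 h2

theorem not_hyp : ¬ Hyp G m := by
  intro hyp
  induction G using WellFoundedGT.induction with
  | ind G ih =>
  obtain ⟨x, y, hx, hxy, hadj⟩ := hyp.exists_not_adj
  have hle : G ≤ G ⊔ SimpleGraph.edge x y := le_sup_left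
  have hlt : G < G ⊔ SimpleGraph.edge x y := by
    refine lt_of_le_of_ne hle fun e => hadj ?_
    rw [e]
    exact Or.inr ((SimpleGraph.edge_adj x y x y).2 ⟨Or.inl ⟨rfl, rfl⟩, hxy⟩)
  obtain ⟨𝒟, hD, hDc⟩ : ∃ 𝒟, Fam (G ⊔ SimpleGraph.edge x y) 𝒟 ∧ 𝒟.card = m + 1 := by
    by_contra! hcon
    refine ih _ hlt ⟨hyp.pos, hyp.card, fun v => (hyp.deg v).trans (nb_le_of_le hle v _),
      hyp.high.trans (card_le_card fun v hv => ?_), hcon⟩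
    exact mem_filter.2 ⟨mem_univ v, (mem_filter.1 hv).2.trans (nb_le_of_le hle v _)⟩
  obtain ⟨A, hA, hxA, hyA⟩ : ∃ A ∈ 𝒟, x ∈ A ∧ y ∈ A := by
    by_contra! hcon
    exact hyp.noPack 𝒟 ⟨fun C hC => (hD.core C hC).of_sup_edge (hcon C hC), hD.disj⟩ hDc
  have hF : Fam G (𝒟.erase A) := by
    refine ⟨fun C hC => ?_, (hD.mono (erase_subset _ _)).disj⟩
    obtain ⟨hCA, hC⟩ := mem_erase.1 hC
    exact (hD.core C hC).of_sup_edge fun hxC _ => disjoint_left.1 (hD.disj C hC A hA hCA) hxC hxA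
  have hc : (𝒟.erase A).card = m := by rw [card_erase_of_mem hA, hDc, Nat.add_sub_cancel]
  have hAR : A ⊆ rest (𝒟.erase A) := fun v hv => mem_rest.2 fun C hC hvC => by
    obtain ⟨hCA, hC⟩ := mem_erase.1 hC
    exact disjoint_left.1 (hD.disj C hC A hA hCA) hvC hv
  obtain ⟨𝒞, h𝒞⟩ := exists_opt hF hc hyp.noPack
  have h1 := h𝒞.card_rest_lt hyp
  have h2 := h𝒞.card_rest_le hF hc
  have h3 := (hD.core A hA).three_le_card
  have h4 := card_le_card hAR
  have hopt := h𝒞.of_card_rest_le hF hc (by omega)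
  have hAe : A = rest (𝒟.erase A) := eq_of_subset_of_card_le hAR (by omega)
  obtain ⟨_, _, _, h5, h6, h7, e⟩ := (hD.core A hA).exists_triangle (by omega)
  obtain ⟨z, t⟩ := Tri.exists_third ⟨h5, h6, h7, e⟩ hxA hyA hxy
  have adj : ∀ v, G.Adj v z ∨ ((v = x ∧ z = y) ∨ (v = y ∧ z = x)) ∧ v ≠ z → G.Adj v z := by
    rintro v (h | ⟨⟨-, h⟩ | ⟨-, h⟩, -⟩)
    exacts [h, (t.bc.ne h.symm).elim, (t.ac.ne h.symm).elim]
  have hxz : G.Adj x z := adj x (by simpa [SimpleGraph.edge_adj] using t.ac)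
  have hyz : G.Adj y z := adj y (by simpa [SimpleGraph.edge_adj] using t.bc)
  exact Cfg.false (x := x) (y := z) (z := y) ⟨hopt, by rw [← hAe, t.swp'.eq], hxz, hyz.symm, hxy⟩
    hyp (Or.inl hx)

end

section

variable {V : Type*} {G : SimpleGraph V}

theorem IsP.exists_walk {p : ℕ → V} {n : ℕ} {X : Finset V} (h : IsP G p n X) {i : ℕ}
    (hi : i < n) : ∃ w : G.Walk (p i) (p 0), w.IsPath ∧ w.length = i ∧
      ∀ v ∈ w.support, ∃ j ≤ i, p j = v := by
  induction i with
  | zero => exact ⟨.nil, .nil, rfl, by simp⟩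
  | succ i ih =>
    obtain ⟨w, hw, hlen, hs⟩ := ih (by omega)
    refine ⟨.cons (h.adj i hi).symm w, hw.cons fun hmem => ?_, by simp [hlen], fun v hv => ?_⟩
    · obtain ⟨j, hj, e⟩ := hs _ hmem
      exact h.ne (by omega) hi (by omega) e
    · rw [SimpleGraph.Walk.support_cons, List.mem_cons] at hv
      rcases hv with rfl | hv
      · exact ⟨_, le_rfl, rfl⟩
      · obtain ⟨j, hj, e⟩ := hs v hv
        exact ⟨j, by omega, e⟩

theorem Core.exists_cycle_walk {S : Finset V} (h : Core G S) :
    ∃ c : (v : V) × G.Walk v v, c.2.IsCycle ∧ ∀ v ∈ c.2.support, v ∈ S := by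
  obtain ⟨p, j, hp, hj, hadj⟩ := h.exists_chord
  obtain ⟨w, hw, hlen, hs⟩ := hp.exists_walk (i := j) (by omega)
  have hS : ∀ v ∈ w.support, v ∈ S := fun v hv => by
    obtain ⟨i, hi, rfl⟩ := hs v hv
    exact hp.mem i (by omega)
  refine ⟨⟨p 0, .cons hadj w⟩, (SimpleGraph.Walk.cons_isCycle_iff _ _).2 ⟨hw, fun hmem => ?_⟩,
    fun v hv => ?_⟩
  · rw [Sym2.eq_swap] at hmem
    have := hw.length_eq_one_of_mem_edges hmem
    omega
  · rw [SimpleGraph.Walk.support_cons, List.mem_cons] at hv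
    rcases hv with rfl | hv
    exacts [hp.mem 0 (by omega), hS v hv]

theorem Fam.hasDisjointCycles {𝒟 : Finset (Finset V)} (h : Fam G 𝒟) {k : ℕ} (hk : 𝒟.card = k) :
    HasDisjointCycles G k := by
  choose c hc hs using fun C : 𝒟 => (h.core C C.2).exists_cycle_walk
  let e := (𝒟.equivFinOfCardEq hk).symm
  refine ⟨fun i => c (e i), fun i => hc _, fun i j hij v hvi hvj => ?_⟩
  exact disjoint_left.1 (h.disj _ (e i).2 _ (e j).2 fun h => hij (e.injective (Subtype.ext h)))
    (hs _ v hvi) (hs _ v hvj)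

theorem nb_univ_eq_degree [Fintype V] [DecidableRel G.Adj] (v : V) :
    nb G v univ = G.degree v := by
  rw [← SimpleGraph.card_neighborFinset_eq_degree, nb]
  congr 1
  ext u
  simp

end

end DisjointCycles

/-- Corollary of Kierstead–Kostochka–Yeager: if `|G| ≥ 3k`, `|H_k(G)| ≥ 2k` and
`δ(G) ≥ 2k - 1` (i.e. `L_k(G) = ∅`), then `G` contains `k` disjoint cycles. -/
theorem kky_corollary {V : Type*} [Fintype V] (G : SimpleGraph V) [DecidableRel G.Adj]
    (k : ℕ) (hk : 2 ≤ k) (hcard : 3 * k ≤ Fintype.card V)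
    (hhigh : 2 * k ≤ (highSet G k).card)
    (hdeg : ∀ v : V, 2 * k - 1 ≤ G.degree v) :
    HasDisjointCycles G k := by
  obtain ⟨m, rfl⟩ : ∃ m, k = m + 1 := ⟨k - 1, by omega⟩
  by_contra hcon
  refine DisjointCycles.not_hyp (G := G) (m := m) ⟨by omega, by omega, fun v => ?_, ?_,
    fun 𝒟 hD hc => hcon (hD.hasDisjointCycles hc)⟩
  · rw [DisjointCycles.nb_univ_eq_degree]
    have := hdeg v
    omega
  · refine hhigh.trans (Finset.card_le_card fun v hv => ?_)
    rw [Finset.mem_filter, DisjointCycles.nb_univ_eq_degree]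
    exact ⟨Finset.mem_univ v, (Finset.mem_filter.1 hv).2⟩
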